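/- Let Ω ⊆ 𝔻 be an open connected set and {u_k} a sequence of minimal graphs on Ω whose divergence set is empty, i.e. sup_k |∇₀u_k(p)| < ∞ for every p ∈ Ω. Then for every p ∈ Ω, a subsequence of {u_k − u_k(p)} converges uniformly on compact subsets of Ω to a minimal graph on Ω. -/

import Mathlib

noncomputable section

open Filter MeasureTheory Set Topology
open scoped RealInnerProductSpace Topology

/-- The Euclidean plane, as a Euclidean space. -/
abbrev E2 : Type := EuclideanSpace ℝ (Fin 2)

/-- The Poincaré disk. -/
def Disk : Set E2 := {p : E2 | ‖p‖ < 1}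

/-- Conformal factor of the hyperbolic metric. -/
def lam (p : E2) : ℝ := 2 / (1 - ‖p‖ ^ 2)

/-- Inverse hyperbolic cosine. -/
def arcosh (x : ℝ) : ℝ := Real.log (x + Real.sqrt (x ^ 2 - 1))

/-- Hyperbolic distance on the Poincaré disk. -/
def hDist (p q : E2) : ℝ :=
  arcosh (1 + 2 * ‖p - q‖ ^ 2 / ((1 - ‖p‖ ^ 2) * (1 - ‖q‖ ^ 2)))

/-- Hyperbolic distance from a point to a set. -/
def hDistSet (a : E2) (S : Set E2) : ℝ := sInf (hDist a '' S)

/-- Hyperbolic length of a subset of the disk, via the 1-dimensional Hausdorff measure. -/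
def hLen (S : Set E2) : ℝ := ∫ p in S, lam p ∂(μH[1])

/-- Hyperbolic length of a parametrized curve. -/
def hLength (γ : ℝ → E2) (a b : ℝ) : ℝ := ∫ t in a..b, lam (γ t) * ‖deriv γ t‖

/-- The Poincaré-to-Klein point transfer map. -/
def toKlein (p : E2) : E2 := (2 / (1 + ‖p‖ ^ 2)) • p

/-- The geodesic arc of the Poincaré disk joining two points of the closed disk:
the preimage in the disk of the Euclidean segment joining the corresponding Klein-model
points.  (It contains its endpoints when these are interior, and an ideal endpoint is
automatically excluded.) -/
def geodArc (a b : E2) : Set E2 :=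
  {p : E2 | p ∈ Disk ∧ ∃ t ∈ Icc (0:ℝ) 1, toKlein p = (1 - t) • toKlein a + t • toKlein b}

/-- Hyperbolic convexity. -/
def HypConvex (S : Set E2) : Prop := ∀ a ∈ S, ∀ b ∈ S, geodArc a b ⊆ S

/-- The open hyperbolic disk of radius `R` centered at the origin. -/
def hBall (R : ℝ) : Set E2 := {p ∈ Disk | hDist 0 p < R}

/-- The normalized horizontal projection of the downward normal of the graph of `u`:
`X_u = ∇₀u / √(1 + λ⁻²·|∇₀u|²)`. -/
def Xfield (u : E2 → ℝ) (p : E2) : E2 :=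
  (Real.sqrt (1 + ((lam p)⁻¹) ^ 2 * ‖gradient u p‖ ^ 2))⁻¹ • gradient u p

/-- Euclidean divergence of a planar vector field. -/
def div0 (X : E2 → E2) (p : E2) : ℝ :=
  ∑ i : Fin 2, fderiv ℝ X p (EuclideanSpace.single i 1) i

/-- `u` is a minimal graph on `Ω`: smooth and satisfying the minimal surface equation
`div₀(∇₀u / √(1 + λ⁻²·|∇₀u|²)) = 0`. -/
def IsMinimalGraph (Ω : Set E2) (u : E2 → ℝ) : Prop :=
  ContDiffOn ℝ (⊤ : ℕ∞) u Ω ∧ ∀ p ∈ Ω, div0 (Xfield u) p = 0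

/-- Rotation by `-90°`, turning a tangent vector into a normal vector of the same length. -/
def Jrot (v : E2) : E2 :=
  v 1 • EuclideanSpace.single (0 : Fin 2) (1:ℝ) - v 0 • EuclideanSpace.single (1 : Fin 2) (1:ℝ)

/-- Flux of the vector field `X` along the curve `γ : [a,b] → E2`, with respect to the
normal `Jrot (γ')`:  `∫ ⟨X, η₀⟩ ds₀`. -/
def fluxV (X : E2 → E2) (γ : ℝ → E2) (a b : ℝ) : ℝ :=
  ∫ t in a..b, ⟪X (γ t), Jrot (deriv γ t)⟫

/-- A piecewise `C¹` curve on `[a,b]`. -/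
def PiecewiseC1On (γ : ℝ → E2) (a b : ℝ) : Prop :=
  ContinuousOn γ (Icc a b) ∧
  ∃ s : Finset ℝ, ∀ t ∈ Icc a b, t ∉ s → DifferentiableAt ℝ γ t ∧ ContinuousAt (deriv γ) t

/-- `η` points outward from `Ω` at the boundary point `x`. -/
def OutwardNormalAt (Ω : Set E2) (x η : E2) : Prop :=
  ∀ᶠ ε : ℝ in 𝓝[>] (0:ℝ), x - ε • η ∈ Ω ∧ x + ε • η ∉ closure Ω

/-- A horocycle at an ideal point: a Euclidean circle tangent to the unit circle
from inside at `pt`, with Euclidean radius `r`. -/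
structure Horocycle where
  pt : E2
  r : ℝ
  hpt : ‖pt‖ = 1
  hr0 : 0 < r
  hr1 : r < 1

/-- The horocycle as a subset of the disk (the circle itself). -/
def Horocycle.circle (H : Horocycle) : Set E2 := {p : E2 | ‖p - (1 - H.r) • H.pt‖ = H.r}

/-- The open horodisk bounded by a horocycle. -/
def Horocycle.horodisk (H : Horocycle) : Set E2 := {p : E2 | ‖p - (1 - H.r) • H.pt‖ < H.r}

/-- A semi-ideal polygonal domain with `k` ideal vertices `pI i` and `k` interior
vertices `pB i`, cyclically ordered as `pI 0, pB 0, pI 1, pB 1, …`; its edges are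
`A i = geodArc (pI i) (pB i)` and `B i = geodArc (pB i) (pI (i+1))`, and its boundary
inside the disk is exactly the union of the edges. -/
structure SemiIdealDomain (k : ℕ) where
  Ω : Set E2
  pI : ZMod k → E2
  pB : ZMod k → E2
  k_pos : 0 < k
  isOpen : IsOpen Ω
  conn : IsConnected Ω
  subset : Ω ⊆ Disk
  ideal : ∀ i, ‖pI i‖ = 1
  inter : ∀ i, pB i ∈ Disk
  injI : Function.Injective pI
  injB : Function.Injective pB
  boundary : frontier Ω ∩ Disk =
    (⋃ i, geodArc (pI i) (pB i)) ∪ (⋃ i, geodArc (pB i) (pI (i + 1)))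

/-- The edge `A i` of a semi-ideal domain. -/
def SemiIdealDomain.edgeA {k : ℕ} (D : SemiIdealDomain k) (i : ZMod k) : Set E2 :=
  geodArc (D.pI i) (D.pB i)

/-- The edge `B i` of a semi-ideal domain. -/
def SemiIdealDomain.edgeB {k : ℕ} (D : SemiIdealDomain k) (i : ZMod k) : Set E2 :=
  geodArc (D.pB i) (D.pI (i + 1))

/-- The open edge `A i` (without its endpoints). -/
def SemiIdealDomain.intEdgeA {k : ℕ} (D : SemiIdealDomain k) (i : ZMod k) : Set E2 :=
  D.edgeA i \ {D.pI i, D.pB i}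

/-- The open edge `B i` (without its endpoints). -/
def SemiIdealDomain.intEdgeB {k : ℕ} (D : SemiIdealDomain k) (i : ZMod k) : Set E2 :=
  D.edgeB i \ {D.pB i, D.pI (i + 1)}

/-- A general polygonal domain in the Poincaré disk, with cyclically ordered
vertices `q j` (interior or ideal) and geodesic edges. -/
structure PolygonalDomain where
  P : Set E2
  m : ℕ
  q : ZMod m → E2
  m_pos : 0 < m
  isOpen : IsOpen P
  conn : IsConnected P
  subset : P ⊆ Disk
  vtx : ∀ j, ‖q j‖ ≤ 1
  boundary : frontier P ∩ Disk = ⋃ j, geodArc (q j) (q (j + 1))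

/-- A polygonal domain inscribed in a semi-ideal domain: contained in it and all of its
vertices are vertices of the ambient domain. -/
def InscribedIn {k : ℕ} (Q : PolygonalDomain) (D : SemiIdealDomain k) : Prop :=
  Q.P ⊆ D.Ω ∧ ∀ j, Q.q j ∈ Set.range D.pI ∪ Set.range D.pB

/-- `Γ(𝒫)`: the part of `∂𝒫` (inside the disk) lying outside the horodisks. -/
def GammaSet {k : ℕ} (Q : PolygonalDomain) (H : ZMod k → Horocycle) : Set E2 :=
  (frontier Q.P ∩ Disk) \ ⋃ i, (H i).horodisk

/-- `|Γ(𝒫)|`. -/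
def gammaLen {k : ℕ} (Q : PolygonalDomain) (H : ZMod k → Horocycle) : ℝ :=
  hLen (GammaSet Q H)

/-- `α(𝒫) = Σ_i |A_i ∩ Γ(𝒫)|`. -/
def alphaVal {k : ℕ} (D : SemiIdealDomain k) (H : ZMod k → Horocycle)
    (Q : PolygonalDomain) : ℝ :=
  letI : NeZero k := ⟨D.k_pos.ne'⟩
  ∑ i : ZMod k, hLen (D.edgeA i ∩ GammaSet Q H)

/-- `β(𝒫) = Σ_i |B_i ∩ Γ(𝒫)|`. -/
def betaVal {k : ℕ} (D : SemiIdealDomain k) (H : ZMod k → Horocycle)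
    (Q : PolygonalDomain) : ℝ :=
  letI : NeZero k := ⟨D.k_pos.ne'⟩
  ∑ i : ZMod k, hLen (D.edgeB i ∩ GammaSet Q H)

/-- An admissible domain. -/
def Admissible {k : ℕ} (D : SemiIdealDomain k) : Prop :=
  HypConvex D.Ω ∧
  ∃ H : ZMod k → Horocycle,
    (∀ i, (H i).pt = D.pI i) ∧
    (∀ i j, i ≠ j → Disjoint (H i).circle (H j).circle) ∧
    (∀ i, hDistSet (D.pB (i - 1)) (H i).circle = hDistSet (D.pB i) (H i).circle) ∧
    (∀ Q : PolygonalDomain, InscribedIn Q D → Q.P ≠ D.Ω →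
      2 * alphaVal D H Q < gammaLen Q H ∧ 2 * betaVal D H Q < gammaLen Q H)

/-- The Jenkins–Serrin boundary conditions: `u → +∞` on the interior of each edge `A i`,
and `u → −∞` on the interior of each edge `B i`. -/
def JSBoundary {k : ℕ} (D : SemiIdealDomain k) (u : E2 → ℝ) : Prop :=
  (∀ i, ∀ x ∈ D.intEdgeA i, Tendsto u (𝓝[D.Ω] x) atTop) ∧
  (∀ i, ∀ x ∈ D.intEdgeB i, Tendsto u (𝓝[D.Ω] x) atBot)

/-- An admissible pair. -/
def AdmissiblePair {k : ℕ} (D : SemiIdealDomain k) (u : E2 → ℝ) : Prop :=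
  Admissible D ∧ (0 : E2) ∈ D.Ω ∧ u 0 = 0 ∧ IsMinimalGraph D.Ω u ∧ JSBoundary D u

/-- The divergence set of a sequence of minimal graphs. -/
def DivergenceSet (Ω : Set E2) (u : ℕ → E2 → ℝ) : Set E2 :=
  {p ∈ Ω | ¬ ∃ C : ℝ, ∀ k, ‖gradient (u k) p‖ ≤ C}

open scoped ContDiff

/-! ### Directional derivatives -/

/-- `f` is differentiable at `p` with derivative `d` in the direction `v`. -/
def HasD (v : E2) (f : E2 → ℝ) (p : E2) (d : ℝ) : Prop :=
  DifferentiableAt ℝ f p ∧ fderiv ℝ f p v = d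

/-- The derivative of `f` along the vector field `V`. -/
def vd (V : E2 → E2) (f : E2 → ℝ) (p : E2) : ℝ := fderiv ℝ f p (V p)

/-- The coordinate partial derivatives. -/
def pd (i : Fin 2) (f : E2 → ℝ) (p : E2) : ℝ := fderiv ℝ f p (EuclideanSpace.single i 1)

namespace HasD

variable {v p : E2} {f g : E2 → ℝ} {a b : ℝ}

lemma const (v p : E2) (c : ℝ) : HasD v (fun _ => c) p 0 :=
  ⟨differentiableAt_const c, by simp⟩

lemma add (hf : HasD v f p a) (hg : HasD v g p b) : HasD v (fun x => f x + g x) p (a + b) :=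
  ⟨hf.1.add hg.1, by rw [fderiv_fun_add hf.1 hg.1]; simp [hf.2, hg.2]⟩

lemma sub (hf : HasD v f p a) (hg : HasD v g p b) : HasD v (fun x => f x - g x) p (a - b) :=
  ⟨hf.1.sub hg.1, by rw [fderiv_fun_sub hf.1 hg.1]; simp [hf.2, hg.2]⟩

lemma neg (hf : HasD v f p a) : HasD v (fun x => -f x) p (-a) :=
  ⟨hf.1.neg, by rw [fderiv_fun_neg]; simp [hf.2]⟩

lemma mul (hf : HasD v f p a) (hg : HasD v g p b) :
    HasD v (fun x => f x * g x) p (a * g p + f p * b) :=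
  ⟨hf.1.mul hg.1, by rw [fderiv_fun_mul hf.1 hg.1]; simp [hf.2, hg.2]; ring⟩

lemma const_mul (hf : HasD v f p a) (c : ℝ) : HasD v (fun x => c * f x) p (c * a) := by
  simpa using (const v p c).mul hf

lemma sq (hf : HasD v f p a) : HasD v (fun x => f x ^ 2) p (2 * f p * a) := by
  have h := hf.mul hf
  convert h using 2 <;> ring

lemma comp {φ : ℝ → ℝ} {c : ℝ} (hφ : HasDerivAt φ c (f p)) (hf : HasD v f p a) :
    HasD v (fun x => φ (f x)) p (c * a) := by
  have h := hφ.comp_hasFDerivAt p hf.1.hasFDerivAt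
  exact ⟨h.differentiableAt, by
    have := h.fderiv
    simp only [Function.comp_def] at this
    rw [this]; simp [hf.2]⟩

lemma inv (hf : HasD v f p a) (h0 : f p ≠ 0) :
    HasD v (fun x => (f x)⁻¹) p (-a / f p ^ 2) := by
  have := comp (hasDerivAt_inv h0) hf
  convert this using 1
  field_simp

lemma div (hf : HasD v f p a) (hg : HasD v g p b) (h0 : g p ≠ 0) :
    HasD v (fun x => f x / g x) p ((a * g p - f p * b) / g p ^ 2) := by
  have := hf.mul (hg.inv h0)
  simp only [div_eq_mul_inv]
  convert this using 1
  field_simp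
  ring

lemma sum {ι : Type*} (s : Finset ι) {f : ι → E2 → ℝ} {a : ι → ℝ}
    (h : ∀ i ∈ s, HasD v (f i) p (a i)) : HasD v (fun x => ∑ i ∈ s, f i x) p (∑ i ∈ s, a i) := by
  refine ⟨DifferentiableAt.fun_sum fun i hi => (h i hi).1, ?_⟩
  rw [fderiv_fun_sum fun i hi => (h i hi).1]
  simp only [_root_.sum_apply]
  exact Finset.sum_congr rfl fun i hi => (h i hi).2

lemma congr_of_eventuallyEq (hf : HasD v f p a) (h : g =ᶠ[𝓝 p] f) : HasD v g p a :=
  ⟨hf.1.congr_of_eventuallyEq h, by rw [h.fderiv_eq]; exact hf.2⟩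

lemma congr_on {N : Set E2} (hN : IsOpen N) (hp : p ∈ N) (hf : HasD v f p a)
    (h : ∀ x ∈ N, g x = f x) : HasD v g p a :=
  hf.congr_of_eventuallyEq (Filter.eventually_of_mem (hN.mem_nhds hp) h)

lemma coord (v p : E2) (i : Fin 2) : HasD v (fun x => x i) p (v i) := by
  have h : HasFDerivAt (fun x : E2 => x i) (EuclideanSpace.proj (𝕜 := ℝ) i) p :=
    (EuclideanSpace.proj (𝕜 := ℝ) (i : Fin 2) : E2 →L[ℝ] ℝ).hasFDerivAt
  exact ⟨h.differentiableAt, by rw [h.fderiv]; rfl⟩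

lemma unique (h : HasD v f p a) (h' : HasD v f p b) : a = b := h.2.symm.trans h'.2

end HasD

lemma E2.eq_sum (v : E2) :
    v = v 0 • EuclideanSpace.single (0 : Fin 2) (1:ℝ) + v 1 • EuclideanSpace.single (1 : Fin 2) (1:ℝ) := by
  ext i; fin_cases i <;> simp

lemma fderiv_eq_pd (f : E2 → ℝ) (p v : E2) :
    fderiv ℝ f p v = v 0 * pd 0 f p + v 1 * pd 1 f p := by
  conv_lhs => rw [E2.eq_sum v]
  simp [pd]

lemma vd_eq_pd (V : E2 → E2) (f : E2 → ℝ) (p : E2) :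
    vd V f p = V p 0 * pd 0 f p + V p 1 * pd 1 f p := fderiv_eq_pd f p (V p)

lemma E2.norm_sq (p : E2) : ‖p‖ ^ 2 = p 0 ^ 2 + p 1 ^ 2 := by
  rw [EuclideanSpace.real_norm_sq_eq, Fin.sum_univ_two]

section SmoothOn

variable {N : Set E2} {f g : E2 → ℝ} {V W : E2 → E2} {p : E2}

lemma hasD_vd (hN : IsOpen N) (hf : ContDiffOn ℝ ∞ f N) (hp : p ∈ N) :
    HasD (V p) f p (vd V f p) :=
  ⟨(hf.differentiableOn (by simp)).differentiableAt (hN.mem_nhds hp), rfl⟩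

lemma hasD_pd (hN : IsOpen N) (hf : ContDiffOn ℝ ∞ f N) (hp : p ∈ N) (i : Fin 2) :
    HasD (EuclideanSpace.single i 1) f p (pd i f p) :=
  ⟨(hf.differentiableOn (by simp)).differentiableAt (hN.mem_nhds hp), rfl⟩

lemma smooth_fderiv (hN : IsOpen N) (hf : ContDiffOn ℝ ∞ f N) :
    ContDiffOn ℝ ∞ (fderiv ℝ f) N :=
  ((contDiffOn_infty_iff_fderiv_of_isOpen hN).1 hf).2

lemma smooth_vd (hN : IsOpen N) (hf : ContDiffOn ℝ ∞ f N) (hV : ContDiffOn ℝ ∞ V N) :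
    ContDiffOn ℝ ∞ (vd V f) N :=
  (smooth_fderiv hN hf).clm_apply hV

lemma smooth_pd (hN : IsOpen N) (hf : ContDiffOn ℝ ∞ f N) (i : Fin 2) :
    ContDiffOn ℝ ∞ (pd i f) N :=
  (smooth_fderiv hN hf).clm_apply contDiffOn_const

lemma vd_vd (hN : IsOpen N) (hf : ContDiffOn ℝ ∞ f N) (hV : ContDiffOn ℝ ∞ V N) (hp : p ∈ N) :
    vd W (vd V f) p
      = fderiv ℝ (fderiv ℝ f) p (W p) (V p) + fderiv ℝ f p (fderiv ℝ V p (W p)) := by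
  have h1 : HasFDerivAt (fderiv ℝ f) (fderiv ℝ (fderiv ℝ f) p) p :=
    (((smooth_fderiv hN hf).differentiableOn (by simp)).differentiableAt
      (hN.mem_nhds hp)).hasFDerivAt
  have h2 : HasFDerivAt V (fderiv ℝ V p) p :=
    ((hV.differentiableOn (by simp)).differentiableAt (hN.mem_nhds hp)).hasFDerivAt
  have h := (h1.clm_apply h2).fderiv
  unfold vd
  rw [h]
  simp [add_comm]

lemma fderiv_fderiv_symm (hN : IsOpen N) (hf : ContDiffOn ℝ ∞ f N) (hp : p ∈ N) (v w : E2) :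
    fderiv ℝ (fderiv ℝ f) p v w = fderiv ℝ (fderiv ℝ f) p w v :=
  ((hf.contDiffAt (hN.mem_nhds hp)).isSymmSndFDerivAt (by simp; exact WithTop.coe_le_coe.2 (le_top : (2 : ℕ∞) ≤ ⊤))).eq v w

lemma pd_comm (hN : IsOpen N) (hf : ContDiffOn ℝ ∞ f N) (hp : p ∈ N) (i j : Fin 2) :
    pd i (pd j f) p = pd j (pd i f) p := by
  have h := fun i j : Fin 2 => vd_vd (W := fun _ => EuclideanSpace.single i 1) hN hf
    (contDiffOn_const (c := EuclideanSpace.single j (1:ℝ))) hp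
  have hi := h i j
  have hj := h j i
  simp only [fderiv_fun_const, Pi.zero_apply, _root_.zero_apply, map_zero,
    add_zero] at hi hj
  exact hi.trans ((fderiv_fderiv_symm hN hf hp _ _).trans hj.symm)

lemma second_deriv_nonpos_of_isLocalMax (hN : IsOpen N) (hf : ContDiffOn ℝ ∞ f N) (hp : p ∈ N)
    (hmax : IsLocalMax f p) (v : E2) : fderiv ℝ (fderiv ℝ f) p v v ≤ 0 := by
  by_contra! hcon
  set l : ℝ → E2 := fun t => p + t • v with hl
  have hl0 : l 0 = p := by simp [hl]
  have hlc : Continuous l := by fun_prop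
  have hld : ∀ t, HasDerivAt l v t := fun t => by
    have := ((hasDerivAt_id t).smul_const v).const_add p
    rwa [one_smul] at this
  have hnear : ∀ᶠ t in 𝓝 (0:ℝ), l t ∈ N :=
    hlc.continuousAt.preimage_mem_nhds (by rw [hl0]; exact hN.mem_nhds hp)
  have hd : ∀ᶠ t in 𝓝 (0:ℝ), deriv (fun t => f (l t)) t = fderiv ℝ f (l t) v := by
    filter_upwards [hnear] with t ht
    have := ((hf.differentiableOn (by simp)).differentiableAt (hN.mem_nhds ht)).hasFDerivAt
    exact (this.comp_hasDerivAt t (hld t)).deriv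
  have hdd : deriv (deriv (fun t => f (l t))) 0 = fderiv ℝ (fderiv ℝ f) p v v := by
    rw [Filter.EventuallyEq.deriv_eq hd]
    have h1 : HasFDerivAt (fderiv ℝ f) (fderiv ℝ (fderiv ℝ f) p) (l 0) := by
      rw [hl0]
      exact (((smooth_fderiv hN hf).differentiableOn (by simp)).differentiableAt
        (hN.mem_nhds hp)).hasFDerivAt
    have h2 := (h1.comp_hasDerivAt 0 (hld 0)).clm_apply (hasDerivAt_const (0:ℝ) v)
    simpa using h2.deriv
  have hmax' : IsLocalMax (fun t => f (l t)) 0 := by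
    have : Tendsto l (𝓝 0) (𝓝 p) := by simpa [hl0] using hlc.tendsto 0
    have := this.eventually hmax
    filter_upwards [this] with t ht
    simpa [hl0] using ht
  have hc : ContinuousAt (fun t => f (l t)) 0 :=
    ContinuousAt.comp (f := l) (x := (0:ℝ))
      (by rw [hl0]; exact (hf.continuousOn).continuousAt (hN.mem_nhds hp)) hlc.continuousAt
  have hmin := isLocalMin_of_deriv_deriv_pos (f := fun t => f (l t)) (x₀ := 0)
    (by rw [hdd]; exact hcon) hmax'.deriv_eq_zero hc
  have hconst : (fun t => f (l t)) =ᶠ[𝓝 0] fun _ => f (l 0) := by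
    filter_upwards [hmin, hmax'] with t h1 h2
    exact le_antisymm h2 h1
  have : deriv (deriv (fun t => f (l t))) 0 = 0 := by
    rw [hconst.deriv.deriv_eq]; simp
  linarith [hdd ▸ this]

lemma vd_vd_nonpos_of_isLocalMax (hN : IsOpen N) (hf : ContDiffOn ℝ ∞ f N)
    (hV : ContDiffOn ℝ ∞ V N) (hp : p ∈ N) (hmax : IsLocalMax f p) : vd V (vd V f) p ≤ 0 := by
  rw [vd_vd hN hf hV hp, hmax.fderiv_eq_zero]
  simpa using second_deriv_nonpos_of_isLocalMax hN hf hp hmax (V p)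

end SmoothOn

/-! ### Adapted commuting frames -/

/-- Half the inverse conformal factor, up to the factor `2`: `κ = 1 - |p|²`. -/
def kap (p : E2) : ℝ := 1 - (p 0 ^ 2 + p 1 ^ 2)

/-- First field of the frame with direction `(c, d)` and angle function `θ`. -/
def vX (c d θ : E2 → ℝ) (p : E2) : E2 :=
  !₂[kap p / 2 * Real.sinh (θ p) * c p, kap p / 2 * Real.sinh (θ p) * d p]

/-- Second field of the frame with direction `(c, d)` and angle function `θ`. -/
def vY (c d θ : E2 → ℝ) (p : E2) : E2 :=
  !₂[-(kap p / 2 * Real.cosh (θ p) * d p), kap p / 2 * Real.cosh (θ p) * c p]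

/-- The structure equations satisfied by the direction `(c, d)` of the gradient of a minimal
graph and by the function `θ` whose hyperbolic tangent is the angle function. -/
structure IsFrame (N : Set E2) (c d θ : E2 → ℝ) : Prop where
  isOpen : IsOpen N
  disk : ∀ p ∈ N, 0 < kap p
  smooth_c : ContDiffOn ℝ ∞ c N
  smooth_d : ContDiffOn ℝ ∞ d N
  smooth_θ : ContDiffOn ℝ ∞ θ N
  unit : ∀ p ∈ N, c p ^ 2 + d p ^ 2 = 1
  pos : ∀ p ∈ N, 0 < θ p
  rotX : ∀ p ∈ N, c p * vd (vX c d θ) d p - d p * vd (vX c d θ) c p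
    = -vd (vY c d θ) θ p + Real.sinh (θ p) * (p 1 * c p - p 0 * d p)
  rotY : ∀ p ∈ N, c p * vd (vY c d θ) d p - d p * vd (vY c d θ) c p
    = vd (vX c d θ) θ p - Real.cosh (θ p) * (p 0 * c p + p 1 * d p)

lemma contDiff_coord (i : Fin 2) : ContDiff ℝ ∞ (fun p : E2 => p i) :=
  (EuclideanSpace.proj (𝕜 := ℝ) (i : Fin 2) : E2 →L[ℝ] ℝ).contDiff

lemma contDiff_kap : ContDiff ℝ ∞ kap := by
  unfold kap
  exact contDiff_const.sub (((contDiff_coord 0).pow 2).add ((contDiff_coord 1).pow 2))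

lemma hasD_kap (v p : E2) : HasD v kap p (-2 * (p 0 * v 0 + p 1 * v 1)) := by
  have := (HasD.const v p 1).sub ((HasD.coord v p 0).sq.add (HasD.coord v p 1).sq)
  unfold kap
  convert this using 1
  ring

lemma contDiffOn_E2 {N : Set E2} {f g : E2 → ℝ} (hf : ContDiffOn ℝ ∞ f N)
    (hg : ContDiffOn ℝ ∞ g N) : ContDiffOn ℝ ∞ (fun p => (!₂[f p, g p] : E2)) N := by
  rw [contDiffOn_piLp]
  intro i
  fin_cases i
  · simpa using hf
  · simpa using hg

namespace IsFrame

variable {N : Set E2} {c d θ f : E2 → ℝ} {p : E2}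

lemma smooth_vX (h : IsFrame N c d θ) : ContDiffOn ℝ ∞ (vX c d θ) N := by
  have hk : ContDiffOn ℝ ∞ (fun p => kap p / 2 * Real.sinh (θ p)) N :=
    (contDiff_kap.contDiffOn.div_const 2).mul (Real.contDiff_sinh.comp_contDiffOn h.smooth_θ)
  exact contDiffOn_E2 (hk.mul h.smooth_c) (hk.mul h.smooth_d)

lemma smooth_vY (h : IsFrame N c d θ) : ContDiffOn ℝ ∞ (vY c d θ) N := by
  have hk : ContDiffOn ℝ ∞ (fun p => kap p / 2 * Real.cosh (θ p)) N :=
    (contDiff_kap.contDiffOn.div_const 2).mul (Real.contDiff_cosh.comp_contDiffOn h.smooth_θ)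
  exact contDiffOn_E2 (hk.mul h.smooth_d).neg (hk.mul h.smooth_c)

lemma unit_deriv (h : IsFrame N c d θ) (hp : p ∈ N) (v : E2) :
    c p * fderiv ℝ c p v + d p * fderiv ℝ d p v = 0 := by
  have hc : HasD v c p _ :=
    ⟨(h.smooth_c.differentiableOn (by simp)).differentiableAt (h.isOpen.mem_nhds hp), rfl⟩
  have hd : HasD v d p _ :=
    ⟨(h.smooth_d.differentiableOn (by simp)).differentiableAt (h.isOpen.mem_nhds hp), rfl⟩
  have h1 := (hc.sq.add hd.sq)
  have h2 := (HasD.const v p 1).congr_on h.isOpen hp h.unit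
  have := h1.unique h2
  linarith

/-- Derivatives of `c` and `d` along the two fields of the frame. -/
lemma deriv_dir (h : IsFrame N c d θ) (hp : p ∈ N) :
    vd (vX c d θ) c p = -d p * (-vd (vY c d θ) θ p + Real.sinh (θ p) * (p 1 * c p - p 0 * d p)) ∧
    vd (vX c d θ) d p = c p * (-vd (vY c d θ) θ p + Real.sinh (θ p) * (p 1 * c p - p 0 * d p)) ∧
    vd (vY c d θ) c p = -d p * (vd (vX c d θ) θ p - Real.cosh (θ p) * (p 0 * c p + p 1 * d p)) ∧
    vd (vY c d θ) d p = c p * (vd (vX c d θ) θ p - Real.cosh (θ p) * (p 0 * c p + p 1 * d p)) := by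
  have hu := h.unit p hp
  have h1 : c p * vd (vX c d θ) c p + d p * vd (vX c d θ) d p = 0 := h.unit_deriv hp _
  have h2 : c p * vd (vY c d θ) c p + d p * vd (vY c d θ) d p = 0 := h.unit_deriv hp _
  rw [← h.rotX p hp, ← h.rotY p hp]
  refine ⟨?_, ?_, ?_, ?_⟩
  · linear_combination (-vd (vX c d θ) c p) * hu + c p * h1
  · linear_combination (-vd (vX c d θ) d p) * hu + d p * h1
  · linear_combination (-vd (vY c d θ) c p) * hu + c p * h2
  · linear_combination (-vd (vY c d θ) d p) * hu + d p * h2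

lemma hasD_sinh (v : E2) {a : ℝ} (hθ : HasD v θ p a) :
    HasD v (fun x => Real.sinh (θ x)) p (Real.cosh (θ p) * a) :=
  HasD.comp (Real.hasDerivAt_sinh _) hθ

lemma hasD_cosh (v : E2) {a : ℝ} (hθ : HasD v θ p a) :
    HasD v (fun x => Real.cosh (θ x)) p (Real.sinh (θ p) * a) :=
  HasD.comp (Real.hasDerivAt_cosh _) hθ

lemma comm (h : IsFrame N c d θ) (hf : ContDiffOn ℝ ∞ f N) (hp : p ∈ N) :
    vd (vX c d θ) (vd (vY c d θ) f) p = vd (vY c d θ) (vd (vX c d θ) f) p := by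
  have key : fderiv ℝ (vY c d θ) p (vX c d θ p) = fderiv ℝ (vX c d θ) p (vY c d θ p) := by
    obtain ⟨e1, e2, e3, e4⟩ := h.deriv_dir hp
    have hu := h.unit p hp
    have hcs := Real.cosh_sq (θ p)
    have comp : ∀ {F : E2 → E2} (hF : ContDiffOn ℝ ∞ F N) (v : E2) (i : Fin 2),
        HasD v (fun x => F x i) p ((fderiv ℝ F p v) i) := by
      intro F hF v i
      have hd := ((hF.differentiableOn (by simp)).differentiableAt
        (h.isOpen.mem_nhds hp)).hasFDerivAt
      have := ((EuclideanSpace.proj (𝕜 := ℝ) (i : Fin 2) : E2 →L[ℝ] ℝ).hasFDerivAt).comp p hd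
      exact ⟨this.differentiableAt, by
        have h2 := this.fderiv
        have h3 : (⇑(EuclideanSpace.proj (𝕜 := ℝ) (i : Fin 2) : E2 →L[ℝ] ℝ) ∘ F)
          = fun x => F x i := rfl
        rw [h3] at h2
        rw [h2]; rfl⟩
    have hXc := hasD_vd (V := vX c d θ) h.isOpen h.smooth_c hp
    have hXd := hasD_vd (V := vX c d θ) h.isOpen h.smooth_d hp
    have hXθ := hasD_vd (V := vX c d θ) h.isOpen h.smooth_θ hp
    have hYc := hasD_vd (V := vY c d θ) h.isOpen h.smooth_c hp
    have hYd := hasD_vd (V := vY c d θ) h.isOpen h.smooth_d hp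
    have hYθ := hasD_vd (V := vY c d θ) h.isOpen h.smooth_θ hp
    have hXk := (hasD_kap (vX c d θ p) p).const_mul 2⁻¹
    have hYk := (hasD_kap (vY c d θ p) p).const_mul 2⁻¹
    have a0 := (comp h.smooth_vY (vX c d θ p) 0).unique
      ((((hXk.mul (hasD_cosh _ hXθ)).mul hXd).neg).congr_of_eventuallyEq
        (.of_forall fun x => by
          change -(kap x / 2 * Real.cosh (θ x) * d x) = -(2⁻¹ * kap x * Real.cosh (θ x) * d x)
          ring))
    have a1 := (comp h.smooth_vY (vX c d θ p) 1).unique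
      (((hXk.mul (hasD_cosh _ hXθ)).mul hXc).congr_of_eventuallyEq
        (.of_forall fun x => by
          change kap x / 2 * Real.cosh (θ x) * c x = 2⁻¹ * kap x * Real.cosh (θ x) * c x
          ring))
    have b0 := (comp h.smooth_vX (vY c d θ p) 0).unique
      (((hYk.mul (hasD_sinh _ hYθ)).mul hYc).congr_of_eventuallyEq
        (.of_forall fun x => by
          change kap x / 2 * Real.sinh (θ x) * c x = 2⁻¹ * kap x * Real.sinh (θ x) * c x
          ring))
    have b1 := (comp h.smooth_vX (vY c d θ p) 1).unique
      (((hYk.mul (hasD_sinh _ hYθ)).mul hYd).congr_of_eventuallyEq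
        (.of_forall fun x => by
          change kap x / 2 * Real.sinh (θ x) * d x = 2⁻¹ * kap x * Real.sinh (θ x) * d x
          ring))
    rw [e1] at a1
    rw [e2] at a0
    rw [e3] at b0
    rw [e4] at b1
    have x0 : vX c d θ p 0 = kap p / 2 * Real.sinh (θ p) * c p := rfl
    have x1 : vX c d θ p 1 = kap p / 2 * Real.sinh (θ p) * d p := rfl
    have y0 : vY c d θ p 0 = -(kap p / 2 * Real.cosh (θ p) * d p) := rfl
    have y1 : vY c d θ p 1 = kap p / 2 * Real.cosh (θ p) * c p := rfl
    rw [x0, x1] at a0 a1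
    rw [y0, y1] at b0 b1
    ext i
    fin_cases i
    · simp only [Fin.zero_eta]
      rw [a0, b0]; ring
    · simp only [Fin.mk_one]
      rw [a1, b1]; ring
  rw [vd_vd h.isOpen hf h.smooth_vY hp, vd_vd h.isOpen hf h.smooth_vX hp,
    fderiv_fderiv_symm h.isOpen hf hp, key]

lemma laplacian_angle (h : IsFrame N c d θ) (hp : p ∈ N) :
    vd (vX c d θ) (vd (vX c d θ) θ) p + vd (vY c d θ) (vd (vY c d θ) θ) p
      = Real.sinh (θ p) * Real.cosh (θ p) := by
  set X := vX c d θ with hX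
  set Y := vY c d θ with hY
  have sX := h.smooth_vX
  have sY := h.smooth_vY
  have ho := h.isOpen
  obtain ⟨e1, e2, e3, e4⟩ := h.deriv_dir hp
  have hu := h.unit p hp
  have hcs := Real.cosh_sq (θ p)
  have hXc := hasD_vd (V := X) ho h.smooth_c hp
  have hXd := hasD_vd (V := X) ho h.smooth_d hp
  have hXθ := hasD_vd (V := X) ho h.smooth_θ hp
  have hYc := hasD_vd (V := Y) ho h.smooth_c hp
  have hYd := hasD_vd (V := Y) ho h.smooth_d hp
  have hYθ := hasD_vd (V := Y) ho h.smooth_θ hp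
  have hXYc := hasD_vd (V := X) ho (smooth_vd ho h.smooth_c sY) hp
  have hXYd := hasD_vd (V := X) ho (smooth_vd ho h.smooth_d sY) hp
  have hYXc := hasD_vd (V := Y) ho (smooth_vd ho h.smooth_c sX) hp
  have hYXd := hasD_vd (V := Y) ho (smooth_vd ho h.smooth_d sX) hp
  have hXXθ := hasD_vd (V := X) ho (smooth_vd ho h.smooth_θ sX) hp
  have hYYθ := hasD_vd (V := Y) ho (smooth_vd ho h.smooth_θ sY) hp
  have r1 := ((hYc.mul hYXd).sub (hYd.mul hYXc)).unique
    ((hYYθ.neg.add ((hasD_sinh _ hYθ).mul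
      (((HasD.coord _ p 1).mul hYc).sub ((HasD.coord _ p 0).mul hYd)))).congr_on ho hp h.rotX)
  have r2 := ((hXc.mul hXYd).sub (hXd.mul hXYc)).unique
    ((hXXθ.sub ((hasD_cosh _ hXθ).mul
      (((HasD.coord _ p 0).mul hXc).add ((HasD.coord _ p 1).mul hXd)))).congr_on ho hp h.rotY)
  rw [h.comm h.smooth_c hp, h.comm h.smooth_d hp] at r2
  simp only [← hX, ← hY] at e1 e2 e3 e4 r1 r2
  rw [e1, e2, e3, e4] at r1 r2
  have x0 : X p 0 = kap p / 2 * Real.sinh (θ p) * c p := rfl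
  have x1 : X p 1 = kap p / 2 * Real.sinh (θ p) * d p := rfl
  have y0 : Y p 0 = -(kap p / 2 * Real.cosh (θ p) * d p) := rfl
  have y1 : Y p 1 = kap p / 2 * Real.cosh (θ p) * c p := rfl
  rw [y0, y1] at r1
  rw [x0, x1] at r2
  generalize vd Y (vd X c) p = z1 at *
  generalize vd Y (vd X d) p = z2 at *
  generalize vd X (vd X θ) p = z3 at *
  generalize vd Y (vd Y θ) p = z4 at *
  generalize vd X θ p = a at *
  generalize vd Y θ p = b at *
  unfold kap at r1 r2
  generalize Real.sinh (θ p) = S at *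
  generalize Real.cosh (θ p) = C at *
  generalize c p = cc at *
  generalize d p = dd at *
  generalize p 0 = x at *
  generalize p 1 = y at *
  have hdd : dd ^ 2 = 1 - cc ^ 2 := by linarith
  ring_nf at r1 r2
  simp only [hdd] at r1 r2
  ring_nf at r1 r2
  ring_nf
  linarith

end IsFrame

/-! ### The gradient estimate for the angle function -/

lemma trace_identity {a b p q r T : ℝ} (hT : p + r = T) :
    (p ^ 2 + 2 * q ^ 2 + r ^ 2) * (a ^ 2 + b ^ 2) - 2 * ((a * p + b * q) ^ 2 + (a * q + b * r) ^ 2)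
      = T ^ 2 * (a ^ 2 + b ^ 2) - 2 * T * (a * (a * p + b * q) + b * (a * q + b * r)) := by
  subst hT; ring

/-- The algebraic part of the maximum principle for the angle function. -/
lemma max_point_algebra {a b p q r S C x₁ x₂ l χ P h₁ : ℝ} (hP : 0 < P) (hPd : P = a ^ 2 + b ^ 2)
    (hχ : 0 < χ) (hT : p + r = S * C)
    (e₁ : 2 * (a * p + b * q) / P + 2 * x₁ / χ + h₁ * a = 0)
    (e₂ : 2 * (a * q + b * r) / P + 2 * x₂ / χ + h₁ * b = 0)
    (e₃ : (2 * (p ^ 2 + 2 * q ^ 2 + r ^ 2) + 2 * (C ^ 2 + S ^ 2) * P) / P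
      - 4 * ((a * p + b * q) ^ 2 + (a * q + b * r) ^ 2) / P ^ 2 + 2 * l / χ
      - 2 * (x₁ ^ 2 + x₂ ^ 2) / χ ^ 2 + 2 / S ^ 2 * P + h₁ * (S * C) ≤ 0) :
    2 / S ^ 2 * P ≤ 4 * (x₁ ^ 2 + x₂ ^ 2) / χ ^ 2 - 2 * l / χ - 3 * (S * C) * h₁
      - 2 * (C ^ 2 + S ^ 2) := by
  have tr := trace_identity (a := a) (b := b) (q := q) hT
  set T := S * C
  have e₁' : a * p + b * q = -P / 2 * (2 * x₁ / χ + h₁ * a) := by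
    field_simp at e₁ ⊢; linarith
  have e₂' : a * q + b * r = -P / 2 * (2 * x₂ / χ + h₁ * b) := by
    field_simp at e₂ ⊢; linarith
  have k : a * (a * p + b * q) + b * (a * q + b * r)
      = -P / 2 * (2 * (a * x₁ + b * x₂) / χ + h₁ * P) := by
    rw [e₁', e₂', hPd]; ring
  rw [k, ← hPd] at tr
  have id : (2 * (p ^ 2 + 2 * q ^ 2 + r ^ 2) + 2 * (C ^ 2 + S ^ 2) * P) / P
      - 4 * ((a * p + b * q) ^ 2 + (a * q + b * r) ^ 2) / P ^ 2
      = 2 * T ^ 2 / P + 4 * T * (a * x₁ + b * x₂) / (P * χ) + 2 * T * h₁ + 2 * (C ^ 2 + S ^ 2) := by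
    have : (p ^ 2 + 2 * q ^ 2 + r ^ 2) = (T ^ 2 * P - 2 * T * (-P / 2 * (2 * (a * x₁ + b * x₂) / χ + h₁ * P))
      + 2 * ((a * p + b * q) ^ 2 + (a * q + b * r) ^ 2)) / P := by
      rw [eq_div_iff hP.ne']; linarith
    rw [this]; field_simp; ring
  rw [id] at e₃
  have cs : 0 ≤ 2 * T ^ 2 / P + 4 * T * (a * x₁ + b * x₂) / (P * χ)
      + 2 * (x₁ ^ 2 + x₂ ^ 2) / χ ^ 2 := by
    have : 2 * T ^ 2 / P + 4 * T * (a * x₁ + b * x₂) / (P * χ) + 2 * (x₁ ^ 2 + x₂ ^ 2) / χ ^ 2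
        = 2 * ((T * a / P + x₁ / χ) ^ 2 + (T * b / P + x₂ / χ) ^ 2) := by
      have : T ^ 2 / P = T ^ 2 * (a ^ 2 + b ^ 2) / P ^ 2 := by rw [← hPd]; field_simp
      rw [show 2 * T ^ 2 / P = 2 * (T ^ 2 / P) by ring, this]
      field_simp; ring
    rw [this]; positivity
  have : 4 * (x₁ ^ 2 + x₂ ^ 2) / χ ^ 2 = 2 * (2 * (x₁ ^ 2 + x₂ ^ 2) / χ ^ 2) := by ring
  rw [this]
  have : -(2 * (x₁ ^ 2 + x₂ ^ 2) / χ ^ 2) ≤ 2 * T ^ 2 / P + 4 * T * (a * x₁ + b * x₂) / (P * χ) := by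
    linarith
  linarith

lemma max_point_bound {a b p q r S C x₁ x₂ l₁ l₂ L₁ L₂ χ P ε e : ℝ} (hP : 0 < P)
    (hPd : P = a ^ 2 + b ^ 2) (hχ : 0 < χ) (hχ1 : χ ≤ 1) (hS : 0 < S) (hC : 0 < C) (hSC : S ≤ C)
    (hε1 : ε ≤ 1) (hT : p + r = S * C)
    (z₁ : 0 = 2 * (a * p + b * q) / P + 2 * (x₁ / χ) - 2 * (C * a / S) - (2 + ε) * a)
    (z₂ : 0 = 2 * (a * q + b * r) / P + 2 * (x₂ / χ) - 2 * (C * b / S) - (2 + ε) * b)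
    (n₁ : L₁ / P - (2 * (a * p + b * q) / P) ^ 2 + 2 * (l₁ / χ - (x₁ / χ) ^ 2)
      + 2 / S ^ 2 * a ^ 2 + (-2 * (C / S) - (2 + ε)) * p ≤ 0)
    (n₂ : L₂ / P - (2 * (a * q + b * r) / P) ^ 2 + 2 * (l₂ / χ - (x₂ / χ) ^ 2)
      + 2 / S ^ 2 * b ^ 2 + (-2 * (C / S) - (2 + ε)) * r ≤ 0)
    (hL : L₁ + L₂ = 2 * (p ^ 2 + 2 * q ^ 2 + r ^ 2) + 2 * (C ^ 2 + S ^ 2) * P)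
    (b₁ : x₁ ^ 2 + x₂ ^ 2 ≤ C ^ 2) (b₂ : -(l₁ + l₂) ≤ 2 * C ^ 2)
    (hce : e * C ^ 2 ≤ 1) (he : 0 < e) : χ ^ 2 * P * e / S ^ 2 ≤ 12 := by
  have e₁ : 2 * (a * p + b * q) / P + 2 * x₁ / χ + (-2 * (C / S) - (2 + ε)) * a = 0 := by
    linear_combination -z₁
  have e₂ : 2 * (a * q + b * r) / P + 2 * x₂ / χ + (-2 * (C / S) - (2 + ε)) * b = 0 := by
    linear_combination -z₂
  have e₃ : (2 * (p ^ 2 + 2 * q ^ 2 + r ^ 2) + 2 * (C ^ 2 + S ^ 2) * P) / P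
      - 4 * ((a * p + b * q) ^ 2 + (a * q + b * r) ^ 2) / P ^ 2 + 2 * (l₁ + l₂) / χ
      - 2 * (x₁ ^ 2 + x₂ ^ 2) / χ ^ 2 + 2 / S ^ 2 * P
      + (-2 * (C / S) - (2 + ε)) * (S * C) ≤ 0 := by
    rw [← hL, ← hT]
    have hP2 : 2 / S ^ 2 * P = 2 / S ^ 2 * a ^ 2 + 2 / S ^ 2 * b ^ 2 := by rw [hPd]; ring
    rw [hP2]
    generalize -2 * (C / S) - (2 + ε) = h₁ at *
    generalize 2 / S ^ 2 = h₂ at *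
    refine le_trans (le_of_eq ?_) (add_nonpos n₁ n₂)
    ring
  have main := max_point_algebra hP hPd hχ hT e₁ e₂ e₃
  have h1 : 2 / S ^ 2 * P * χ ^ 2 ≤ 23 * C ^ 2 := by
    have e1 : -3 * (S * C) * (-2 * (C / S) - (2 + ε)) = 6 * C ^ 2 + 3 * (2 + ε) * (S * C) := by
      field_simp; ring
    have e2 : 3 * (2 + ε) * (S * C) ≤ 9 * C ^ 2 := by
      have k1 : S * C ≤ C ^ 2 := by rw [sq]; gcongr
      have k2 : 3 * (2 + ε) ≤ 9 := by linarith
      calc 3 * (2 + ε) * (S * C) ≤ 9 * (S * C) := by gcongr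
        _ ≤ 9 * C ^ 2 := by gcongr
    have e3 : 2 / S ^ 2 * P ≤ 4 * (x₁ ^ 2 + x₂ ^ 2) / χ ^ 2 - 2 * (l₁ + l₂) / χ + 15 * C ^ 2 := by
      linarith [sq_nonneg C, sq_nonneg S]
    calc 2 / S ^ 2 * P * χ ^ 2
        ≤ (4 * (x₁ ^ 2 + x₂ ^ 2) / χ ^ 2 - 2 * (l₁ + l₂) / χ + 15 * C ^ 2) * χ ^ 2 := by gcongr
      _ = 4 * (x₁ ^ 2 + x₂ ^ 2) + 2 * -(l₁ + l₂) * χ + 15 * C ^ 2 * χ ^ 2 := by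
          field_simp; ring
      _ ≤ 4 * C ^ 2 + 2 * (2 * C ^ 2) * 1 + 15 * C ^ 2 * 1 ^ 2 := by gcongr
      _ = 23 * C ^ 2 := by ring
  have h2 : χ ^ 2 * P * e / S ^ 2 = (2 / S ^ 2 * P * χ ^ 2) * e / 2 := by field_simp
  have h3 : 2 / S ^ 2 * P * χ ^ 2 * e ≤ 23 * C ^ 2 * e := by gcongr
  rw [h2]
  linarith

/-- The cutoff function of the ball of radius `R` about `q`. -/
def cutoff (q : E2) (R : ℝ) (z : E2) : ℝ := R ^ 2 - ((z 0 - q 0) ^ 2 + (z 1 - q 1) ^ 2)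

lemma contDiff_cutoff (q : E2) (R : ℝ) : ContDiff ℝ ∞ (cutoff q R) := by
  unfold cutoff
  exact contDiff_const.sub ((((contDiff_coord 0).sub contDiff_const).pow 2).add
    (((contDiff_coord 1).sub contDiff_const).pow 2))

lemma hasD_cutoff (q : E2) (R : ℝ) (v p : E2) :
    HasD v (cutoff q R) p (-2 * ((p 0 - q 0) * v 0 + (p 1 - q 1) * v 1)) := by
  have := (HasD.const v p (R ^ 2)).sub
    ((((HasD.coord v p 0).sub (HasD.const v p (q 0))).sq).add
    (((HasD.coord v p 1).sub (HasD.const v p (q 1))).sq))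
  unfold cutoff
  convert this using 1
  ring

lemma cutoff_eq (q : E2) (R : ℝ) (z : E2) : cutoff q R z = R ^ 2 - dist z q ^ 2 := by
  rw [dist_eq_norm, E2.norm_sq]; rfl

namespace IsFrame

variable {N : Set E2} {c d θ f : E2 → ℝ} {p : E2}

/-- Squared length of the derivative of the angle function in the adapted frame. -/
def energy (c d θ : E2 → ℝ) (p : E2) : ℝ := vd (vX c d θ) θ p ^ 2 + vd (vY c d θ) θ p ^ 2

lemma smooth_energy (h : IsFrame N c d θ) : ContDiffOn ℝ ∞ (energy c d θ) N :=
  ((smooth_vd h.isOpen h.smooth_θ h.smooth_vX).pow 2).add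
    ((smooth_vd h.isOpen h.smooth_θ h.smooth_vY).pow 2)

lemma hasD_vX (h : IsFrame N c d θ) (hp : p ∈ N) (v : E2) :
    HasD v (fun x => vX c d θ x 0) p
        (-(p 0 * v 0 + p 1 * v 1) * Real.sinh (θ p) * c p
          + kap p / 2 * (Real.cosh (θ p) * fderiv ℝ θ p v) * c p
          + kap p / 2 * Real.sinh (θ p) * fderiv ℝ c p v) ∧
    HasD v (fun x => vX c d θ x 1) p
        (-(p 0 * v 0 + p 1 * v 1) * Real.sinh (θ p) * d p
          + kap p / 2 * (Real.cosh (θ p) * fderiv ℝ θ p v) * d p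
          + kap p / 2 * Real.sinh (θ p) * fderiv ℝ d p v) := by
  have hc := hasD_vd (V := fun _ => v) h.isOpen h.smooth_c hp
  have hd := hasD_vd (V := fun _ => v) h.isOpen h.smooth_d hp
  have hθ := hasD_vd (V := fun _ => v) h.isOpen h.smooth_θ hp
  have hk := (hasD_kap v p).const_mul 2⁻¹
  have e0 : (fun x => vX c d θ x 0) = fun x => 2⁻¹ * kap x * Real.sinh (θ x) * c x := by
    funext x
    change kap x / 2 * Real.sinh (θ x) * c x = _
    ring
  have e1 : (fun x => vX c d θ x 1) = fun x => 2⁻¹ * kap x * Real.sinh (θ x) * d x := by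
    funext x
    change kap x / 2 * Real.sinh (θ x) * d x = _
    ring
  rw [e0, e1]
  constructor
  · convert (hk.mul (hasD_sinh _ hθ)).mul hc using 1
    simp only [vd]; ring
  · convert (hk.mul (hasD_sinh _ hθ)).mul hd using 1
    simp only [vd]; ring

lemma hasD_vY (h : IsFrame N c d θ) (hp : p ∈ N) (v : E2) :
    HasD v (fun x => vY c d θ x 0) p
        (-(-(p 0 * v 0 + p 1 * v 1) * Real.cosh (θ p) * d p
          + kap p / 2 * (Real.sinh (θ p) * fderiv ℝ θ p v) * d p
          + kap p / 2 * Real.cosh (θ p) * fderiv ℝ d p v)) ∧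
    HasD v (fun x => vY c d θ x 1) p
        (-(p 0 * v 0 + p 1 * v 1) * Real.cosh (θ p) * c p
          + kap p / 2 * (Real.sinh (θ p) * fderiv ℝ θ p v) * c p
          + kap p / 2 * Real.cosh (θ p) * fderiv ℝ c p v) := by
  have hc := hasD_vd (V := fun _ => v) h.isOpen h.smooth_c hp
  have hd := hasD_vd (V := fun _ => v) h.isOpen h.smooth_d hp
  have hθ := hasD_vd (V := fun _ => v) h.isOpen h.smooth_θ hp
  have hk := (hasD_kap v p).const_mul 2⁻¹
  have e0 : (fun x => vY c d θ x 0) = fun x => -(2⁻¹ * kap x * Real.cosh (θ x) * d x) := by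
    funext x
    change -(kap x / 2 * Real.cosh (θ x) * d x) = _
    ring
  have e1 : (fun x => vY c d θ x 1) = fun x => 2⁻¹ * kap x * Real.cosh (θ x) * c x := by
    funext x
    change kap x / 2 * Real.cosh (θ x) * c x = _
    ring
  rw [e0, e1]
  constructor
  · convert ((hk.mul (hasD_cosh _ hθ)).mul hd).neg using 1
    simp only [vd]; ring
  · convert (hk.mul (hasD_cosh _ hθ)).mul hc using 1
    simp only [vd]; ring

/-- The frame Laplacian of the cutoff function. -/
lemma laplacian_cutoff (h : IsFrame N c d θ) (hp : p ∈ N) (q : E2) (R : ℝ) :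
    vd (vX c d θ) (vd (vX c d θ) (cutoff q R)) p + vd (vY c d θ) (vd (vY c d θ) (cutoff q R)) p
      = -2 * ((kap p / 2 * Real.sinh (θ p)) ^ 2 + (kap p / 2 * Real.cosh (θ p)) ^ 2)
        - kap p * ((p 0 - q 0) * ((p 0 * c p + p 1 * d p) * c p + (p 1 * c p - p 0 * d p) * d p)
          + (p 1 - q 1) * ((p 0 * c p + p 1 * d p) * d p - (p 1 * c p - p 0 * d p) * c p)) := by
  have eX : ∀ V : E2 → E2, vd V (cutoff q R)
      = fun x => -2 * ((x 0 - q 0) * V x 0 + (x 1 - q 1) * V x 1) := fun V => by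
    funext x; exact (hasD_cutoff q R (V x) x).2
  obtain ⟨e1, e2, e3, e4⟩ := h.deriv_dir hp
  have hu := h.unit p hp
  have hcs := Real.cosh_sq (θ p)
  have gen : ∀ (V : E2 → E2) (a0 a1 : ℝ), HasD (V p) (fun x => V x 0) p a0 →
      HasD (V p) (fun x => V x 1) p a1 → vd V (vd V (cutoff q R)) p
        = -2 * (V p 0 ^ 2 + (p 0 - q 0) * a0 + V p 1 ^ 2 + (p 1 - q 1) * a1) := by
    intro V a0 a1 h0 h1
    rw [eX V]
    have := (((((HasD.coord (V p) p 0).sub (HasD.const (V p) p (q 0))).mul h0).add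
      (((HasD.coord (V p) p 1).sub (HasD.const (V p) p (q 1))).mul h1)).const_mul (-2)).2
    rw [vd, this]; ring
  rw [gen _ _ _ (h.hasD_vX hp _).1 (h.hasD_vX hp _).2,
    gen _ _ _ (h.hasD_vY hp _).1 (h.hasD_vY hp _).2]
  simp only [vd] at e1 e2 e3 e4
  rw [e1, e2, e3, e4]
  have x0 : vX c d θ p 0 = kap p / 2 * Real.sinh (θ p) * c p := rfl
  have x1 : vX c d θ p 1 = kap p / 2 * Real.sinh (θ p) * d p := rfl
  have y0 : vY c d θ p 0 = -(kap p / 2 * Real.cosh (θ p) * d p) := rfl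
  have y1 : vY c d θ p 1 = kap p / 2 * Real.cosh (θ p) * c p := rfl
  rw [x0, x1, y0, y1]
  generalize fderiv ℝ θ p _ = a
  generalize fderiv ℝ θ p _ = b
  generalize kap p = κ
  generalize Real.sinh (θ p) = S at *
  generalize Real.cosh (θ p) = C at *
  generalize c p = cc at *
  generalize d p = dd at *
  generalize p 0 = x at *
  generalize p 1 = y at *
  generalize q 0 = q0 at *
  generalize q 1 = q1 at *
  have hC : C ^ 2 = S ^ 2 + 1 := hcs
  have hdd : dd ^ 2 = 1 - cc ^ 2 := by linarith
  ring_nf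
  simp only [hC, hdd]
  ring_nf

end IsFrame

lemma exp_mul_cosh_sq_le {t ε : ℝ} (hε : 0 < ε) (ht : 0 < t) :
    Real.exp (-(2 + ε) * t) * Real.cosh t ^ 2 ≤ 1 := by
  have : Real.cosh t ≤ Real.exp t := by
    rw [Real.cosh_eq]
    have : Real.exp (-t) ≤ Real.exp t := Real.exp_le_exp.2 (by linarith)
    linarith
  calc Real.exp (-(2 + ε) * t) * Real.cosh t ^ 2
      ≤ Real.exp (-2 * t) * Real.exp t ^ 2 := by
        gcongr
        nlinarith
    _ = 1 := by rw [← Real.exp_nat_mul, ← Real.exp_add]; simp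

lemma cutoff_le_one (q p : E2) {R : ℝ} (hR : 0 < R) (hR1 : R ≤ 1) : cutoff q R p ≤ 1 := by
  unfold cutoff
  nlinarith [sq_nonneg (p 0 - q 0), sq_nonneg (p 1 - q 1)]

namespace IsFrame

variable {N : Set E2} {c d θ f : E2 → ℝ} {p : E2}

lemma vd_energy (h : IsFrame N c d θ) (hp : p ∈ N) (V : E2 → E2) :
    vd V (energy c d θ) p = 2 * (vd (vX c d θ) θ p * vd V (vd (vX c d θ) θ) p
      + vd (vY c d θ) θ p * vd V (vd (vY c d θ) θ) p) := by
  have h1 := hasD_vd (V := V) h.isOpen (smooth_vd h.isOpen h.smooth_θ h.smooth_vX) hp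
  have h2 := hasD_vd (V := V) h.isOpen (smooth_vd h.isOpen h.smooth_θ h.smooth_vY) hp
  have := (h1.sq.add h2.sq).2
  rw [vd]
  refine Eq.trans ?_ (this.trans (by ring))
  rfl

lemma vd_congr (hN : IsOpen N) (hp : p ∈ N) {g : E2 → ℝ} (V : E2 → E2)
    (hfg : ∀ x ∈ N, f x = g x) : vd V f p = vd V g p := by
  unfold vd
  rw [Filter.EventuallyEq.fderiv_eq (Filter.eventually_of_mem (hN.mem_nhds hp) hfg)]

lemma vd_vd_energy (h : IsFrame N c d θ) (hp : p ∈ N) {V : E2 → E2}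
    (hV : ContDiffOn ℝ ∞ V N) :
    vd V (vd V (energy c d θ)) p
      = 2 * (vd V (vd (vX c d θ) θ) p ^ 2 + vd V (vd (vY c d θ) θ) p ^ 2
      + vd (vX c d θ) θ p * vd V (vd V (vd (vX c d θ) θ)) p
      + vd (vY c d θ) θ p * vd V (vd V (vd (vY c d θ) θ)) p) := by
  have sX := smooth_vd h.isOpen h.smooth_θ h.smooth_vX
  have sY := smooth_vd h.isOpen h.smooth_θ h.smooth_vY
  rw [vd_congr h.isOpen hp V fun x hx => h.vd_energy hx V]
  have h1 := hasD_vd (V := V) h.isOpen sX hp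
  have h2 := hasD_vd (V := V) h.isOpen sY hp
  have h3 := hasD_vd (V := V) h.isOpen (smooth_vd h.isOpen sX hV) hp
  have h4 := hasD_vd (V := V) h.isOpen (smooth_vd h.isOpen sY hV) hp
  have := (((h1.mul h3).add (h2.mul h4)).const_mul 2).2
  rw [vd, this]
  ring

lemma laplacian_energy (h : IsFrame N c d θ) (hp : p ∈ N) :
    vd (vX c d θ) (vd (vX c d θ) (energy c d θ)) p + vd (vY c d θ) (vd (vY c d θ) (energy c d θ)) p
      = 2 * (vd (vX c d θ) (vd (vX c d θ) θ) p ^ 2 + 2 * vd (vX c d θ) (vd (vY c d θ) θ) p ^ 2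
          + vd (vY c d θ) (vd (vY c d θ) θ) p ^ 2)
        + 2 * (Real.cosh (θ p) ^ 2 + Real.sinh (θ p) ^ 2) * energy c d θ p := by
  have sX := smooth_vd h.isOpen h.smooth_θ h.smooth_vX
  have sY := smooth_vd h.isOpen h.smooth_θ h.smooth_vY
  have hθ := fun v : E2 => hasD_vd (V := fun _ => v) h.isOpen h.smooth_θ hp
  rw [h.vd_vd_energy hp h.smooth_vX, h.vd_vd_energy hp h.smooth_vY]
  have lap : ∀ V : E2 → E2, vd V (vd (vX c d θ) (vd (vX c d θ) θ)) p
      + vd V (vd (vY c d θ) (vd (vY c d θ) θ)) p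
      = (Real.cosh (θ p) ^ 2 + Real.sinh (θ p) ^ 2) * vd V θ p := by
    intro V
    have h1 := hasD_vd (V := V) h.isOpen (smooth_vd h.isOpen sX h.smooth_vX) hp
    have h2 := hasD_vd (V := V) h.isOpen (smooth_vd h.isOpen sY h.smooth_vY) hp
    have h3 := ((hasD_sinh _ (hθ (V p))).mul (hasD_cosh _ (hθ (V p))))
    have := (h1.add h2).unique (h3.congr_on h.isOpen hp fun x hx => h.laplacian_angle hx)
    rw [this]; simp only [vd]; ring
  have lX := lap (vX c d θ)
  have lY := lap (vY c d θ)
  have c1 : vd (vX c d θ) (vd (vX c d θ) (vd (vY c d θ) θ)) p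
      = vd (vY c d θ) (vd (vX c d θ) (vd (vX c d θ) θ)) p := by
    rw [vd_congr h.isOpen hp _ fun x hx => h.comm h.smooth_θ hx]
    exact h.comm sX hp
  have c2 : vd (vY c d θ) (vd (vY c d θ) (vd (vX c d θ) θ)) p
      = vd (vX c d θ) (vd (vY c d θ) (vd (vY c d θ) θ)) p := by
    rw [← vd_congr h.isOpen hp _ fun x hx => h.comm h.smooth_θ hx]
    exact (h.comm sY hp).symm
  rw [c1, c2, ← h.comm h.smooth_θ hp]
  unfold energy
  linear_combination 2 * vd (vX c d θ) θ p * lX + 2 * vd (vY c d θ) θ p * lY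

/-- The quantity to which the maximum principle is applied. -/
def gauge (c d θ : E2 → ℝ) (q : E2) (R ε : ℝ) (z : E2) : ℝ :=
  cutoff q R z ^ 2 * energy c d θ z * Real.exp (-(2 + ε) * θ z) / Real.sinh (θ z) ^ 2

lemma cutoff_grad_le (h : IsFrame N c d θ) (hp : p ∈ N) {q : E2} {R : ℝ} (hR : 0 < R)
    (hR1 : R ≤ 1) (hχ : 0 < cutoff q R p) :
    vd (vX c d θ) (cutoff q R) p ^ 2 + vd (vY c d θ) (cutoff q R) p ^ 2 ≤ Real.cosh (θ p) ^ 2 ∧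
    -(vd (vX c d θ) (vd (vX c d θ) (cutoff q R)) p + vd (vY c d θ) (vd (vY c d θ) (cutoff q R)) p)
      ≤ 2 * Real.cosh (θ p) ^ 2 := by
  have hu := h.unit p hp
  have hk := h.disk p hp
  have hcs := Real.cosh_sq (θ p)
  have hk1 : kap p ≤ 1 := by unfold kap; nlinarith [sq_nonneg (p 0), sq_nonneg (p 1)]
  have hr : p 0 ^ 2 + p 1 ^ 2 ≤ 1 := by unfold kap at hk; linarith
  have hd : (p 0 - q 0) ^ 2 + (p 1 - q 1) ^ 2 ≤ 1 := by
    unfold cutoff at hχ; nlinarith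
  rw [h.laplacian_cutoff hp]
  have e : ∀ V : E2 → E2, vd V (cutoff q R) p = _ := fun V => (hasD_cutoff q R (V p) p).2
  rw [e, e]
  have x0 : vX c d θ p 0 = kap p / 2 * Real.sinh (θ p) * c p := rfl
  have x1 : vX c d θ p 1 = kap p / 2 * Real.sinh (θ p) * d p := rfl
  have y0 : vY c d θ p 0 = -(kap p / 2 * Real.cosh (θ p) * d p) := rfl
  have y1 : vY c d θ p 1 = kap p / 2 * Real.cosh (θ p) * c p := rfl
  rw [x0, x1, y0, y1]
  generalize kap p = κ at *
  generalize Real.sinh (θ p) = S at *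
  generalize Real.cosh (θ p) = C at *
  generalize c p = cc at *
  generalize d p = dd at *
  generalize p 0 = x at *
  generalize p 1 = y at *
  generalize x - q 0 = X at *
  generalize y - q 1 = Y at *
  have hκ2 : κ ^ 2 ≤ 1 := by nlinarith
  constructor
  · have : (-2 * (X * (κ / 2 * S * cc) + Y * (κ / 2 * S * dd))) ^ 2 +
        (-2 * (X * (-(κ / 2 * C * dd)) + Y * (κ / 2 * C * cc))) ^ 2
        = κ ^ 2 * (C ^ 2 * ((X ^ 2 + Y ^ 2) * (cc ^ 2 + dd ^ 2)) - (X * cc + Y * dd) ^ 2) := by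
      linear_combination (-κ ^ 2 * (X * cc + Y * dd) ^ 2) * hcs
    rw [this, hu, mul_one]
    have h1 : C ^ 2 * (X ^ 2 + Y ^ 2) - (X * cc + Y * dd) ^ 2 ≤ C ^ 2 := by
      nlinarith [sq_nonneg C, sq_nonneg (X * cc + Y * dd)]
    nlinarith [sq_nonneg C, sq_nonneg κ]
  · have h2 : κ * (X * ((x * cc + y * dd) * cc + (y * cc - x * dd) * dd)
        + Y * ((x * cc + y * dd) * dd - (y * cc - x * dd) * cc)) ≤ 1 := by
      set A := (x * cc + y * dd) * cc + (y * cc - x * dd) * dd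
      set B := (x * cc + y * dd) * dd - (y * cc - x * dd) * cc
      have hAB : A ^ 2 + B ^ 2 ≤ 1 := by
        have : A ^ 2 + B ^ 2 = (x ^ 2 + y ^ 2) * (cc ^ 2 + dd ^ 2) ^ 2 := by
          simp only [A, B]; ring
        rw [this, hu]; linarith
      have : X * A + Y * B ≤ 1 := by
        nlinarith [sq_nonneg (X - A), sq_nonneg (Y - B)]
      nlinarith
    have h3 : (κ / 2 * S) ^ 2 + (κ / 2 * C) ^ 2 ≤ C ^ 2 / 2 := by
      have : (κ / 2 * S) ^ 2 + (κ / 2 * C) ^ 2 = κ ^ 2 * (2 * C ^ 2 - 1) / 4 := by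
        rw [mul_pow, mul_pow]; linear_combination (-κ ^ 2 / 4) * hcs
      rw [this]; nlinarith [sq_nonneg C, sq_nonneg S, sq_nonneg κ]
    nlinarith [sq_nonneg S]

lemma gauge_le_of_isLocalMax (h : IsFrame N c d θ) (hp : p ∈ N) {q : E2} {R ε : ℝ} (hR : 0 < R)
    (hR1 : R ≤ 1) (hε : 0 < ε) (hε1 : ε ≤ 1) (hχ : 0 < cutoff q R p)
    (hP : 0 < energy c d θ p) (hmax : IsLocalMax (gauge c d θ q R ε) p) :
    gauge c d θ q R ε p ≤ 12 := by
  set X := vX c d θ with hX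
  set Y := vY c d θ with hY
  have ho := h.isOpen
  have sX := h.smooth_vX
  have sY := h.smooth_vY
  set N' := (N ∩ {z | 0 < energy c d θ z}) ∩ {z | 0 < cutoff q R z} with hN'
  have hχc : Continuous (cutoff q R) := (contDiff_cutoff q R).continuous
  have hN'o : IsOpen N' := by
    refine IsOpen.inter ?_ (isOpen_lt continuous_const hχc)
    exact h.smooth_energy.continuousOn.isOpen_inter_preimage ho isOpen_Ioi
  have hsub : N' ⊆ N := fun z hz => hz.1.1
  have hpN' : p ∈ N' := ⟨⟨hp, hP⟩, hχ⟩
  have sE : ContDiffOn ℝ ∞ (energy c d θ) N' := h.smooth_energy.mono hsub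
  have sχ : ContDiffOn ℝ ∞ (cutoff q R) N' := (contDiff_cutoff q R).contDiffOn
  have sθ : ContDiffOn ℝ ∞ θ N' := h.smooth_θ.mono hsub
  have hsinh : ∀ z ∈ N', 0 < Real.sinh (θ z) := fun z hz => Real.sinh_pos_iff.2 (h.pos z hz.1.1)
  have sS : ContDiffOn ℝ ∞ (fun z => Real.sinh (θ z)) N' := Real.contDiff_sinh.comp_contDiffOn sθ
  set Φ : E2 → ℝ := fun z => Real.log (energy c d θ z) + 2 * Real.log (cutoff q R z)
    - 2 * Real.log (Real.sinh (θ z)) - (2 + ε) * θ z with hΦ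
  have sΦ : ContDiffOn ℝ ∞ Φ N' :=
    (((sE.log fun z hz => hz.1.2.ne').add
      (contDiffOn_const.mul (sχ.log fun z hz => hz.2.ne'))).sub
      (contDiffOn_const.mul (sS.log fun z hz => (hsinh z hz).ne'))).sub
      (contDiffOn_const.mul sθ)
  have hlog : ∀ z ∈ N', Φ z = Real.log (gauge c d θ q R ε z) := by
    intro z hz
    have h1 : energy c d θ z ≠ 0 := hz.1.2.ne'
    have h2 : cutoff q R z ≠ 0 := hz.2.ne'
    have h3 := (hsinh z hz).ne'
    have h4 := (Real.exp_pos (-(2 + ε) * θ z)).ne'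
    rw [gauge, Real.log_div (by positivity) (by positivity), Real.log_mul (by positivity) h4,
      Real.log_mul (by positivity) h1, Real.log_exp, Real.log_pow, Real.log_pow]
    simp only [hΦ]; push_cast; ring
  have hpos : ∀ z ∈ N', 0 < gauge c d θ q R ε z := by
    intro z hz
    have h1 : 0 < energy c d θ z := hz.1.2
    have h2 : 0 < cutoff q R z := hz.2
    have h3 := hsinh z hz
    unfold gauge; positivity
  have hΦmax : IsLocalMax Φ p := by
    filter_upwards [hmax, hN'o.mem_nhds hpN'] with z h1 h2
    rw [hlog z h2, hlog p hpN']
    exact Real.log_le_log (hpos z h2) h1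
  have hS : 0 < Real.sinh (θ p) := hsinh p hpN'
  -- first derivatives
  have first : ∀ V : E2 → E2, ∀ z ∈ N', vd V Φ z
      = vd V (energy c d θ) z / energy c d θ z + 2 * (vd V (cutoff q R) z / cutoff q R z)
        - 2 * (Real.cosh (θ z) * vd V θ z / Real.sinh (θ z)) - (2 + ε) * vd V θ z := by
    intro V z hz
    have hz1 : energy c d θ z ≠ 0 := hz.1.2.ne'
    have hz2 : cutoff q R z ≠ 0 := hz.2.ne'
    have k1 := HasD.comp (Real.hasDerivAt_log hz1) (hasD_vd (V := V) hN'o sE hz)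
    have k2 := HasD.comp (Real.hasDerivAt_log hz2) (hasD_vd (V := V) hN'o sχ hz)
    have k3 := HasD.comp (Real.hasDerivAt_log (hsinh z hz).ne')
      (hasD_sinh (V z) (hasD_vd (V := V) hN'o sθ hz))
    have := (((k1.add (k2.const_mul 2)).sub (k3.const_mul 2)).sub
      ((hasD_vd (V := V) hN'o sθ hz).const_mul (2 + ε))).2
    rw [vd, this]; ring
  have second : ∀ V : E2 → E2, ContDiffOn ℝ ∞ V N → vd V (vd V Φ) p
      = (vd V (vd V (energy c d θ)) p / energy c d θ p - (vd V (energy c d θ) p / energy c d θ p) ^ 2)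
        + 2 * (vd V (vd V (cutoff q R)) p / cutoff q R p - (vd V (cutoff q R) p / cutoff q R p) ^ 2)
        + 2 / Real.sinh (θ p) ^ 2 * vd V θ p ^ 2
        + (-2 * (Real.cosh (θ p) / Real.sinh (θ p)) - (2 + ε)) * vd V (vd V θ) p := by
    intro V hV
    have hV' := hV.mono hsub
    have g1 := (hasD_vd (V := V) hN'o (smooth_vd hN'o sE hV') hpN').div
      (hasD_vd (V := V) hN'o sE hpN') hP.ne'
    have g2 := (hasD_vd (V := V) hN'o (smooth_vd hN'o sχ hV') hpN').div
      (hasD_vd (V := V) hN'o sχ hpN') hχ.ne'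
    have hθ := hasD_vd (V := V) hN'o sθ hpN'
    have hθ2 := hasD_vd (V := V) hN'o (smooth_vd hN'o sθ hV') hpN'
    have g3 := ((hasD_cosh (V p) hθ).mul hθ2).div (hasD_sinh (V p) hθ) hS.ne'
    have := (((g1.add (g2.const_mul 2)).sub (g3.const_mul 2)).sub
      (hθ2.const_mul (2 + ε))).congr_on hN'o hpN' (first V)
    rw [vd, this.2]
    have hcs := Real.cosh_sq (θ p)
    field_simp
    linear_combination (2 * energy c d θ p ^ 2 * cutoff q R p ^ 2 * vd V θ p ^ 2) * hcs
  have z1 := first X p hpN'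
  have z2 := first Y p hpN'
  rw [vd, hΦmax.fderiv_eq_zero] at z1 z2
  have n1 := vd_vd_nonpos_of_isLocalMax hN'o sΦ (sX.mono hsub) hpN' hΦmax
  have n2 := vd_vd_nonpos_of_isLocalMax hN'o sΦ (sY.mono hsub) hpN' hΦmax
  rw [second X sX] at n1
  rw [second Y sY] at n2
  have le := h.laplacian_energy hp
  have la := h.laplacian_angle hp
  obtain ⟨b1, b2⟩ := h.cutoff_grad_le hp hR hR1 hχ
  have v1 := h.vd_energy hp X
  have v2 := h.vd_energy hp Y
  simp only [← hX, ← hY] at le la b1 b2 v1 v2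
  rw [← h.comm h.smooth_θ hp] at v2
  simp only [← hX, ← hY] at v2
  rw [v1] at z1 n1
  rw [v2] at z2 n2
  have hC : 0 < Real.cosh (θ p) := Real.cosh_pos _
  have hcs := Real.cosh_sq (θ p)
  have hPd : energy c d θ p = vd X θ p ^ 2 + vd Y θ p ^ 2 := rfl
  have hce := exp_mul_cosh_sq_le hε (h.pos p hp)
  have hχ1 := cutoff_le_one q p hR hR1
  have hSC : Real.sinh (θ p) ≤ Real.cosh (θ p) := (Real.sinh_lt_cosh _).le
  unfold gauge
  exact max_point_bound hP hPd hχ hχ1 hS hC hSC hε1 la (by simpa using z1) (by simpa using z2)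
    n1 n2 le b1 b2 hce (Real.exp_pos _)

end IsFrame

namespace IsFrame

variable {N : Set E2} {c d θ f : E2 → ℝ} {p : E2}

lemma gauge_eq_mul_exp (q : E2) (R ε : ℝ) (z : E2) :
    gauge c d θ q R ε z = gauge c d θ q R 0 z * Real.exp (-ε * θ z) := by
  unfold gauge
  rw [show -(2 + ε) * θ z = -(2 + 0) * θ z + -ε * θ z by ring, Real.exp_add]
  ring

lemma continuousOn_gauge (h : IsFrame N c d θ) (q : E2) (R ε : ℝ) :
    ContinuousOn (gauge c d θ q R ε) N := by
  have hθ := h.smooth_θ.continuousOn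
  refine ContinuousOn.div ?_ ((Real.continuous_sinh.comp_continuousOn hθ).pow 2)
    fun z hz => (pow_pos (Real.sinh_pos_iff.2 (h.pos z hz)) 2).ne'
  exact ((((contDiff_cutoff q R).continuous.continuousOn).pow 2).mul
    h.smooth_energy.continuousOn).mul
    (Real.continuous_exp.comp_continuousOn (continuousOn_const.mul hθ))

lemma gauge_nonneg (q : E2) (R ε : ℝ) (z : E2) : 0 ≤ gauge c d θ q R ε z := by
  unfold gauge energy; positivity

lemma cutoff_pos_iff {q : E2} {R : ℝ} (hR : 0 < R) (z : E2) :
    0 < cutoff q R z ↔ z ∈ Metric.ball q R := by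
  rw [cutoff_eq, Metric.mem_ball, sub_pos, sq_lt_sq₀ dist_nonneg hR.le]

/-- Interior gradient estimate for the angle function. -/
theorem gauge_le (h : IsFrame N c d θ) {q : E2} {R : ℝ} (hR : 0 < R) (hR1 : R ≤ 1) {K : ℝ}
    (hcpt : ∀ T, IsCompact {z | z ∈ N ∧ z ∈ Metric.closedBall q R ∧ θ z ≤ T})
    (hK : ∀ z ∈ N, z ∈ Metric.closedBall q R → gauge c d θ q R 0 z ≤ K)
    (hp : p ∈ N) (hpb : p ∈ Metric.ball q R) : gauge c d θ q R 0 p ≤ 12 := by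
  have key : ∀ ε, 0 < ε → ε ≤ 1 → gauge c d θ q R ε p ≤ 12 := by
    intro ε hε hε1
    rcases (gauge_nonneg (c := c) (d := d) (θ := θ) q R ε p).eq_or_lt with h0 | h0
    · rw [← h0]; norm_num
    have ht : Tendsto (fun T : ℝ => |K| * Real.exp (-ε * T)) atTop (𝓝 (|K| * 0)) := by
      refine Tendsto.const_mul _ (Real.tendsto_exp_atBot.comp ?_)
      exact tendsto_id.const_mul_atTop_of_neg (by linarith)
    rw [mul_zero] at ht
    obtain ⟨T, hT1, hT2⟩ := ((ht.eventually_lt_const h0).and (eventually_ge_atTop (θ p))).exists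
    obtain ⟨z, hz, hmax⟩ := (hcpt T).exists_isMaxOn
      ⟨p, hp, Metric.ball_subset_closedBall hpb, hT2⟩
      ((h.continuousOn_gauge q R ε).mono fun z hz => hz.1)
    have hpz : gauge c d θ q R ε p ≤ gauge c d θ q R ε z :=
      hmax ⟨hp, Metric.ball_subset_closedBall hpb, hT2⟩
    have hall : ∀ w ∈ N, w ∈ Metric.closedBall q R →
        gauge c d θ q R ε w ≤ gauge c d θ q R ε z := by
      intro w hw hwb
      by_cases hwT : θ w ≤ T
      · exact hmax ⟨hw, hwb, hwT⟩
      · refine le_trans ?_ (hT1.le.trans hpz)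
        rw [gauge_eq_mul_exp]
        have h1 : gauge c d θ q R 0 w ≤ |K| := (hK w hw hwb).trans (le_abs_self K)
        have h2 : Real.exp (-ε * θ w) ≤ Real.exp (-ε * T) := by
          apply Real.exp_le_exp.2; nlinarith
        gcongr
    have hz0 : 0 < gauge c d θ q R ε z := h0.trans_le hpz
    have hχ0 : cutoff q R z ≠ 0 := by
      intro h0; simp [gauge, h0] at hz0
    have hE0 : energy c d θ z ≠ 0 := by
      intro h0; simp [gauge, h0] at hz0
    have hχ : 0 < cutoff q R z := by
      refine lt_of_le_of_ne ?_ hχ0.symm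
      rw [cutoff_eq, sub_nonneg]
      exact pow_le_pow_left₀ dist_nonneg hz.2.1 2
    have hE : 0 < energy c d θ z := lt_of_le_of_ne (by unfold energy; positivity) hE0.symm
    refine hpz.trans (h.gauge_le_of_isLocalMax hz.1 hR hR1 hε hε1 hχ hE ?_)
    have hzb : z ∈ Metric.ball q R := (cutoff_pos_iff hR z).1 hχ
    filter_upwards [h.isOpen.mem_nhds hz.1, Metric.isOpen_ball.mem_nhds hzb] with w h1 h2
    exact hall w h1 (Metric.ball_subset_closedBall h2)
  have ht : Tendsto (fun ε : ℝ => gauge c d θ q R ε p) (𝓝[>] 0) (𝓝 (gauge c d θ q R 0 p)) := by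
    have hc : Continuous fun ε : ℝ => gauge c d θ q R ε p := by unfold gauge; fun_prop
    exact (hc.tendsto 0).mono_left nhdsWithin_le_nhds
  refine le_of_tendsto ht ?_
  filter_upwards [Ioc_mem_nhdsGT (zero_lt_one' ℝ)] with ε hε
  exact key ε hε.1 hε.2

end IsFrame

/-! ### The minimal graph equation in nondivergence form -/

/-- The minimal graph operator in nondivergence form. -/
def mgOp (u : E2 → ℝ) (p : E2) : ℝ :=
  (1 + (kap p / 2) ^ 2 * (pd 0 u p ^ 2 + pd 1 u p ^ 2)) * (pd 0 (pd 0 u) p + pd 1 (pd 1 u) p)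
    - (kap p / 2) ^ 2 * (pd 0 u p ^ 2 * pd 0 (pd 0 u) p + 2 * pd 0 u p * pd 1 u p * pd 0 (pd 1 u) p
      + pd 1 u p ^ 2 * pd 1 (pd 1 u) p)
    + kap p / 2 * (pd 0 u p ^ 2 + pd 1 u p ^ 2) * (p 0 * pd 0 u p + p 1 * pd 1 u p)

lemma kap_eq (p : E2) : kap p = 1 - ‖p‖ ^ 2 := by rw [E2.norm_sq]; rfl

lemma kap_pos {p : E2} (hp : p ∈ Disk) : 0 < kap p := by
  rw [kap_eq]
  have h : ‖p‖ < 1 := hp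
  nlinarith [norm_nonneg p]

lemma lam_inv (p : E2) : (lam p)⁻¹ = kap p / 2 := by
  rw [lam, kap_eq, inv_div]

lemma gradient_apply (u : E2 → ℝ) (p : E2) (i : Fin 2) : gradient u p i = pd i u p := by
  have h : inner ℝ (gradient u p) (EuclideanSpace.single i (1:ℝ))
      = fderiv ℝ u p (EuclideanSpace.single i 1) := by
    rw [gradient, InnerProductSpace.toDual_symm_apply]
  rw [EuclideanSpace.inner_single_right] at h
  simpa [pd] using h

lemma norm_gradient_sq (u : E2 → ℝ) (p : E2) :
    ‖gradient u p‖ ^ 2 = pd 0 u p ^ 2 + pd 1 u p ^ 2 := by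
  rw [E2.norm_sq, gradient_apply, gradient_apply]

lemma Xfield_apply (u : E2 → ℝ) (p : E2) (i : Fin 2) :
    Xfield u p i = (Real.sqrt (1 + (kap p / 2) ^ 2 * (pd 0 u p ^ 2 + pd 1 u p ^ 2)))⁻¹ * pd i u p := by
  rw [Xfield, lam_inv, norm_gradient_sq, PiLp.smul_apply, gradient_apply, smul_eq_mul]

lemma div0_Xfield {Ω : Set E2} (hΩ : IsOpen Ω) {u : E2 → ℝ} (hu : ContDiffOn ℝ ∞ u Ω) {p : E2}
    (hp : p ∈ Ω) :
    div0 (Xfield u) p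
      = (Real.sqrt (1 + (kap p / 2) ^ 2 * (pd 0 u p ^ 2 + pd 1 u p ^ 2)))⁻¹ ^ 3 * mgOp u p := by
  set W2 : E2 → ℝ := fun x => 1 + (2⁻¹ * kap x) ^ 2 * (pd 0 u x ^ 2 + pd 1 u x ^ 2) with hW2
  have e : ∀ x, 1 + (kap x / 2) ^ 2 * (pd 0 u x ^ 2 + pd 1 u x ^ 2) = W2 x := by
    intro x; simp only [hW2]; ring
  have hW2pos : 0 < W2 p := by simp only [hW2]; positivity
  have hsq : Real.sqrt (W2 p) ^ 2 = W2 p := Real.sq_sqrt hW2pos.le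
  have hsp : 0 < Real.sqrt (W2 p) := Real.sqrt_pos.2 hW2pos
  have s0 := smooth_pd hΩ hu 0
  have s1 := smooth_pd hΩ hu 1
  have sj : ∀ j, ContDiffOn ℝ ∞ (pd j u) Ω := fun j => smooth_pd hΩ hu j
  have comp : ∀ i j : Fin 2, HasD (EuclideanSpace.single i 1) (fun x => Xfield u x j) p
      (-((kap p * (-2 * (p 0 * (EuclideanSpace.single i (1:ℝ) : E2) 0
            + p 1 * (EuclideanSpace.single i (1:ℝ) : E2) 1)) * 2⁻¹ * (pd 0 u p ^ 2 + pd 1 u p ^ 2)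
          + (kap p / 2) ^ 2 * (2 * pd 0 u p * pd i (pd 0 u) p + 2 * pd 1 u p * pd i (pd 1 u) p)) / 2
          * pd j u p) / Real.sqrt (W2 p) ^ 3 + pd i (pd j u) p / Real.sqrt (W2 p)) := by
    intro i j
    have hk := ((hasD_kap (EuclideanSpace.single i 1) p).const_mul 2⁻¹).sq
    have hW := (HasD.const (EuclideanSpace.single i 1) p 1).add
      (hk.mul ((hasD_pd hΩ s0 hp i).sq.add (hasD_pd hΩ s1 hp i).sq))
    have hs := (HasD.comp (Real.hasDerivAt_sqrt hW2pos.ne') hW).inv hsp.ne'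
    have := hs.mul (hasD_pd hΩ (sj j) hp i)
    have e2 : (fun x => Xfield u x j) = fun x => (Real.sqrt (W2 x))⁻¹ * pd j u x := by
      funext x; rw [Xfield_apply, e]
    rw [e2]
    convert this using 1
    field_simp
    ring
  have hdiff : DifferentiableAt ℝ (Xfield u) p := by
    rw [differentiableAt_piLp]
    intro i
    exact (comp 0 i).1
  have hdiv : div0 (Xfield u) p = ∑ i, pd i (fun x => Xfield u x i) p := by
    unfold div0
    refine Finset.sum_congr rfl fun i _ => ?_
    have h2 := ((EuclideanSpace.proj (𝕜 := ℝ) (i : Fin 2) : E2 →L[ℝ] ℝ).hasFDerivAt).comp p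
      hdiff.hasFDerivAt
    have h3 : (⇑(EuclideanSpace.proj (𝕜 := ℝ) (i : Fin 2) : E2 →L[ℝ] ℝ) ∘ Xfield u)
      = fun x => Xfield u x i := rfl
    rw [h3] at h2
    rw [pd, h2.fderiv]; rfl
  rw [hdiv, Fin.sum_univ_two, pd, pd, (comp 0 0).2, (comp 1 1).2, e]
  have h10 := pd_comm hΩ hu hp 1 0
  rw [h10]
  simp only [PiLp.single_apply]
  simp only [mgOp]
  have hWp : Real.sqrt (W2 p) ^ 2 = 1 + (kap p / 2) ^ 2 * (pd 0 u p ^ 2 + pd 1 u p ^ 2) := by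
    rw [hsq, ← e]
  rw [← hWp]
  generalize Real.sqrt (W2 p) = w at *
  have hw := hsp.ne'
  simp
  field_simp
  ring

lemma isMinimalGraph_iff {Ω : Set E2} (hΩ : IsOpen Ω) {u : E2 → ℝ} :
    IsMinimalGraph Ω u ↔ ContDiffOn ℝ ∞ u Ω ∧ ∀ p ∈ Ω, mgOp u p = 0 := by
  refine and_congr_right fun hu => forall₂_congr fun p hp => ?_
  rw [div0_Xfield hΩ hu hp, mul_eq_zero, or_iff_right]
  have : 0 < 1 + (kap p / 2) ^ 2 * (pd 0 u p ^ 2 + pd 1 u p ^ 2) := by positivity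
  exact (pow_pos (inv_pos.2 (Real.sqrt_pos.2 this)) 3).ne'

/-! ### The adapted frame of a minimal graph -/

/-- Euclidean length of the gradient. -/
def gn (u : E2 → ℝ) (p : E2) : ℝ := Real.sqrt (pd 0 u p ^ 2 + pd 1 u p ^ 2)

/-- First component of the gradient direction. -/
def dirc (u : E2 → ℝ) (p : E2) : ℝ := pd 0 u p / gn u p

/-- Second component of the gradient direction. -/
def dird (u : E2 → ℝ) (p : E2) : ℝ := pd 1 u p / gn u p

/-- Hyperbolic angle function. -/
def ang (u : E2 → ℝ) (p : E2) : ℝ := Real.arsinh (2 / (kap p * gn u p))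

/-- The noncritical points. -/
def noncrit (Ω : Set E2) (u : E2 → ℝ) : Set E2 := Ω ∩ {p | 0 < gn u p}

section Frame

variable {Ω : Set E2} {u : E2 → ℝ} {p : E2}

lemma gn_nonneg (u : E2 → ℝ) (p : E2) : 0 ≤ gn u p := Real.sqrt_nonneg _

lemma gn_sq (u : E2 → ℝ) (p : E2) : gn u p ^ 2 = pd 0 u p ^ 2 + pd 1 u p ^ 2 :=
  Real.sq_sqrt (by positivity)

lemma gn_eq_norm (u : E2 → ℝ) (p : E2) : gn u p = ‖gradient u p‖ := by
  rw [gn, ← norm_gradient_sq, Real.sqrt_sq (norm_nonneg _)]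

lemma sinh_ang (u : E2 → ℝ) (p : E2) : Real.sinh (ang u p) = 2 / (kap p * gn u p) :=
  Real.sinh_arsinh _

lemma continuousOn_gn (hΩ : IsOpen Ω) (hu : ContDiffOn ℝ ∞ u Ω) : ContinuousOn (gn u) Ω :=
  Real.continuous_sqrt.comp_continuousOn
    (((smooth_pd hΩ hu 0).continuousOn.pow 2).add ((smooth_pd hΩ hu 1).continuousOn.pow 2))

lemma isOpen_noncrit (hΩ : IsOpen Ω) (hu : ContDiffOn ℝ ∞ u Ω) : IsOpen (noncrit Ω u) :=
  (continuousOn_gn hΩ hu).isOpen_inter_preimage hΩ isOpen_Ioi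

lemma hasD_gn (hΩ : IsOpen Ω) (hu : ContDiffOn ℝ ∞ u Ω) (hp : p ∈ noncrit Ω u) (v : E2) :
    HasD v (gn u) p
      ((pd 0 u p * fderiv ℝ (pd 0 u) p v + pd 1 u p * fderiv ℝ (pd 1 u) p v) / gn u p) := by
  have h0 := hasD_vd (V := fun _ => v) hΩ (smooth_pd hΩ hu 0) hp.1
  have h1 := hasD_vd (V := fun _ => v) hΩ (smooth_pd hΩ hu 1) hp.1
  have hg : 0 < gn u p := hp.2
  have hg2 := gn_sq u p
  have hne : pd 0 u p ^ 2 + pd 1 u p ^ 2 ≠ 0 := by rw [← hg2]; positivity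
  have := HasD.comp (Real.hasDerivAt_sqrt hne) (h0.sq.add h1.sq)
  change HasD v (gn u) p _ at this
  convert this using 1
  change _ / gn u p = 1 / (2 * gn u p) * (2 * pd 0 u p * fderiv ℝ (pd 0 u) p v
    + 2 * pd 1 u p * fderiv ℝ (pd 1 u) p v)
  field_simp

lemma hasD_ang (hΩ : IsOpen Ω) (hΩD : Ω ⊆ Disk) (hu : ContDiffOn ℝ ∞ u Ω)
    (hp : p ∈ noncrit Ω u) (v : E2) :
    HasD v (ang u) p (-(Real.sinh (ang u p) / Real.cosh (ang u p))
      * (-2 * (p 0 * v 0 + p 1 * v 1) / kap p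
        + (pd 0 u p * fderiv ℝ (pd 0 u) p v + pd 1 u p * fderiv ℝ (pd 1 u) p v) / gn u p ^ 2)) := by
  have hk : 0 < kap p := kap_pos (hΩD hp.1)
  have hg : 0 < gn u p := hp.2
  have h1 := (HasD.const v p 2).div ((hasD_kap v p).mul (hasD_gn hΩ hu hp v)) (mul_pos hk hg).ne'
  have h2 := HasD.comp (Real.hasDerivAt_arsinh _) h1
  rw [← Real.cosh_arsinh] at h2
  change HasD v (ang u) p ((Real.cosh (ang u p))⁻¹ * _) at h2
  convert h2 using 1
  rw [sinh_ang]
  have hC := (Real.cosh_pos (ang u p)).ne'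
  field_simp
  ring

lemma smooth_gn (hΩ : IsOpen Ω) (hu : ContDiffOn ℝ ∞ u Ω) :
    ContDiffOn ℝ ∞ (gn u) (noncrit Ω u) := by
  have hs : noncrit Ω u ⊆ Ω := fun p hp => hp.1
  refine ContDiffOn.sqrt ((((smooth_pd hΩ hu 0).mono hs).pow 2).add
    (((smooth_pd hΩ hu 1).mono hs).pow 2)) fun p hp => ?_
  rw [← gn_sq]
  have : 0 < gn u p := hp.2
  positivity

/-- A minimal graph defines an adapted frame on its set of noncritical points. -/
lemma isFrame (hΩ : IsOpen Ω) (hΩD : Ω ⊆ Disk) (hu : ContDiffOn ℝ ∞ u Ω)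
    (hm : ∀ p ∈ Ω, mgOp u p = 0) : IsFrame (noncrit Ω u) (dirc u) (dird u) (ang u) := by
  have hs : noncrit Ω u ⊆ Ω := fun p hp => hp.1
  have s0 := (smooth_pd hΩ hu 0).mono hs
  have s1 := (smooth_pd hΩ hu 1).mono hs
  have sg := smooth_gn hΩ hu
  have hg : ∀ p ∈ noncrit Ω u, 0 < gn u p := fun p hp => hp.2
  have hk : ∀ p ∈ noncrit Ω u, 0 < kap p := fun p hp => kap_pos (hΩD hp.1)
  have rot : ∀ p ∈ noncrit Ω u, ∀ v : E2, dirc u p * fderiv ℝ (dird u) p v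
      - dird u p * fderiv ℝ (dirc u) p v
      = (pd 0 u p * fderiv ℝ (pd 1 u) p v - pd 1 u p * fderiv ℝ (pd 0 u) p v) / gn u p ^ 2 := by
    intro p hp v
    have h0 := hasD_vd (V := fun _ => v) hΩ (smooth_pd hΩ hu 0) hp.1
    have h1 := hasD_vd (V := fun _ => v) hΩ (smooth_pd hΩ hu 1) hp.1
    have hg0 := (hg p hp).ne'
    have hc : HasD v (dirc u) p _ := h0.div (hasD_gn hΩ hu hp v) hg0
    have hd : HasD v (dird u) p _ := h1.div (hasD_gn hΩ hu hp v) hg0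
    rw [hc.2, hd.2]
    simp only [vd, dirc, dird]
    field_simp
    ring
  refine ⟨isOpen_noncrit hΩ hu, hk, s0.div sg fun p hp => (hg p hp).ne',
    s1.div sg fun p hp => (hg p hp).ne', ?_, ?_, ?_, ?_, ?_⟩
  · exact Real.contDiff_arsinh.comp_contDiffOn (contDiffOn_const.div
      (contDiff_kap.contDiffOn.mul sg) fun p hp => (mul_pos (hk p hp) (hg p hp)).ne')
  · intro p hp
    have hg0 := (hg p hp).ne'
    simp only [dirc, dird]
    field_simp
    exact (gn_sq u p).symm
  · intro p hp
    exact Real.arsinh_pos_iff.2 (div_pos two_pos (mul_pos (hk p hp) (hg p hp)))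
  · intro p hp
    simp only [vd]
    rw [rot p hp, (hasD_ang hΩ hΩD hu hp _).2]
    simp only [fderiv_eq_pd]
    rw [pd_comm hΩ hu hp.1 1 0]
    have x0 : vX (dirc u) (dird u) (ang u) p 0 = kap p / 2 * Real.sinh (ang u p) * dirc u p := rfl
    have x1 : vX (dirc u) (dird u) (ang u) p 1 = kap p / 2 * Real.sinh (ang u p) * dird u p := rfl
    have y0 : vY (dirc u) (dird u) (ang u) p 0 = -(kap p / 2 * Real.cosh (ang u p) * dird u p) := rfl
    have y1 : vY (dirc u) (dird u) (ang u) p 1 = kap p / 2 * Real.cosh (ang u p) * dirc u p := rfl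
    rw [x0, x1, y0, y1]
    have hC := (Real.cosh_pos (ang u p)).ne'
    have hk0 := (hk p hp).ne'
    have hg0 := (hg p hp).ne'
    simp only [dirc, dird]
    field_simp
    ring
  · intro p hp
    simp only [vd]
    rw [rot p hp, (hasD_ang hΩ hΩD hu hp _).2]
    simp only [fderiv_eq_pd]
    have hmp := hm p hp.1
    rw [mgOp] at hmp
    rw [pd_comm hΩ hu hp.1 1 0]
    have x0 : vX (dirc u) (dird u) (ang u) p 0 = kap p / 2 * Real.sinh (ang u p) * dirc u p := rfl
    have x1 : vX (dirc u) (dird u) (ang u) p 1 = kap p / 2 * Real.sinh (ang u p) * dird u p := rfl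
    have y0 : vY (dirc u) (dird u) (ang u) p 0 = -(kap p / 2 * Real.cosh (ang u p) * dird u p) := rfl
    have y1 : vY (dirc u) (dird u) (ang u) p 1 = kap p / 2 * Real.cosh (ang u p) * dirc u p := rfl
    rw [x0, x1, y0, y1]
    have hC := (Real.cosh_pos (ang u p)).ne'
    have hk0 := (hk p hp).ne'
    have hg0 := (hg p hp).ne'
    have hg2 := gn_sq u p
    have hcs : Real.cosh (ang u p) ^ 2 = 1 + 4 / (kap p * gn u p) ^ 2 := by
      rw [Real.cosh_sq, sinh_ang]; field_simp; ring
    rw [← mul_left_inj' hC, sinh_ang]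
    simp only [dirc, dird]
    rw [← hg2] at hmp
    generalize Real.cosh (ang u p) = C at *
    generalize gn u p = g at *
    generalize kap p = κ at *
    generalize pd 0 u p = a at *
    generalize pd 1 u p = b at *
    generalize pd 0 (pd 0 u) p = r at *
    generalize pd 0 (pd 1 u) p = s at *
    generalize pd 1 (pd 1 u) p = t at *
    generalize p 0 = x at *
    generalize p 1 = y at *
    have hC2 : κ ^ 2 * g ^ 2 * C ^ 2 = κ ^ 2 * g ^ 2 + 4 := by
      rw [hcs]; field_simp
    field_simp
    linear_combination (κ * (b ^ 2 * r - 2 * a * b * s + a ^ 2 * t)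
      + 2 * g ^ 2 * (a * x + b * y)) * hC2 + 4 * κ * g ^ 2 * hmp
      - κ * (4 + κ ^ 2 * g ^ 2) * (r + t) * hg2

end Frame

section AngleEstimate

variable {Ω : Set E2} {u : E2 → ℝ} {p : E2}

lemma abs_inner_le_norm (a v : E2) : |a 0 * v 0 + a 1 * v 1| ≤ ‖a‖ * ‖v‖ := by
  have h1 := E2.norm_sq a
  have h2 := E2.norm_sq v
  apply abs_le_of_sq_le_sq _ (by positivity)
  rw [mul_pow, h1, h2]
  nlinarith [sq_nonneg (a 0 * v 1 - a 1 * v 0)]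

lemma norm_vX_le (h : IsFrame (noncrit Ω u) (dirc u) (dird u) (ang u)) (hp : p ∈ noncrit Ω u) :
    ‖vX (dirc u) (dird u) (ang u) p‖ ≤ kap p / 2 * Real.cosh (ang u p) ∧
    ‖vY (dirc u) (dird u) (ang u) p‖ ≤ kap p / 2 * Real.cosh (ang u p) := by
  have hu := h.unit p hp
  have hk := h.disk p hp
  have hC := Real.cosh_pos (ang u p)
  have hcs := Real.cosh_sq (ang u p)
  have x0 : vX (dirc u) (dird u) (ang u) p 0 = kap p / 2 * Real.sinh (ang u p) * dirc u p := rfl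
  have x1 : vX (dirc u) (dird u) (ang u) p 1 = kap p / 2 * Real.sinh (ang u p) * dird u p := rfl
  have y0 : vY (dirc u) (dird u) (ang u) p 0 = -(kap p / 2 * Real.cosh (ang u p) * dird u p) := rfl
  have y1 : vY (dirc u) (dird u) (ang u) p 1 = kap p / 2 * Real.cosh (ang u p) * dirc u p := rfl
  constructor
  · apply le_of_sq_le_sq _ (by positivity)
    rw [E2.norm_sq, x0, x1]
    have : (kap p / 2 * Real.sinh (ang u p) * dirc u p) ^ 2
        + (kap p / 2 * Real.sinh (ang u p) * dird u p) ^ 2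
        = (kap p / 2) ^ 2 * Real.sinh (ang u p) ^ 2 := by
      linear_combination (kap p / 2) ^ 2 * Real.sinh (ang u p) ^ 2 * hu
    rw [this, mul_pow, hcs]
    nlinarith [sq_nonneg (kap p / 2)]
  · apply le_of_sq_le_sq _ (by positivity)
    rw [E2.norm_sq, y0, y1]
    apply le_of_eq
    linear_combination (kap p / 2) ^ 2 * Real.cosh (ang u p) ^ 2 * hu

lemma isCompact_ang_le (hΩ : IsOpen Ω) (hΩD : Ω ⊆ Disk) (hu : ContDiffOn ℝ ∞ u Ω)
    {q : E2} {R : ℝ} (hq : Metric.closedBall q R ⊆ Ω) (T : ℝ) :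
    IsCompact {z | z ∈ noncrit Ω u ∧ z ∈ Metric.closedBall q R ∧ ang u z ≤ T} := by
  have : {z | z ∈ noncrit Ω u ∧ z ∈ Metric.closedBall q R ∧ ang u z ≤ T}
      = Metric.closedBall q R ∩ (fun z => Real.sinh T * (kap z * gn u z)) ⁻¹' Ici 2 := by
    ext z
    simp only [mem_ofPred_eq, mem_inter_iff, mem_preimage, mem_Ici]
    constructor
    · rintro ⟨hz, hzb, hT⟩
      refine ⟨hzb, ?_⟩
      have hg : 0 < gn u z := hz.2
      have hk := kap_pos (hΩD hz.1)
      rw [← Real.sinh_le_sinh, sinh_ang, div_le_iff₀ (by positivity)] at hT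
      exact hT
    · rintro ⟨hzb, hT⟩
      have hk := kap_pos (hΩD (hq hzb))
      have hg : 0 < gn u z := by
        refine lt_of_le_of_ne (gn_nonneg u z) fun h0 => ?_
        rw [← h0] at hT; norm_num at hT
      refine ⟨⟨hq hzb, hg⟩, hzb, ?_⟩
      rw [← Real.sinh_le_sinh, sinh_ang, div_le_iff₀ (by positivity)]
      exact hT
  rw [this]
  have hc : ContinuousOn (fun z => Real.sinh T * (kap z * gn u z)) (Metric.closedBall q R) :=
    continuousOn_const.mul (contDiff_kap.continuous.continuousOn.mul
      ((continuousOn_gn hΩ hu).mono hq))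
  exact (isCompact_closedBall q R).of_isClosed_subset
    (hc.preimage_isClosed_of_isClosed Metric.isClosed_closedBall isClosed_Ici) inter_subset_left

lemma sinh_le_exp (t : ℝ) : Real.sinh t ≤ Real.exp t := by
  rw [Real.sinh_eq]; linarith [Real.exp_pos t, Real.exp_pos (-t)]

lemma kap_le_one (p : E2) : kap p ≤ 1 := by
  unfold kap; nlinarith [sq_nonneg (p 0), sq_nonneg (p 1)]

lemma norm_le_of_disk (hp : p ∈ Disk) : ‖p‖ ≤ 1 := le_of_lt hp

lemma gauge_bounded (hΩ : IsOpen Ω) (hΩD : Ω ⊆ Disk) (hu : ContDiffOn ℝ ∞ u Ω)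
    (hm : ∀ p ∈ Ω, mgOp u p = 0) {q : E2} {R : ℝ} (hR : 0 < R) (hR1 : R ≤ 1)
    (hq : Metric.closedBall q R ⊆ Ω) :
    ∃ K, ∀ z ∈ noncrit Ω u, z ∈ Metric.closedBall q R →
      IsFrame.gauge (dirc u) (dird u) (ang u) q R 0 z ≤ K := by
  have h := isFrame hΩ hΩD hu hm
  have cont : ∀ i, ContinuousOn (fderiv ℝ (pd i u)) (Metric.closedBall q R) := fun i =>
    (smooth_fderiv hΩ (smooth_pd hΩ hu i)).continuousOn.mono hq
  obtain ⟨M0, hM0⟩ := (isCompact_closedBall q R).exists_bound_of_continuousOn (cont 0)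
  obtain ⟨M1, hM1⟩ := (isCompact_closedBall q R).exists_bound_of_continuousOn (cont 1)
  set M := |M0| + |M1| with hM
  have hMn : 0 ≤ M := by positivity
  refine ⟨2 * (1 + M) ^ 2, fun z hz hzb => ?_⟩
  have hg : 0 < gn u z := hz.2
  have hk := kap_pos (hΩD hz.1)
  have hk1 := kap_le_one z
  have hC := Real.cosh_pos (ang u z)
  have hS : 0 < Real.sinh (ang u z) := Real.sinh_pos_iff.2 (h.pos z hz)
  have hgS : gn u z * Real.sinh (ang u z) * kap z = 2 := by
    rw [sinh_ang]; field_simp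
  have der : ∀ v : E2, ‖v‖ ≤ kap z / 2 * Real.cosh (ang u z) →
      |fderiv ℝ (ang u) z v| ≤ Real.sinh (ang u z) * (1 + kap z * M / (2 * gn u z)) := by
    intro v hv
    rw [(hasD_ang hΩ hΩD hu hz v).2, abs_mul, abs_neg, abs_of_pos (div_pos hS hC)]
    have a1 : |-2 * (z 0 * v 0 + z 1 * v 1) / kap z| ≤ 2 * ‖v‖ / kap z := by
      rw [abs_div, abs_of_pos hk, abs_mul]
      have := abs_inner_le_norm z v
      have hz1 := norm_le_of_disk (hΩD hz.1)
      have : |z 0 * v 0 + z 1 * v 1| ≤ ‖v‖ := by nlinarith [norm_nonneg v]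
      norm_num
      gcongr
    have a2 : |(pd 0 u z * fderiv ℝ (pd 0 u) z v + pd 1 u z * fderiv ℝ (pd 1 u) z v) / gn u z ^ 2|
        ≤ M * ‖v‖ / gn u z := by
      have b0 : |fderiv ℝ (pd 0 u) z v| ≤ |M0| * ‖v‖ :=
        ((fderiv ℝ (pd 0 u) z).le_opNorm v).trans (by
          gcongr; exact (hM0 z hzb).trans (le_abs_self _))
      have b1 : |fderiv ℝ (pd 1 u) z v| ≤ |M1| * ‖v‖ :=
        ((fderiv ℝ (pd 1 u) z).le_opNorm v).trans (by
          gcongr; exact (hM1 z hzb).trans (le_abs_self _))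
      have c0 : |pd 0 u z| ≤ gn u z :=
        abs_le_of_sq_le_sq (by rw [gn_sq]; nlinarith [sq_nonneg (pd 1 u z)]) hg.le
      have c1 : |pd 1 u z| ≤ gn u z :=
        abs_le_of_sq_le_sq (by rw [gn_sq]; nlinarith [sq_nonneg (pd 0 u z)]) hg.le
      rw [abs_div, abs_of_pos (by positivity : 0 < gn u z ^ 2), div_le_div_iff₀ (by positivity) hg]
      have : |pd 0 u z * fderiv ℝ (pd 0 u) z v + pd 1 u z * fderiv ℝ (pd 1 u) z v|
          ≤ gn u z * (M * ‖v‖) := by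
        refine (abs_add_le _ _).trans ?_
        rw [abs_mul, abs_mul, hM]
        calc _ ≤ gn u z * (|M0| * ‖v‖) + gn u z * (|M1| * ‖v‖) := by gcongr
          _ = _ := by ring
      calc _ ≤ gn u z * (M * ‖v‖) * gn u z := by gcongr
        _ = _ := by ring
    calc _ ≤ Real.sinh (ang u z) / Real.cosh (ang u z) * (2 * ‖v‖ / kap z + M * ‖v‖ / gn u z) := by
          gcongr; exact (abs_add_le _ _).trans (add_le_add a1 a2)
      _ ≤ Real.sinh (ang u z) / Real.cosh (ang u z)
          * (2 * (kap z / 2 * Real.cosh (ang u z)) / kap z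
            + M * (kap z / 2 * Real.cosh (ang u z)) / gn u z) := by gcongr
      _ = _ := by field_simp
  have dX := der _ (norm_vX_le h hz).1
  have dY := der _ (norm_vX_le h hz).2
  set L := 1 + kap z * M / (2 * gn u z) with hL
  have hL0 : 0 < L := by positivity
  have hE : IsFrame.energy (dirc u) (dird u) (ang u) z ≤ 2 * (Real.sinh (ang u z) * L) ^ 2 := by
    unfold IsFrame.energy vd
    have e1 := sq_le_sq' (abs_le.1 dX).1 (abs_le.1 dX).2
    have e2 := sq_le_sq' (abs_le.1 dY).1 (abs_le.1 dY).2
    linarith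
  have hχ : cutoff q R z ^ 2 ≤ 1 := by
    have h1 := cutoff_le_one q z hR hR1
    have h2 : 0 ≤ cutoff q R z := by
      rw [cutoff_eq, sub_nonneg]; exact pow_le_pow_left₀ dist_nonneg hzb 2
    nlinarith
  have hexp : L * Real.exp (-ang u z) ≤ 1 + M := by
    have e1 : Real.exp (-ang u z) ≤ kap z * gn u z / 2 := by
      rw [Real.exp_neg, inv_le_comm₀ (Real.exp_pos _) (by positivity)]
      refine le_trans (le_of_eq ?_) (sinh_le_exp _)
      rw [sinh_ang, inv_div]
    have e2 : Real.exp (-ang u z) ≤ 1 := Real.exp_le_one_iff.2 (by linarith [h.pos z hz])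
    have e3 : kap z * M / (2 * gn u z) * Real.exp (-ang u z) ≤ M := by
      calc _ ≤ kap z * M / (2 * gn u z) * (kap z * gn u z / 2) := by gcongr
        _ = kap z ^ 2 * M / 4 := by field_simp; ring
        _ ≤ 1 ^ 2 * M / 1 := by gcongr; norm_num
        _ = M := by ring
    rw [hL]; linarith
  unfold IsFrame.gauge
  have he2 : Real.exp (-(2 + 0) * ang u z) = Real.exp (-ang u z) ^ 2 := by
    rw [← Real.exp_nat_mul]; congr 1; push_cast; ring
  rw [he2, div_le_iff₀ (by positivity)]
  have hE0 : 0 ≤ IsFrame.energy (dirc u) (dird u) (ang u) z := by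
    unfold IsFrame.energy; positivity
  calc _ ≤ 1 * (2 * (Real.sinh (ang u z) * L) ^ 2) * Real.exp (-ang u z) ^ 2 := by gcongr
    _ = 2 * (L * Real.exp (-ang u z)) ^ 2 * Real.sinh (ang u z) ^ 2 := by ring
    _ ≤ _ := by gcongr

/-- Interior estimate for the derivative of the angle function, independent of the graph. -/
lemma fderiv_ang_le (hΩ : IsOpen Ω) (hΩD : Ω ⊆ Disk) (hu : ContDiffOn ℝ ∞ u Ω)
    (hm : ∀ p ∈ Ω, mgOp u p = 0) {R : ℝ} (hR : 0 < R) (hR1 : R ≤ 1)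
    (hq : Metric.closedBall p R ⊆ Ω) (hp : p ∈ noncrit Ω u) (v : E2) :
    |fderiv ℝ (ang u) p v| * Real.exp (-ang u p) ≤ 8 / (kap p * R ^ 2) * ‖v‖ := by
  have h := isFrame hΩ hΩD hu hm
  obtain ⟨K, hK⟩ := gauge_bounded hΩ hΩD hu hm hR hR1 hq
  have main := h.gauge_le hR hR1 (isCompact_ang_le hΩ hΩD hu hq) hK hp (Metric.mem_ball_self hR)
  unfold IsFrame.gauge IsFrame.energy at main
  have hk := kap_pos (hΩD hp.1)
  have hC := Real.cosh_pos (ang u p)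
  have hcs := Real.cosh_sq (ang u p)
  have hS : 0 < Real.sinh (ang u p) := Real.sinh_pos_iff.2 (h.pos p hp)
  have hun := h.unit p hp
  have he2 : Real.exp (-(2 + 0) * ang u p) = Real.exp (-ang u p) ^ 2 := by
    rw [← Real.exp_nat_mul]; congr 1; push_cast; ring
  rw [he2, cutoff_eq, dist_self, div_le_iff₀ (by positivity)] at main
  simp only [vd] at main
  rw [fderiv_eq_pd (ang u) p (vX _ _ _ p), fderiv_eq_pd (ang u) p (vY _ _ _ p)] at main
  rw [fderiv_eq_pd]
  have x0 : vX (dirc u) (dird u) (ang u) p 0 = kap p / 2 * Real.sinh (ang u p) * dirc u p := rfl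
  have x1 : vX (dirc u) (dird u) (ang u) p 1 = kap p / 2 * Real.sinh (ang u p) * dird u p := rfl
  have y0 : vY (dirc u) (dird u) (ang u) p 0 = -(kap p / 2 * Real.cosh (ang u p) * dird u p) := rfl
  have y1 : vY (dirc u) (dird u) (ang u) p 1 = kap p / 2 * Real.cosh (ang u p) * dirc u p := rfl
  rw [x0, x1, y0, y1] at main
  have hv := E2.norm_sq v
  have hE := Real.exp_pos (-ang u p)
  apply le_of_sq_le_sq _ (by positivity)
  rw [mul_pow, sq_abs, mul_pow, hv]
  generalize kap p = κ at *
  generalize Real.sinh (ang u p) = S at *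
  generalize Real.cosh (ang u p) = C at *
  generalize dirc u p = c at *
  generalize dird u p = d at *
  generalize pd 0 (ang u) p = a at *
  generalize pd 1 (ang u) p = b at *
  generalize Real.exp (-ang u p) = E at *
  generalize v 0 = x at *
  generalize v 1 = y at *
  have m1 : (κ / 2) ^ 2 * (a ^ 2 + b ^ 2) * E ^ 2 * R ^ 4 ≤ 12 := by
    have e1 : (κ / 2 * S * c * a + κ / 2 * S * d * b) ^ 2
        + (-(κ / 2 * C * d) * a + κ / 2 * C * c * b) ^ 2
        = (κ / 2) ^ 2 * (S ^ 2 * ((a ^ 2 + b ^ 2) * (c ^ 2 + d ^ 2)) + (c * b - d * a) ^ 2) := by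
      linear_combination (κ / 2) ^ 2 * (c * b - d * a) ^ 2 * hcs
    rw [e1, hun] at main
    have e2 : ((κ / 2) ^ 2 * (a ^ 2 + b ^ 2) * E ^ 2 * R ^ 4) * S ^ 2 ≤ 12 * S ^ 2 := by
      refine le_trans ?_ main
      have : 0 ≤ (κ / 2) ^ 2 * (c * b - d * a) ^ 2 * E ^ 2 * R ^ 4 := by positivity
      linarith
    exact le_of_mul_le_mul_right e2 (by positivity)
  have m2 : (x * a + y * b) ^ 2 ≤ (a ^ 2 + b ^ 2) * (x ^ 2 + y ^ 2) := by
    nlinarith [sq_nonneg (x * b - y * a)]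
  have m3 : (a ^ 2 + b ^ 2) * E ^ 2 ≤ (8 / (κ * R ^ 2)) ^ 2 := by
    rw [div_pow, le_div_iff₀ (by positivity)]
    linarith
  calc (x * a + y * b) ^ 2 * E ^ 2 ≤ (a ^ 2 + b ^ 2) * (x ^ 2 + y ^ 2) * E ^ 2 := by gcongr
    _ = (a ^ 2 + b ^ 2) * E ^ 2 * (x ^ 2 + y ^ 2) := by ring
    _ ≤ _ := by gcongr

end AngleEstimate

/-! ### Locally uniform bounds for the first two derivatives -/

/-- The quantity `2 √(1 + λ⁻² |∇u|²)`. -/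
def rr (u : E2 → ℝ) (p : E2) : ℝ :=
  Real.sqrt (4 + kap p ^ 2 * (pd 0 u p ^ 2 + pd 1 u p ^ 2))

section GradientEstimate

variable {Ω : Set E2} {u : E2 → ℝ} {p : E2}

lemma rr_sq (u : E2 → ℝ) (p : E2) : rr u p ^ 2 = 4 + kap p ^ 2 * gn u p ^ 2 := by
  rw [rr, Real.sq_sqrt (by positivity), gn_sq]

lemma rr_pos (u : E2 → ℝ) (p : E2) : 0 < rr u p := Real.sqrt_pos.2 (by positivity)

lemma hasD_rr (hΩ : IsOpen Ω) (hu : ContDiffOn ℝ ∞ u Ω) (hp : p ∈ Ω) (v : E2) :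
    HasD v (rr u) p ((kap p * (-2 * (p 0 * v 0 + p 1 * v 1)) * gn u p ^ 2
      + kap p ^ 2 * (pd 0 u p * fderiv ℝ (pd 0 u) p v + pd 1 u p * fderiv ℝ (pd 1 u) p v))
        / rr u p) := by
  have h0 := hasD_vd (V := fun _ => v) hΩ (smooth_pd hΩ hu 0) hp
  have h1 := hasD_vd (V := fun _ => v) hΩ (smooth_pd hΩ hu 1) hp
  have hne : 4 + kap p ^ 2 * (pd 0 u p ^ 2 + pd 1 u p ^ 2) ≠ 0 := by positivity
  have := HasD.comp (Real.hasDerivAt_sqrt hne)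
    ((HasD.const v p 4).add ((hasD_kap v p).sq.mul (h0.sq.add h1.sq)))
  change HasD v (rr u) p _ at this
  convert this using 1
  have hr := (rr_pos u p).ne'
  rw [gn_sq]
  change _ = 1 / (2 * rr u p) * _
  simp only [vd]
  field_simp
  ring

lemma kap_mul_gn_le (hp : p ∈ Disk) : kap p * gn u p ≤ rr u p := by
  have hk := kap_pos hp
  apply le_of_sq_le_sq _ (rr_pos u p).le
  rw [rr_sq, mul_pow]; linarith

lemma exp_neg_ang (hk : 0 < kap p) (hg : 0 < gn u p) :
    Real.exp (-ang u p) = kap p * gn u p / (rr u p + 2) := by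
  have hr := rr_pos u p
  have hr2 := rr_sq u p
  have hC : Real.cosh (ang u p) = rr u p / (kap p * gn u p) := by
    have h1 := Real.cosh_sq (ang u p)
    have h2 := Real.cosh_pos (ang u p)
    refine (sq_eq_sq₀ h2.le (by positivity)).1 ?_
    rw [h1, sinh_ang, div_pow, div_pow, hr2]
    field_simp
    ring
  rw [← Real.cosh_sub_sinh, hC, sinh_ang]
  field_simp
  linear_combination hr2

/-- At a noncritical point the logarithmic derivative of `kap * gn` is controlled by that of the
angle. -/
lemma fderiv_ang_eq (hΩ : IsOpen Ω) (hΩD : Ω ⊆ Disk) (hu : ContDiffOn ℝ ∞ u Ω)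
    (hp : p ∈ noncrit Ω u) (v : E2) :
    rr u p * fderiv ℝ (ang u) p v * (kap p * gn u p ^ 2)
      = -2 * (-2 * (p 0 * v 0 + p 1 * v 1) * gn u p ^ 2
        + kap p * (pd 0 u p * fderiv ℝ (pd 0 u) p v + pd 1 u p * fderiv ℝ (pd 1 u) p v)) := by
  have hk := kap_pos (hΩD hp.1)
  have hg : 0 < gn u p := hp.2
  have hr := rr_pos u p
  have hS : Real.sinh (ang u p) / Real.cosh (ang u p) = 2 / rr u p := by
    have e := exp_neg_ang hk hg
    rw [← Real.cosh_sub_sinh] at e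
    have hr2 := rr_sq u p
    have hC : Real.cosh (ang u p) = rr u p / (kap p * gn u p) := by
      have : Real.cosh (ang u p) = kap p * gn u p / (rr u p + 2) + Real.sinh (ang u p) := by
        linarith
      rw [this, sinh_ang]
      field_simp
      linear_combination -hr2
    rw [hC, sinh_ang]
    field_simp
  rw [(hasD_ang hΩ hΩD hu hp v).2, hS]
  field_simp

lemma fderiv_rr_le (hΩ : IsOpen Ω) (hΩD : Ω ⊆ Disk) (hu : ContDiffOn ℝ ∞ u Ω)
    (hm : ∀ p ∈ Ω, mgOp u p = 0) {R : ℝ} (hR : 0 < R) (hR1 : R ≤ 1)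
    (hq : Metric.closedBall p R ⊆ Ω) (v : E2) :
    |fderiv ℝ (rr u) p v| ≤ 4 / (kap p * R ^ 2) * ‖v‖ * (rr u p + 2) ^ 2 := by
  have hpΩ : p ∈ Ω := hq (Metric.mem_closedBall_self hR.le)
  have hk := kap_pos (hΩD hpΩ)
  have hr := rr_pos u p
  rcases (gn_nonneg u p).eq_or_lt with hg | hg
  · have h0 := gn_sq u p
    rw [← hg] at h0
    have a0 : pd 0 u p = 0 := by nlinarith [sq_nonneg (pd 0 u p), sq_nonneg (pd 1 u p)]
    have a1 : pd 1 u p = 0 := by nlinarith [sq_nonneg (pd 0 u p), sq_nonneg (pd 1 u p)]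
    rw [(hasD_rr hΩ hu hpΩ v).2, a0, a1, ← hg]
    norm_num
    positivity
  · have hp : p ∈ noncrit Ω u := ⟨hpΩ, hg⟩
    have main := fderiv_ang_le hΩ hΩD hu hm hR hR1 hq hp v
    have he := exp_neg_ang hk hg
    have hs1 := kap_mul_gn_le (u := u) (hΩD hpΩ)
    rw [he] at main
    have e1 : fderiv ℝ (rr u) p v = -(kap p * gn u p) ^ 2 / 2 * fderiv ℝ (ang u) p v := by
      have := fderiv_ang_eq hΩ hΩD hu hp v
      rw [(hasD_rr hΩ hu hpΩ v).2, div_eq_iff hr.ne']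
      linear_combination kap p / 2 * this
    rw [e1, abs_mul, neg_div, abs_neg, abs_of_pos (by positivity)]
    have m1 : |fderiv ℝ (ang u) p v| * (kap p * gn u p)
        ≤ 8 / (kap p * R ^ 2) * ‖v‖ * (rr u p + 2) := by
      rwa [mul_div_assoc', div_le_iff₀ (by positivity)] at main
    calc (kap p * gn u p) ^ 2 / 2 * |fderiv ℝ (ang u) p v|
        = |fderiv ℝ (ang u) p v| * (kap p * gn u p) * ((kap p * gn u p) / 2) := by ring
      _ ≤ 8 / (kap p * R ^ 2) * ‖v‖ * (rr u p + 2) * ((rr u p + 2) / 2) := by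
          gcongr; linarith
      _ = _ := by ring

lemma abs_grad_hess_le (hΩ : IsOpen Ω) (hΩD : Ω ⊆ Disk) (hu : ContDiffOn ℝ ∞ u Ω)
    (hm : ∀ p ∈ Ω, mgOp u p = 0) {R : ℝ} (hR : 0 < R) (hR1 : R ≤ 1)
    (hq : Metric.closedBall p R ⊆ Ω) (hp : p ∈ noncrit Ω u) (v : E2) :
    |pd 0 u p * fderiv ℝ (pd 0 u) p v + pd 1 u p * fderiv ℝ (pd 1 u) p v|
      ≤ gn u p * ((8 / (kap p * R ^ 2) * (rr u p + 2) * rr u p + 4 * gn u p) / kap p * ‖v‖) := by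
  have hk := kap_pos (hΩD hp.1)
  have hg : 0 < gn u p := hp.2
  have hr := rr_pos u p
  have main := fderiv_ang_le hΩ hΩD hu hm hR hR1 hq hp v
  rw [exp_neg_ang hk hg, mul_div_assoc', div_le_iff₀ (by positivity)] at main
  have hz : |p 0 * v 0 + p 1 * v 1| ≤ ‖v‖ := by
    have := abs_inner_le_norm p v
    have := norm_le_of_disk (hΩD hp.1)
    nlinarith [norm_nonneg v]
  have e := fderiv_ang_eq hΩ hΩD hu hp v
  set T := pd 0 u p * fderiv ℝ (pd 0 u) p v + pd 1 u p * fderiv ℝ (pd 1 u) p v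
  have e1 : kap p * T = -(rr u p / 2 * gn u p * (fderiv ℝ (ang u) p v * (kap p * gn u p)))
      + 2 * gn u p ^ 2 * (p 0 * v 0 + p 1 * v 1) := by
    linear_combination 1 / 2 * e
  have e2 : kap p * |T| ≤ rr u p / 2 * gn u p * (8 / (kap p * R ^ 2) * ‖v‖ * (rr u p + 2))
      + 2 * gn u p ^ 2 * ‖v‖ := by
    rw [← abs_of_pos hk, ← abs_mul, abs_of_pos hk, e1]
    refine (abs_add_le _ _).trans ?_
    rw [abs_neg, abs_mul, abs_mul (2 * gn u p ^ 2), abs_mul (fderiv ℝ (ang u) p v),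
      abs_of_pos (by positivity : 0 < rr u p / 2 * gn u p),
      abs_of_pos (by positivity : 0 < kap p * gn u p),
      abs_of_pos (by positivity : 0 < 2 * gn u p ^ 2)]
    gcongr
  have e3 : gn u p * ((8 / (kap p * R ^ 2) * (rr u p + 2) * rr u p + 4 * gn u p) / kap p * ‖v‖)
      = gn u p * ((8 / (kap p * R ^ 2) * (rr u p + 2) * rr u p + 4 * gn u p) * ‖v‖) / kap p := by
    ring
  rw [e3, le_div_iff₀ hk, mul_comm]
  refine e2.trans ?_
  have : 0 ≤ gn u p * (8 / (kap p * R ^ 2) * (rr u p + 2) * rr u p) * ‖v‖ := by positivity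
  have : 0 ≤ gn u p ^ 2 * ‖v‖ := by positivity
  linarith

end GradientEstimate

lemma hessian_bound {ux uy a b c g s κ x y M : ℝ} (hg : 0 < g) (hg2 : g ^ 2 = ux ^ 2 + uy ^ 2)
    (hs : 0 ≤ s) (hs1 : s ≤ 1) (hκ : 0 ≤ κ) (hκ1 : κ ≤ 1) (hx : |x| ≤ 1) (hy : |y| ≤ 1)
    (h0 : |ux * a + uy * b| ≤ g * M) (h1 : |ux * b + uy * c| ≤ g * M)
    (hpde : (1 + s * (ux ^ 2 + uy ^ 2)) * (a + c)
      - s * (ux ^ 2 * a + 2 * ux * uy * b + uy ^ 2 * c)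
      + κ / 2 * (ux ^ 2 + uy ^ 2) * (x * ux + y * uy) = 0) :
    |a| ≤ 2 * M + (2 * g ^ 2 * M + g ^ 3) ∧ |b| ≤ 2 * M + (2 * g ^ 2 * M + g ^ 3) ∧
      |c| ≤ 2 * M + (2 * g ^ 2 * M + g ^ 3) := by
  have cx : |ux| ≤ g := abs_le_of_sq_le_sq (by rw [hg2]; nlinarith [sq_nonneg uy]) hg.le
  have cy : |uy| ≤ g := abs_le_of_sq_le_sq (by rw [hg2]; nlinarith [sq_nonneg ux]) hg.le
  have hM : 0 ≤ M := by
    have := (abs_nonneg _).trans h0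
    exact nonneg_of_mul_nonneg_right this hg
  set T0 := ux * a + uy * b with hT0
  set T1 := ux * b + uy * c with hT1
  have p1 : |ux * T0| ≤ g * (g * M) := by rw [abs_mul]; gcongr
  have p2 : |uy * T1| ≤ g * (g * M) := by rw [abs_mul]; gcongr
  have p3 : |uy * T0| ≤ g * (g * M) := by rw [abs_mul]; gcongr
  have p4 : |ux * T1| ≤ g * (g * M) := by rw [abs_mul]; gcongr
  have p5 : |x * ux| ≤ 1 * g := by rw [abs_mul]; gcongr
  have p6 : |y * uy| ≤ 1 * g := by rw [abs_mul]; gcongr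
  have hτ : |a + c| ≤ 2 * g ^ 2 * M + g ^ 3 := by
    have e : (1 + s * g ^ 2) * (a + c)
        = s * (ux * T0 + uy * T1) - κ / 2 * g ^ 2 * (x * ux + y * uy) := by
      rw [hT0, hT1, hg2]; linear_combination hpde
    have e2 : (1 + s * g ^ 2) * |a + c| ≤ 2 * g ^ 2 * M + g ^ 3 := by
      rw [← abs_of_pos (by positivity : 0 < 1 + s * g ^ 2), ← abs_mul, e]
      refine (abs_sub _ _).trans ?_
      rw [abs_mul, abs_mul (κ / 2 * g ^ 2), abs_of_nonneg hs,
        abs_of_nonneg (by positivity : 0 ≤ κ / 2 * g ^ 2)]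
      calc _ ≤ 1 * (g * (g * M) + g * (g * M)) + 1 / 2 * g ^ 2 * (1 * g + 1 * g) := by
            gcongr
            · exact (abs_add_le _ _).trans (add_le_add p1 p2)
            · exact (abs_add_le _ _).trans (add_le_add p5 p6)
        _ = _ := by ring
    have : 0 ≤ s * g ^ 2 * |a + c| := by positivity
    linarith
  set N := 2 * g ^ 2 * M + g ^ 3 with hN
  have hN0 : 0 ≤ N := by positivity
  have q1 : |uy ^ 2 * (a + c)| ≤ g ^ 2 * N := by
    rw [abs_mul, abs_of_nonneg (sq_nonneg _)]
    have : uy ^ 2 ≤ g ^ 2 := by rw [hg2]; linarith [sq_nonneg ux]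
    exact mul_le_mul this hτ (abs_nonneg _) (by positivity)
  have q2 : |ux ^ 2 * (a + c)| ≤ g ^ 2 * N := by
    rw [abs_mul, abs_of_nonneg (sq_nonneg _)]
    have : ux ^ 2 ≤ g ^ 2 := by rw [hg2]; linarith [sq_nonneg uy]
    exact mul_le_mul this hτ (abs_nonneg _) (by positivity)
  have q3 : |ux * uy * (a + c)| ≤ g * g * N := by
    rw [abs_mul, abs_mul]
    gcongr
  have key : ∀ t : ℝ, |g ^ 2 * t| ≤ g ^ 2 * (2 * M + N) → |t| ≤ 2 * M + N := by
    intro t ht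
    rw [abs_mul, abs_of_pos (by positivity : 0 < g ^ 2)] at ht
    exact le_of_mul_le_mul_left ht (by positivity)
  rw [abs_le] at p1 p2 p3 p4 q1 q2 q3
  refine ⟨key _ ?_, key _ ?_, key _ ?_⟩
  · have e : g ^ 2 * a = ux * T0 - uy * T1 + uy ^ 2 * (a + c) := by
      rw [hT0, hT1, hg2]; ring
    rw [e, abs_le]; constructor <;> linarith
  · have e : g ^ 2 * b = uy * T0 + ux * T1 - ux * uy * (a + c) := by
      rw [hT0, hT1, hg2]; ring
    rw [e, abs_le]; constructor <;> linarith
  · have e : g ^ 2 * c = uy * T1 - ux * T0 + ux ^ 2 * (a + c) := by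
      rw [hT0, hT1, hg2]; ring
    rw [e, abs_le]; constructor <;> linarith

/-- Locally uniform boundedness of a family of functions. -/
def LB {ι : Type*} (Ω : Set E2) (f : ι → E2 → ℝ) : Prop :=
  ∀ x ∈ Ω, ∃ C, ∀ᶠ y in 𝓝 x, ∀ k, |f k y| ≤ C

namespace LB

variable {ι : Type*} {Ω : Set E2} {f g : ι → E2 → ℝ}

lemma of_continuousOn (hΩ : IsOpen Ω) {f : E2 → ℝ} (hf : ContinuousOn f Ω) :
    LB Ω (fun _ : ι => f) := by
  intro x hx
  refine ⟨|f x| + 1, ?_⟩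
  have hc : ContinuousAt (fun y => |f y|) x := (hf.continuousAt (hΩ.mem_nhds hx)).abs
  filter_upwards [hc.eventually (gt_mem_nhds (lt_add_one _))] with y hy _ using hy.le

lemma mono_abs (hg : LB Ω g) (h : ∀ k, ∀ x ∈ Ω, |f k x| ≤ |g k x|) (hΩ : IsOpen Ω) : LB Ω f := by
  intro x hx
  obtain ⟨C, hC⟩ := hg x hx
  refine ⟨C, ?_⟩
  filter_upwards [hC, hΩ.mem_nhds hx] with y hy hyΩ k using (h k y hyΩ).trans (hy k)

lemma mul (hf : LB Ω f) (hg : LB Ω g) : LB Ω (fun k x => f k x * g k x) := by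
  intro x hx
  obtain ⟨C, hC⟩ := hf x hx
  obtain ⟨D, hD⟩ := hg x hx
  refine ⟨C * D, ?_⟩
  filter_upwards [hC, hD] with y h1 h2 k
  rw [abs_mul]
  exact mul_le_mul (h1 k) (h2 k) (abs_nonneg _) ((abs_nonneg _).trans (h1 k))

end LB

section LocalBounds

variable {ι : Type*} {Ω : Set E2} {u : ι → E2 → ℝ}

lemma exists_good_radius (hΩ : IsOpen Ω) (hΩD : Ω ⊆ Disk) {x : E2} (hx : x ∈ Ω) :
    ∃ R, 0 < R ∧ R ≤ 1 ∧ ∃ κ, 0 < κ ∧ ∀ y ∈ Metric.ball x R,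
      Metric.closedBall y R ⊆ Ω ∧ κ ≤ kap y := by
  obtain ⟨ε, hε, hball⟩ := Metric.isOpen_iff.1 hΩ x hx
  have hk := kap_pos (hΩD hx)
  obtain ⟨δ, hδ, hkap⟩ := Metric.eventually_nhds_iff_ball.1
    ((contDiff_kap.continuous.tendsto x).eventually (lt_mem_nhds (half_lt_self hk)))
  refine ⟨min 1 (min δ (ε / 2)), by positivity, min_le_left _ _, kap x / 2, by positivity,
    fun y hy => ⟨fun z hz => hball ?_, (hkap y ?_).le⟩⟩
  · rw [Metric.mem_ball] at hy ⊢
    rw [Metric.mem_closedBall] at hz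
    have h1 : min 1 (min δ (ε / 2)) ≤ ε / 2 := (min_le_right _ _).trans (min_le_right _ _)
    linarith [dist_triangle z y x]
  · exact Metric.ball_subset_ball ((min_le_right _ _).trans (min_le_left _ _)) hy

lemma LB_rr (hΩ : IsOpen Ω) (hΩD : Ω ⊆ Disk) (hu : ∀ k, ContDiffOn ℝ ∞ (u k) Ω)
    (hm : ∀ k, ∀ p ∈ Ω, mgOp (u k) p = 0) (hB : ∀ p ∈ Ω, ∃ C, ∀ k, gn (u k) p ≤ C) :
    LB Ω (fun k => rr (u k)) := by
  intro x hx
  obtain ⟨R, hR, hR1, κ, hκ, hgood⟩ := exists_good_radius hΩ hΩD hx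
  obtain ⟨C, hC⟩ := hB x hx
  set L := 4 / (κ * R ^ 2) with hL
  have hLpos : 0 < L := by positivity
  have lip : ∀ k, ∀ y ∈ Metric.ball x R,
      |(rr (u k) y + 2)⁻¹ - (rr (u k) x + 2)⁻¹| ≤ L * dist y x := by
    intro k y hy
    have hd : ∀ z ∈ Metric.ball x R, DifferentiableAt ℝ (fun z => (rr (u k) z + 2)⁻¹) z := by
      intro z hz
      have hzΩ := (hgood z hz).1 (Metric.mem_closedBall_self hR.le)
      have hr := rr_pos (u k) z
      exact (((hasD_rr hΩ (hu k) hzΩ 0).add (HasD.const _ z 2)).inv (by positivity)).1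
    have hb : ∀ z ∈ Metric.ball x R, ‖fderiv ℝ (fun z => (rr (u k) z + 2)⁻¹) z‖ ≤ L := by
      intro z hz
      refine ContinuousLinearMap.opNorm_le_bound _ hLpos.le fun v => ?_
      have hzΩ := (hgood z hz).1 (Metric.mem_closedBall_self hR.le)
      have hr := rr_pos (u k) z
      have h1 : HasD v (rr (u k)) z (fderiv ℝ (rr (u k)) z v) :=
        ⟨(hasD_rr hΩ (hu k) hzΩ v).1, rfl⟩
      rw [((h1.add (HasD.const v z 2)).inv (by positivity)).2, Real.norm_eq_abs, add_zero, abs_div,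
        abs_neg, abs_of_pos (by positivity : 0 < (rr (u k) z + 2) ^ 2), div_le_iff₀ (by positivity)]
      refine (fderiv_rr_le hΩ hΩD (hu k) (hm k) hR hR1 (hgood z hz).1 v).trans ?_
      rw [hL]
      gcongr
      exact (hgood z hz).2
    have := (convex_ball x R).norm_image_sub_le_of_norm_fderiv_le hd hb
      (Metric.mem_ball_self hR) hy
    rwa [← dist_eq_norm y x, Real.norm_eq_abs] at this
  obtain ⟨C0, hC0, hrC⟩ : ∃ C0, 0 < C0 ∧ ∀ k, rr (u k) x ≤ C0 := by
    refine ⟨Real.sqrt (4 + C ^ 2), by positivity, fun k => ?_⟩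
    apply Real.le_sqrt_of_sq_le
    rw [rr_sq]
    have h1 := kap_pos (hΩD hx)
    have h2 := kap_le_one x
    have h3 : kap x * gn (u k) x ≤ C := by
      have := gn_nonneg (u k) x
      calc _ ≤ 1 * gn (u k) x := by gcongr
        _ ≤ C := by rw [one_mul]; exact hC k
    rw [← mul_pow]
    have : 0 ≤ kap x * gn (u k) x := mul_nonneg h1.le (gn_nonneg _ _)
    gcongr
  set δ := (C0 + 2)⁻¹ with hδ
  have hδpos : 0 < δ := by positivity
  refine ⟨2 / δ, ?_⟩
  have hρ : 0 < min R (δ / (2 * L)) := by positivity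
  filter_upwards [Metric.ball_mem_nhds x hρ] with y hy k
  have hyR : y ∈ Metric.ball x R := Metric.ball_subset_ball (min_le_left _ _) hy
  have hyd : dist y x ≤ δ / (2 * L) := (Metric.mem_ball.1 hy).le.trans (min_le_right _ _)
  have h1 := lip k y hyR
  have h2 : L * dist y x ≤ δ / 2 := by
    calc _ ≤ L * (δ / (2 * L)) := by gcongr
      _ = _ := by field_simp
  have h3 : δ ≤ (rr (u k) x + 2)⁻¹ := by
    have := rr_pos (u k) x
    rw [hδ]; gcongr; exact hrC k
  have h4 : δ / 2 ≤ (rr (u k) y + 2)⁻¹ := by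
    have := (abs_le.1 h1).1
    linarith
  have hr := rr_pos (u k) y
  rw [abs_of_pos hr]
  have h5 : rr (u k) y + 2 ≤ (δ / 2)⁻¹ := by
    rw [le_inv_comm₀ (by positivity) (by positivity)]; exact h4
  rw [inv_div] at h5
  linarith

lemma LB_gn (hΩ : IsOpen Ω) (hΩD : Ω ⊆ Disk) (h : LB Ω (fun k => rr (u k))) :
    LB Ω (fun k => gn (u k)) := by
  have hk : LB Ω (fun _ : ι => fun x => (kap x)⁻¹) := LB.of_continuousOn hΩ
    (contDiff_kap.continuous.continuousOn.inv₀ fun x hx => (kap_pos (hΩD hx)).ne')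
  refine (hk.mul h).mono_abs (fun k x hx => ?_) hΩ
  have h1 := kap_pos (hΩD hx)
  have h2 := rr_pos (u k) x
  rw [abs_of_nonneg (gn_nonneg _ _), abs_of_pos (by positivity), ← div_eq_inv_mul,
    le_div_iff₀ h1, mul_comm]
  exact kap_mul_gn_le (hΩD hx)

lemma LB_pd (hΩ : IsOpen Ω) (h : LB Ω (fun k => gn (u k))) (i : Fin 2) :
    LB Ω (fun k => pd i (u k)) := by
  refine h.mono_abs (fun k x hx => ?_) hΩ
  apply sq_le_sq.1
  rw [gn_sq]
  fin_cases i
  · simp only [Fin.zero_eta]; nlinarith [sq_nonneg (pd 1 (u k) x)]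
  · simp only [Fin.mk_one]; nlinarith [sq_nonneg (pd 0 (u k) x)]

lemma LB_pd_pd (hΩ : IsOpen Ω) (hΩD : Ω ⊆ Disk) (hu : ∀ k, ContDiffOn ℝ ∞ (u k) Ω)
    (hm : ∀ k, ∀ p ∈ Ω, mgOp (u k) p = 0) (hr : LB Ω (fun k => rr (u k))) (i j : Fin 2) :
    LB Ω (fun k => pd i (pd j (u k))) := by
  intro x hx
  obtain ⟨R, hR, hR1, κ, hκ, hgood⟩ := exists_good_radius hΩ hΩD hx
  obtain ⟨C, hC⟩ := hr x hx
  obtain ⟨G, hG⟩ := LB_gn hΩ hΩD hr x hx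
  set M := (8 / (κ * R ^ 2) * (|C| + 2) * |C| + 4 * |G|) / κ with hM
  have hM0 : 0 ≤ M := by positivity
  set B := 2 * M + (2 * |G| ^ 2 * M + |G| ^ 3) with hB
  refine ⟨B, ?_⟩
  have crit : ∀ k, ∀ y ∈ Metric.ball x R, |rr (u k) y| ≤ C → |gn (u k) y| ≤ G → 0 < gn (u k) y →
      |pd i (pd j (u k)) y| ≤ B := by
    intro k y hy hyC hyG hg
    obtain ⟨hsub, hκy⟩ := hgood y hy
    have hyΩ := hsub (Metric.mem_closedBall_self hR.le)
    have hk := kap_pos (hΩD hyΩ)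
    have hr := rr_pos (u k) y
    have hrC : rr (u k) y ≤ |C| := (le_abs_self _).trans (hyC.trans (le_abs_self _))
    have hgG : gn (u k) y ≤ |G| := (le_abs_self _).trans (hyG.trans (le_abs_self _))
    have T : ∀ l : Fin 2, |pd 0 (u k) y * pd l (pd 0 (u k)) y + pd 1 (u k) y * pd l (pd 1 (u k)) y|
        ≤ gn (u k) y * M := by
      intro l
      refine (abs_grad_hess_le hΩ hΩD (hu k) (hm k) hR hR1 hsub ⟨hyΩ, hg⟩
        (EuclideanSpace.single l 1)).trans ?_
      have h1 : ‖(EuclideanSpace.single l 1 : E2)‖ = 1 := by simp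
      rw [hM, h1, mul_one]
      gcongr
    have T0 := T 0
    have T1 := T 1
    rw [pd_comm hΩ (hu k) hyΩ 0 1] at T0
    have coordle : ∀ l : Fin 2, |y l| ≤ 1 := fun l =>
      (PiLp.norm_apply_le y l).trans (norm_le_of_disk (hΩD hyΩ))
    have hk1 := kap_le_one y
    have hpde := hm k y hyΩ
    unfold mgOp at hpde
    rw [pd_comm hΩ (hu k) hyΩ 0 1] at hpde
    have main := hessian_bound (s := (kap y / 2) ^ 2) hg (gn_sq (u k) y) (by positivity)
      (by nlinarith) hk.le hk1 (coordle 0) (coordle 1) T0 T1 (by linear_combination hpde)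
    have hBB : 2 * M + (2 * gn (u k) y ^ 2 * M + gn (u k) y ^ 3) ≤ B := by
      rw [hB]; gcongr
    fin_cases i <;> fin_cases j
    · exact main.1.trans hBB
    · simp only [Fin.zero_eta, Fin.mk_one]
      rw [pd_comm hΩ (hu k) hyΩ 0 1]
      exact main.2.1.trans hBB
    · exact main.2.1.trans hBB
    · exact main.2.2.trans hBB
  have hB0 : 0 ≤ B := by positivity
  filter_upwards [hC.eventually_nhds, hG.eventually_nhds, Metric.ball_mem_nhds x hR]
    with y hyC hyG hyR k
  by_contra! hlt
  have hyΩ := (hgood y hyR).1 (Metric.mem_closedBall_self hR.le)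
  have hcont : ContinuousAt (fun z => |pd i (pd j (u k)) z|) y :=
    ((smooth_pd hΩ (smooth_pd hΩ (hu k) j) i).continuousOn.continuousAt (hΩ.mem_nhds hyΩ)).abs
  have hev : ∀ᶠ z in 𝓝 y, pd j (u k) z = 0 := by
    filter_upwards [hcont.eventually (lt_mem_nhds hlt), hyC, hyG,
      Metric.isOpen_ball.mem_nhds hyR] with z hz hzC hzG hzR
    rcases (gn_nonneg (u k) z).eq_or_lt with hg | hg
    · have h0 := gn_sq (u k) z
      rw [← hg] at h0
      fin_cases j
      · simp only [Fin.zero_eta]; nlinarith [sq_nonneg (pd 0 (u k) z), sq_nonneg (pd 1 (u k) z)]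
      · simp only [Fin.mk_one]; nlinarith [sq_nonneg (pd 0 (u k) z), sq_nonneg (pd 1 (u k) z)]
    · exact absurd (crit k z hzR (hzC k) (hzG k) hg) (not_le.2 hz)
  have : pd i (pd j (u k)) y = 0 :=
    ((HasD.const (EuclideanSpace.single i 1) y 0).congr_of_eventuallyEq hev).2
  rw [this, abs_zero] at hlt
  linarith

end LocalBounds

/-! ### Bernstein's estimate for bounded systems -/

/-- Pure algebra behind Bernstein's estimate at an interior maximum point. -/
lemma bernstein_algebra {χ G H K M A c t e : ℝ} {χ1 χ2 G1 G2 N1 N2 S T : Fin 3 → ℝ}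
    (hχ : 0 < χ) (hχ1 : χ ≤ 1) (hG : 0 < G) (hM : 0 ≤ M) (hK : 1 ≤ K)
    (hKA : 64 * (M * A) ≤ K) (hKH : K ≤ H) (hHM : H ≤ K + M) (hc : 0 ≤ c) (ht : 0 ≤ t)
    (he : 0 ≤ e) (hS : ∀ m, 0 ≤ S m)
    (crit : ∀ m, 2 * χ * χ1 m * (G * H) + χ ^ 2 * (G1 m * H + G * N1 m) = 0)
    (second : ∑ m, ((2 * χ1 m ^ 2 + 2 * χ * χ2 m) * (G * H)
      + 2 * (2 * χ * χ1 m) * (G1 m * H + G * N1 m)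
      + χ ^ 2 * (G2 m * H + 2 * G1 m * N1 m + G * N2 m)) ≤ 0)
    (hχs : ∑ m, χ1 m ^ 2 ≤ c) (hχL : -∑ m, χ2 m ≤ c)
    (hLG : 2 * ∑ m, S m - t * G - (1 + G ^ 2 + ∑ m, S m) / (8 * (K + M)) ≤ ∑ m, G2 m)
    (hLN : G - e ≤ ∑ m, N2 m)
    (hG1 : ∀ m, G1 m ^ 2 ≤ 4 * G * S m) (hN1 : ∀ m, N1 m ^ 2 ≤ 4 * M * T m)
    (hT : ∑ m, T m ≤ A * G) :
    χ ^ 2 * (G * H) ≤ (K + M) * (2 * ((K + M) * t + e + 8 * c * (K + M)) + 2) := by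
  have hH : 0 < H := by linarith
  have hGH : 0 < G * H := by positivity
  have hSs : 0 ≤ ∑ m, S m := Finset.sum_nonneg fun m _ => hS m
  -- combine the two maximum conditions
  have comb : χ ^ 2 * (H * ∑ m, G2 m + 2 * ∑ m, G1 m * N1 m + G * ∑ m, N2 m)
      ≤ 8 * c * (G * H) := by
    have e1 : ∀ m, 2 * (2 * χ * χ1 m) * (G1 m * H + G * N1 m) = -8 * χ1 m ^ 2 * (G * H) := by
      intro m
      have h := crit m
      have : χ * (χ * (G1 m * H + G * N1 m) + 2 * χ1 m * (G * H)) = 0 := by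
        linear_combination h
      have h' := (mul_eq_zero.1 this).resolve_left hχ.ne'
      linear_combination 4 * χ1 m * h'
    simp only [e1, Fin.sum_univ_three] at second
    simp only [Fin.sum_univ_three] at hχs hχL ⊢
    have s1 : 6 * (χ1 0 ^ 2 + χ1 1 ^ 2 + χ1 2 ^ 2) - 2 * χ * (χ2 0 + χ2 1 + χ2 2) ≤ 8 * c := by
      have : χ * -(χ2 0 + χ2 1 + χ2 2) ≤ 1 * c := by
        calc _ ≤ χ * c := by gcongr
          _ ≤ _ := by gcongr
      linarith
    have s2 := mul_le_mul_of_nonneg_right s1 hGH.le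
    linarith
  have cross : ∀ m, -(K * S m) - 16 * M / K * (G * T m) ≤ 2 * (G1 m * N1 m) := by
    intro m
    have a1 : 0 ≤ (K * G1 m + 4 * G * N1 m) ^ 2 := sq_nonneg _
    have a2 : 0 ≤ 4 * G * K := by positivity
    have a3 := mul_le_mul_of_nonneg_left (hG1 m) (by positivity : 0 ≤ K ^ 2)
    have a4 := mul_le_mul_of_nonneg_left (hN1 m) (by positivity : 0 ≤ 16 * G ^ 2)
    have a5 : 0 ≤ (4 * G * K) * (2 * (G1 m * N1 m) + K * S m + 16 * M / K * (G * T m)) := by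
      have e : (4 * G * K) * (16 * M / K * (G * T m)) = 64 * M * G ^ 2 * T m := by
        field_simp; ring
      rw [mul_add, e]
      linarith
    have := nonneg_of_mul_nonneg_right a5 (by positivity)
    linarith
  have crossS : -(K * ∑ m, S m) - G ^ 2 / 4 ≤ 2 * ∑ m, G1 m * N1 m := by
    have c0 := cross 0
    have c1 := cross 1
    have c2 := cross 2
    have b1 : 16 * M / K * (G * ∑ m, T m) ≤ G ^ 2 / 4 := by
      calc _ ≤ 16 * M / K * (G * (A * G)) := by gcongr
        _ = (64 * (M * A)) / K * (G ^ 2 / 4) := by ring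
        _ ≤ 1 * (G ^ 2 / 4) := by
          gcongr; exact (div_le_one (by linarith)).2 hKA
        _ = _ := by ring
    simp only [Fin.sum_univ_three] at b1 ⊢
    linarith
  have lower : G ^ 2 / 2 - ((K + M) * t + e) * G - 1 ≤
      H * ∑ m, G2 m + 2 * ∑ m, G1 m * N1 m + G * ∑ m, N2 m := by
    have b1 := mul_le_mul_of_nonneg_left hLG hH.le
    have b2 := mul_le_mul_of_nonneg_left hLN hG.le
    have b3 : H * ((1 + G ^ 2 + ∑ m, S m) / (8 * (K + M))) ≤ (1 + G ^ 2 + ∑ m, S m) / 8 := by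
      calc _ ≤ (K + M) * ((1 + G ^ 2 + ∑ m, S m) / (8 * (K + M))) := by gcongr
        _ = _ := by
          have : K + M ≠ 0 := by linarith
          field_simp
    have b4 : H * (t * G) ≤ (K + M) * (t * G) := by gcongr
    have b5 : K * ∑ m, S m ≤ H * ∑ m, S m := by gcongr
    have b6 : 1 * ∑ m, S m ≤ H * ∑ m, S m := by gcongr; linarith
    nlinarith [sq_nonneg G]
  have fin : χ ^ 2 * G ≤ 2 * ((K + M) * t + e + 8 * c * (K + M)) + 2 := by
    set D := (K + M) * t + e with hD
    have hKM : 0 ≤ K + M := by linarith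
    have hD0 : 0 ≤ D := by positivity
    have hχ2 : χ ^ 2 ≤ 1 := pow_le_one₀ hχ.le hχ1
    have b1 : χ ^ 2 * (G ^ 2 / 2 - D * G - 1) ≤ 8 * c * (G * (K + M)) := by
      refine (mul_le_mul_of_nonneg_left lower (by positivity)).trans (comb.trans ?_)
      gcongr
    set y := χ ^ 2 * G with hy
    have hy0 : 0 ≤ y := by positivity
    have b2 : y ^ 2 / 2 ≤ (D + 8 * c * (K + M)) * y + 1 := by
      have b3 := mul_le_mul_of_nonneg_left b1 (by positivity : 0 ≤ χ ^ 2)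
      have b4 : χ ^ 2 * (D * y) ≤ 1 * (D * y) := by gcongr
      have b5 : χ ^ 2 * χ ^ 2 ≤ 1 * 1 := by gcongr
      have e1 : y ^ 2 = χ ^ 2 * χ ^ 2 * G ^ 2 := by rw [hy]; ring
      rw [e1]
      have e2 : χ ^ 2 * (8 * c * (G * (K + M))) = 8 * c * (K + M) * y := by rw [hy]; ring
      have e3 : χ ^ 2 * (χ ^ 2 * (G ^ 2 / 2 - D * G - 1))
        = χ ^ 2 * χ ^ 2 * G ^ 2 / 2 - χ ^ 2 * (D * y) - χ ^ 2 * χ ^ 2 := by rw [hy]; ring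
      linarith
    have hE : 0 ≤ D + 8 * c * (K + M) := by positivity
    by_contra! hcon
    have h1 : 1 < y := by linarith
    have h2 : (2 * (D + 8 * c * (K + M)) + 2) * y < y * y := by gcongr
    nlinarith
  calc χ ^ 2 * (G * H) = (χ ^ 2 * G) * H := by ring
    _ ≤ (2 * ((K + M) * t + e + 8 * c * (K + M)) + 2) * (K + M) := by
      have : 0 ≤ χ ^ 2 * G := by positivity
      gcongr
    _ = _ := by ring

/-- `f1` and `f2` are the first two derivatives of `f` in the fixed direction `v`. -/
def Jet2 (N : Set E2) (v : E2) (f f1 f2 : E2 → ℝ) : Prop :=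
  ∀ x ∈ N, HasD v f x (f1 x) ∧ HasD v f1 x (f2 x)

namespace Jet2

variable {N : Set E2} {v : E2} {f f1 f2 g g1 g2 : E2 → ℝ}

lemma add (hf : Jet2 N v f f1 f2) (hg : Jet2 N v g g1 g2) :
    Jet2 N v (fun x => f x + g x) (fun x => f1 x + g1 x) (fun x => f2 x + g2 x) :=
  fun x hx => ⟨(hf x hx).1.add (hg x hx).1, (hf x hx).2.add (hg x hx).2⟩

lemma mul (hf : Jet2 N v f f1 f2) (hg : Jet2 N v g g1 g2) :
    Jet2 N v (fun x => f x * g x) (fun x => f1 x * g x + f x * g1 x)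
      (fun x => f2 x * g x + 2 * (f1 x * g1 x) + f x * g2 x) := by
  refine fun x hx => ⟨(hf x hx).1.mul (hg x hx).1, ?_⟩
  have := ((hf x hx).2.mul (hg x hx).1).add ((hf x hx).1.mul (hg x hx).2)
  convert this using 1
  ring

lemma sq (hf : Jet2 N v f f1 f2) :
    Jet2 N v (fun x => f x ^ 2) (fun x => 2 * f x * f1 x)
      (fun x => 2 * f1 x ^ 2 + 2 * f x * f2 x) := by
  refine fun x hx => ⟨(hf x hx).1.sq, ?_⟩
  have := ((HasD.const v x 2).mul (hf x hx).1).mul (hf x hx).2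
  convert this using 1
  ring

lemma const (c : ℝ) : Jet2 N v (fun _ => c) (fun _ => 0) (fun _ => 0) :=
  fun x _ => ⟨HasD.const v x c, HasD.const v x 0⟩

lemma sum {ι : Type*} (s : Finset ι) {f f1 f2 : ι → E2 → ℝ}
    (h : ∀ i ∈ s, Jet2 N v (f i) (f1 i) (f2 i)) :
    Jet2 N v (fun x => ∑ i ∈ s, f i x) (fun x => ∑ i ∈ s, f1 i x) (fun x => ∑ i ∈ s, f2 i x) :=
  fun x hx => ⟨HasD.sum s fun i hi => (h i hi x hx).1, HasD.sum s fun i hi => (h i hi x hx).2⟩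

lemma of_smooth (hN : IsOpen N) (hf : ContDiffOn ℝ ∞ f N) :
    Jet2 N v f (vd (fun _ => v) f) (vd (fun _ => v) (vd (fun _ => v) f)) :=
  fun _ hx => ⟨hasD_vd (V := fun _ => v) hN hf hx,
    hasD_vd (V := fun _ => v) hN (smooth_vd hN hf contDiffOn_const) hx⟩

lemma of_isLocalMax (hN : IsOpen N) (hf : ContDiffOn ℝ ∞ f N) (h : Jet2 N v f f1 f2) {p : E2}
    (hp : p ∈ N) (hmax : IsLocalMax f p) : f1 p = 0 ∧ f2 p ≤ 0 := by
  constructor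
  · rw [← (h p hp).1.2, hmax.fderiv_eq_zero]; rfl
  · have h1 := vd_vd_nonpos_of_isLocalMax (V := fun _ => v) hN hf contDiffOn_const hp hmax
    have h2 : HasD v (vd (fun _ => v) f) p (f2 p) :=
      (h p hp).2.congr_on hN hp fun x hx => (h x hx).1.2
    have h3 : vd (fun _ => v) (vd (fun _ => v) f) p = f2 p := h2.2
    rwa [h3] at h1

end Jet2

/-- The operator `Δ + D²(q, q)`. -/
def Lq (q : E2 → E2) (f : E2 → ℝ) (x : E2) : ℝ :=
  pd 0 (pd 0 f) x + pd 1 (pd 1 f) x + (q x 0 ^ 2 * pd 0 (pd 0 f) x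
    + 2 * (q x 0 * q x 1) * pd 0 (pd 1 f) x + q x 1 ^ 2 * pd 1 (pd 1 f) x)

/-- Sum of squares of a finite system of functions. -/
def sqs {ι : Type*} [Fintype ι] (w : ι → E2 → ℝ) (x : E2) : ℝ := ∑ a, w a x ^ 2

/-- The system of all first partial derivatives. -/
def gr {ι : Type*} (w : ι → E2 → ℝ) : Fin 2 × ι → E2 → ℝ := fun b => pd b.1 (w b.2)

/-- The three directions whose second derivatives add up to `Lq`. -/
def dirs (v : E2) : Fin 3 → E2 := ![EuclideanSpace.single 0 1, EuclideanSpace.single 1 1, v]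

lemma smooth_gr {ι : Type*} {N : Set E2} {w : ι → E2 → ℝ} (hN : IsOpen N)
    (hw : ∀ a, ContDiffOn ℝ ∞ (w a) N) (b : Fin 2 × ι) : ContDiffOn ℝ ∞ (gr w b) N :=
  smooth_pd hN (hw b.2) b.1

section Bernstein

variable {ι : Type*} [Fintype ι] {N : Set E2} {w : ι → E2 → ℝ} {p : E2}

lemma sqs_nonneg (w : ι → E2 → ℝ) (x : E2) : 0 ≤ sqs w x :=
  Finset.sum_nonneg fun _ _ => sq_nonneg _

lemma smooth_sqs (hw : ∀ a, ContDiffOn ℝ ∞ (w a) N) : ContDiffOn ℝ ∞ (sqs w) N :=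
  ContDiffOn.sum fun a _ => (hw a).pow 2

lemma vd_vd_const (hN : IsOpen N) {f : E2 → ℝ} (hf : ContDiffOn ℝ ∞ f N) (hp : p ∈ N) (v : E2) :
    vd (fun _ => v) (vd (fun _ => v) f) p = v 0 ^ 2 * pd 0 (pd 0 f) p
      + 2 * (v 0 * v 1) * pd 0 (pd 1 f) p + v 1 ^ 2 * pd 1 (pd 1 f) p := by
  have e : vd (fun _ => v) f = fun x => v 0 * pd 0 f x + v 1 * pd 1 f x := by
    funext x; exact vd_eq_pd _ f x
  have h : ∀ i : Fin 2, HasD v (pd i f) p (v 0 * pd 0 (pd i f) p + v 1 * pd 1 (pd i f) p) :=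
    fun i => ⟨(hasD_pd hN (smooth_pd hN hf i) hp 0).1, fderiv_eq_pd _ _ _⟩
  have := (((h 0).const_mul (v 0)).add ((h 1).const_mul (v 1))).2
  change fderiv ℝ (vd (fun _ => v) f) p v = _
  rw [e, this, pd_comm hN hf hp 1 0]
  ring

lemma sum_dirs (hN : IsOpen N) {f : E2 → ℝ} (hf : ContDiffOn ℝ ∞ f N) (hp : p ∈ N)
    (q : E2 → E2) :
    ∑ m, vd (fun _ => dirs (q p) m) (vd (fun _ => dirs (q p) m) f) p = Lq q f p := by
  simp only [vd_vd_const hN hf hp, Fin.sum_univ_three, Lq, dirs]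
  simp

/-- First directional derivative of `sqs`. -/
def sqs1 (w : ι → E2 → ℝ) (v : E2) (x : E2) : ℝ := ∑ a, 2 * w a x * vd (fun _ => v) (w a) x

/-- Second directional derivative of `sqs`. -/
def sqs2 (w : ι → E2 → ℝ) (v : E2) (x : E2) : ℝ :=
  ∑ a, (2 * vd (fun _ => v) (w a) x ^ 2 + 2 * w a x * vd (fun _ => v) (vd (fun _ => v) (w a)) x)

/-- The directional energy of the system. -/
def en (w : ι → E2 → ℝ) (v : E2) (x : E2) : ℝ := ∑ a, vd (fun _ => v) (w a) x ^ 2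

lemma jet2_sqs (hN : IsOpen N) (hw : ∀ a, ContDiffOn ℝ ∞ (w a) N) (v : E2) :
    Jet2 N v (sqs w) (sqs1 w v) (sqs2 w v) :=
  Jet2.sum _ fun a _ => (Jet2.of_smooth hN (hw a)).sq

lemma sqs1_sq_le (w : ι → E2 → ℝ) (v x : E2) : sqs1 w v x ^ 2 ≤ 4 * sqs w x * en w v x := by
  have := Finset.sum_mul_sq_le_sq_mul_sq Finset.univ (fun a => w a x)
    (fun a => vd (fun _ => v) (w a) x)
  unfold sqs1 sqs en
  have e : ∑ a, 2 * w a x * vd (fun _ => v) (w a) x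
      = 2 * ∑ a, w a x * vd (fun _ => v) (w a) x := by
    rw [Finset.mul_sum]; exact Finset.sum_congr rfl fun a _ => by ring
  rw [e]
  linarith

lemma sum_en_ge (w : ι → E2 → ℝ) (v x : E2) : sqs (gr w) x ≤ ∑ m, en w (dirs v m) x := by
  have h : 0 ≤ en w (dirs v 2) x := Finset.sum_nonneg fun _ _ => sq_nonneg _
  rw [Fin.sum_univ_three]
  have : sqs (gr w) x = en w (dirs v 0) x + en w (dirs v 1) x := by
    unfold sqs
    rw [Fintype.sum_prod_type, Fin.sum_univ_two]
    rfl
  linarith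

lemma sum_en_le (w : ι → E2 → ℝ) {v : E2} {Q : ℝ} (hv : v 0 ^ 2 + v 1 ^ 2 ≤ Q) (x : E2) :
    ∑ m, en w (dirs v m) x ≤ (1 + Q) * sqs (gr w) x := by
  rw [Fin.sum_univ_three]
  have e : sqs (gr w) x = en w (dirs v 0) x + en w (dirs v 1) x := by
    unfold sqs
    rw [Fintype.sum_prod_type, Fin.sum_univ_two]
    rfl
  have : en w (dirs v 2) x ≤ Q * sqs (gr w) x := by
    rw [e]
    unfold en
    rw [← Finset.sum_add_distrib, Finset.mul_sum]
    refine Finset.sum_le_sum fun a _ => ?_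
    rw [vd_eq_pd (fun _ => dirs v 2)]
    change (v 0 * pd 0 (w a) x + v 1 * pd 1 (w a) x) ^ 2
      ≤ Q * (pd 0 (w a) x ^ 2 + pd 1 (w a) x ^ 2)
    calc _ ≤ (v 0 ^ 2 + v 1 ^ 2) * (pd 0 (w a) x ^ 2 + pd 1 (w a) x ^ 2) := by
          nlinarith [sq_nonneg (v 0 * pd 1 (w a) x - v 1 * pd 0 (w a) x)]
      _ ≤ _ := by gcongr
  linarith

lemma sum_sqs2_ge (hN : IsOpen N) (hw : ∀ a, ContDiffOn ℝ ∞ (w a) N) (hp : p ∈ N) (q : E2 → E2)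
    {τ : ℝ} (hτ : 0 < τ) :
    2 * ∑ m, en w (dirs (q p) m) p - τ * sqs w p - sqs (fun a => Lq q (w a)) p / τ
      ≤ ∑ m, sqs2 w (dirs (q p) m) p := by
  have e : ∑ m, sqs2 w (dirs (q p) m) p
      = 2 * ∑ m, en w (dirs (q p) m) p + ∑ a, 2 * w a p * Lq q (w a) p := by
    unfold sqs2 en
    simp only [Finset.sum_add_distrib]
    congr 1
    · rw [Finset.mul_sum]
      exact Finset.sum_congr rfl fun m _ => by rw [Finset.mul_sum]
    · rw [Finset.sum_comm]
      refine Finset.sum_congr rfl fun a _ => ?_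
      rw [← Finset.mul_sum, sum_dirs hN (hw a) hp q]
  have h : -(τ * sqs w p + sqs (fun a => Lq q (w a)) p / τ) ≤ ∑ a, 2 * w a p * Lq q (w a) p := by
    unfold sqs
    rw [Finset.mul_sum, Finset.sum_div, ← Finset.sum_add_distrib, ← Finset.sum_neg_distrib]
    refine Finset.sum_le_sum fun a _ => ?_
    have : 0 ≤ (τ * w a p + Lq q (w a) p) ^ 2 / τ := by positivity
    have e : (τ * w a p + Lq q (w a) p) ^ 2 / τ
        = τ * w a p ^ 2 + Lq q (w a) p ^ 2 / τ + 2 * w a p * Lq q (w a) p := by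
      field_simp; ring
    linarith
  linarith

lemma jet2_cutoff (q : E2) (R : ℝ) (v : E2) :
    Jet2 N v (cutoff q R) (fun x => -2 * ((x 0 - q 0) * v 0 + (x 1 - q 1) * v 1))
      (fun _ => -2 * (v 0 ^ 2 + v 1 ^ 2)) := by
  refine fun x _ => ⟨hasD_cutoff q R v x, ?_⟩
  have := (((((HasD.coord v x 0).sub (HasD.const v x (q 0))).mul (HasD.const v x (v 0))).add
    (((HasD.coord v x 1).sub (HasD.const v x (q 1))).mul (HasD.const v x (v 1)))).const_mul (-2))
  convert this using 1
  ring

/-- Bernstein's interior gradient estimate, with constants depending only on the bounds. -/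
lemma bernstein_estimate (ι : Type*) [Fintype ι] {M B Q R : ℝ} (hM : 0 ≤ M) (hB : 0 ≤ B) (hQ : 0 ≤ Q)
    (hR : 0 < R) (hR1 : R ≤ 1) :
    ∃ C, ∀ (N : Set E2) (w : ι → E2 → ℝ) (q : E2 → E2) (x₀ : E2), IsOpen N →
      (∀ a, ContDiffOn ℝ ∞ (w a) N) → Metric.closedBall x₀ R ⊆ N →
      (∀ x ∈ Metric.closedBall x₀ R, sqs w x ≤ M ∧ q x 0 ^ 2 + q x 1 ^ 2 ≤ Q ∧
        sqs (fun a => Lq q (w a)) x ≤ B * (1 + sqs (gr w) x) ∧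
        sqs (fun b => Lq q (gr w b)) x ≤ B * (1 + sqs (gr w) x ^ 2 + sqs (gr (gr w)) x)) →
      ∀ x ∈ Metric.ball x₀ (R / 2), sqs (gr w) x ≤ C := by
  set K := 64 * (M * (1 + Q)) + 1 with hK
  have hK1 : 1 ≤ K := by
    have : 0 ≤ 64 * (M * (1 + Q)) := by positivity
    linarith
  set t := 8 * (B + 1) * (K + M) with ht
  set e := (B + 1) * M + 1 with he
  set c := 4 * (1 + Q) with hc
  have hKM : 0 < K + M := by linarith
  set Y := (K + M) * (2 * ((K + M) * t + e + 8 * c * (K + M)) + 2) with hY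
  have hY0 : 0 ≤ Y := by positivity
  refine ⟨Y * 2 / R ^ 4, fun N w q x₀ hN hw hsub hyp => ?_⟩
  set Φ : E2 → ℝ := fun x => cutoff x₀ R x ^ 2 * (sqs (gr w) x * (K + sqs w x)) with hΦ
  have sχ : ContDiffOn ℝ ∞ (cutoff x₀ R) N := (contDiff_cutoff x₀ R).contDiffOn
  have sΦ : ContDiffOn ℝ ∞ Φ N :=
    (sχ.pow 2).mul ((smooth_sqs (smooth_gr hN hw)).mul (contDiffOn_const.add (smooth_sqs hw)))
  have bound : ∀ x ∈ Metric.closedBall x₀ R, Φ x ≤ Y := by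
    obtain ⟨z, hz, hmax⟩ := (isCompact_closedBall x₀ R).exists_isMaxOn
      ⟨x₀, Metric.mem_closedBall_self hR.le⟩ (sΦ.continuousOn.mono hsub)
    refine fun x hx => (hmax hx).trans ?_
    change Φ z ≤ Y
    by_cases hpos : Φ z ≤ 0
    · exact hpos.trans hY0
    push Not at hpos
    have hχ0 : 0 ≤ cutoff x₀ R z := by
      rw [cutoff_eq, sub_nonneg]; exact pow_le_pow_left₀ dist_nonneg hz 2
    have hχ : 0 < cutoff x₀ R z := by
      refine lt_of_le_of_ne hχ0 fun h0 => ?_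
      simp only [hΦ, ← h0] at hpos
      norm_num at hpos
    have hG : 0 < sqs (gr w) z := by
      refine lt_of_le_of_ne (sqs_nonneg _ _) fun h0 => ?_
      simp only [hΦ, ← h0] at hpos
      norm_num at hpos
    have hzb : z ∈ Metric.ball x₀ R := by
      rw [cutoff_eq, sub_pos] at hχ
      exact lt_of_pow_lt_pow_left₀ 2 hR.le hχ
    have hloc : IsLocalMax Φ z :=
      (hmax.filter_mono (by
        rw [le_principal_iff]
        exact mem_of_superset (Metric.isOpen_ball.mem_nhds hzb) Metric.ball_subset_closedBall))
    have hzN : z ∈ N := hsub hz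
    obtain ⟨hw1, hq1, hf1, hf2⟩ := hyp z hz
    have jets := fun m => (((jet2_cutoff x₀ R (dirs (q z) m)).sq).mul
      ((jet2_sqs hN (smooth_gr hN hw) (dirs (q z) m)).mul
        ((Jet2.const (N := N) (v := dirs (q z) m) K).add (jet2_sqs hN hw (dirs (q z) m)))))
    have conds := fun m => (jets m).of_isLocalMax hN sΦ hzN hloc
    have hdist : (z 0 - x₀ 0) ^ 2 + (z 1 - x₀ 1) ^ 2 ≤ 1 := by
      have h1 : dist z x₀ ^ 2 ≤ 1 := pow_le_one₀ dist_nonneg (le_trans hz hR1)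
      rwa [dist_eq_norm, E2.norm_sq] at h1
    have hdq : ((z 0 - x₀ 0) * q z 0 + (z 1 - x₀ 1) * q z 1) ^ 2 ≤ Q := by
      calc _ ≤ ((z 0 - x₀ 0) ^ 2 + (z 1 - x₀ 1) ^ 2) * (q z 0 ^ 2 + q z 1 ^ 2) := by
            nlinarith [sq_nonneg ((z 0 - x₀ 0) * q z 1 - (z 1 - x₀ 1) * q z 0)]
        _ ≤ 1 * Q := by gcongr
        _ = Q := one_mul Q
    refine bernstein_algebra (A := 1 + Q) (c := c) (t := t) (e := e)
      (χ1 := fun m => -2 * ((z 0 - x₀ 0) * dirs (q z) m 0 + (z 1 - x₀ 1) * dirs (q z) m 1))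
      (χ2 := fun m => -2 * (dirs (q z) m 0 ^ 2 + dirs (q z) m 1 ^ 2))
      (G1 := fun m => sqs1 (gr w) (dirs (q z) m) z) (G2 := fun m => sqs2 (gr w) (dirs (q z) m) z)
      (N1 := fun m => sqs1 w (dirs (q z) m) z) (N2 := fun m => sqs2 w (dirs (q z) m) z)
      (S := fun m => en (gr w) (dirs (q z) m) z) (T := fun m => en w (dirs (q z) m) z)
      hχ (cutoff_le_one x₀ z hR hR1) hG hM hK1 (by rw [hK]; linarith)
      (by linarith [sqs_nonneg w z]) (by linarith) (by positivity) (by positivity) (by positivity)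
      (fun m => Finset.sum_nonneg fun _ _ => sq_nonneg _) (fun m => ?_) ?_ ?_ ?_ ?_ ?_
      (fun m => sqs1_sq_le _ _ _) (fun m => ?_) (sum_en_le w hq1 z)
    · refine Eq.trans ?_ (conds m).1
      ring
    · refine Finset.sum_nonpos fun m _ => le_trans (le_of_eq ?_) (conds m).2
      ring
    · simp only [Fin.sum_univ_three, dirs]
      simp
      rw [hc]
      linarith
    · simp only [Fin.sum_univ_three, dirs]
      simp
      rw [hc]
      linarith
    · have h1 := sum_sqs2_ge hN (smooth_gr hN hw) hzN q (by positivity : 0 < t)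
      have h2 : sqs (fun b => Lq q (gr w b)) z / t
          ≤ (1 + sqs (gr w) z ^ 2 + ∑ m, en (gr w) (dirs (q z) m) z) / (8 * (K + M)) := by
        have h3 := sum_en_ge (gr w) (q z) z
        have h4 := sqs_nonneg (gr (gr w)) z
        calc _ ≤ (B + 1) * (1 + sqs (gr w) z ^ 2 + ∑ m, en (gr w) (dirs (q z) m) z) / t := by
              gcongr
              refine hf2.trans ?_
              gcongr
              linarith
          _ = _ := by rw [ht]; field_simp
      linarith
    · have h1 := sum_sqs2_ge hN hw hzN q (by positivity : 0 < B + 1)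
      have h2 : sqs (fun a => Lq q (w a)) z / (B + 1) ≤ 1 + sqs (gr w) z := by
        rw [div_le_iff₀ (by positivity)]
        linarith
      have h3 := sum_en_ge w (q z) z
      have h4 : (B + 1) * sqs w z ≤ (B + 1) * M := by gcongr
      rw [he]
      linarith
    · refine (sqs1_sq_le _ _ _).trans ?_
      have : 0 ≤ en w (dirs (q z) m) z := Finset.sum_nonneg fun _ _ => sq_nonneg _
      gcongr
  intro x hx
  have hxR : x ∈ Metric.closedBall x₀ R :=
    Metric.ball_subset_closedBall (Metric.ball_subset_ball (by linarith) hx)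
  have h1 := bound x hxR
  have h2 : R ^ 2 * (3 / 4) ≤ cutoff x₀ R x := by
    rw [cutoff_eq]
    have : dist x x₀ ^ 2 ≤ (R / 2) ^ 2 := pow_le_pow_left₀ dist_nonneg (Metric.mem_ball.1 hx).le 2
    linarith
  have h3 : R ^ 4 / 2 ≤ cutoff x₀ R x ^ 2 := by
    have : (R ^ 2 * (3 / 4)) ^ 2 ≤ cutoff x₀ R x ^ 2 := pow_le_pow_left₀ (by positivity) h2 2
    have : 0 ≤ R ^ 4 := by positivity
    linarith
  rw [le_div_iff₀ (by positivity)]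
  have h4 := sqs_nonneg (gr w) x
  have h5 := sqs_nonneg w x
  have h6 : R ^ 4 / 2 * (sqs (gr w) x * 1) ≤ Φ x := by
    simp only [hΦ]
    gcongr
    linarith
  linarith

end Bernstein

/-! ### Differential polynomials -/

/-- Iterated partial derivatives along a word of coordinate indices. -/
def pdl (l : List (Fin 2)) (f : E2 → ℝ) : E2 → ℝ := l.foldr pd f

/-- Polynomials in the coordinates and in the partial derivatives of positive order of the family
`u`; derivatives of order at most `n` have weight zero, those of order `n + e` have weight `e`, and
`d` bounds the total weight. -/
inductive DPol {ι : Type*} (u : ι → E2 → ℝ) (n : ℕ) : ℕ → (ι → E2 → ℝ) → Prop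
  | const (d : ℕ) (c : ℝ) : DPol u n d (fun _ _ => c)
  | coord (d : ℕ) (i : Fin 2) : DPol u n d (fun _ x => x i)
  | gen (d : ℕ) (l : List (Fin 2)) (h1 : 1 ≤ l.length) (h2 : l.length ≤ n + d) :
      DPol u n d (fun k => pdl l (u k))
  | add (d : ℕ) (f g : ι → E2 → ℝ) (hf : DPol u n d f) (hg : DPol u n d g) :
      DPol u n d (fun k x => f k x + g k x)
  | mul (d d₁ d₂ : ℕ) (hd : d₁ + d₂ ≤ d) (f g : ι → E2 → ℝ) (hf : DPol u n d₁ f)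
      (hg : DPol u n d₂ g) : DPol u n d (fun k x => f k x * g k x)

lemma smooth_pdl {Ω : Set E2} (hΩ : IsOpen Ω) {f : E2 → ℝ} (hf : ContDiffOn ℝ ∞ f Ω)
    (l : List (Fin 2)) : ContDiffOn ℝ ∞ (pdl l f) Ω := by
  induction l with
  | nil => exact hf
  | cons i l ih => exact smooth_pd hΩ ih i

namespace DPol

variable {ι : Type*} {u : ι → E2 → ℝ} {n d : ℕ} {f g : ι → E2 → ℝ}

lemma mono (hf : DPol u n d f) {n' d' : ℕ} (hn : n ≤ n') (hd : d ≤ d') : DPol u n' d' f := by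
  induction hf generalizing d' with
  | const d c => exact const _ c
  | coord d i => exact coord _ i
  | gen d l h1 h2 => exact gen _ l h1 (by omega)
  | add d f g _ _ ihf ihg => exact add _ _ _ (ihf hd) (ihg hd)
  | mul d d₁ d₂ h f g _ _ ihf ihg => exact mul _ _ _ (h.trans hd) _ _ (ihf le_rfl) (ihg le_rfl)

lemma shift (hf : DPol u n d f) : DPol u (n + 1) (d - 1) f := by
  induction hf with
  | const d c => exact const _ c
  | coord d i => exact coord _ i
  | gen d l h1 h2 => exact gen _ l h1 (by omega)
  | add d f g _ _ ihf ihg => exact add _ _ _ ihf ihg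
  | mul d d₁ d₂ h f g _ _ ihf ihg => exact mul _ _ _ (by omega) _ _ ihf ihg

lemma mul' (hf : DPol u n d f) (hg : DPol u n 0 g) : DPol u n d (fun k x => f k x * g k x) :=
  mul d d 0 le_rfl _ _ hf hg

lemma sub (hf : DPol u n d f) (hg : DPol u n d g) : DPol u n d (fun k x => f k x - g k x) := by
  have := add d _ _ hf (mul d 0 d (by omega) _ _ (const 0 (-1)) hg)
  convert this using 3
  ring

lemma kap : DPol u n 0 (fun _ => kap) := by
  have h : ∀ i : Fin 2, DPol u n 0 (fun _ x => x i * x i) := fun i => (coord 0 i).mul' (coord 0 i)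
  have := (const 0 1).sub (add 0 _ _ (h 0) (h 1))
  convert this using 3
  rw [_root_.kap]
  ring

lemma exists_deriv {Ω : Set E2} (hΩ : IsOpen Ω) (hu : ∀ k, ContDiffOn ℝ ∞ (u k) Ω)
    (hf : DPol u n d f) (i : Fin 2) : ∃ g, DPol u n (d + 1) g ∧
      ∀ k, ∀ x ∈ Ω, HasD (EuclideanSpace.single i 1) (f k) x (g k x) := by
  induction hf with
  | const d c => exact ⟨_, const _ 0, fun k x _ => HasD.const _ _ _⟩
  | coord d j =>
    exact ⟨_, const _ ((EuclideanSpace.single i (1:ℝ) : E2) j), fun k x _ => HasD.coord _ _ _⟩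
  | gen d l h1 h2 =>
    exact ⟨_, gen _ (i :: l) (by simp) (by simp; omega),
      fun k x hx => hasD_pd hΩ (smooth_pdl hΩ (hu k) l) hx i⟩
  | add d f g _ _ ihf ihg =>
    obtain ⟨f', hf', hf⟩ := ihf
    obtain ⟨g', hg', hg⟩ := ihg
    exact ⟨_, add _ _ _ hf' hg', fun k x hx => (hf k x hx).add (hg k x hx)⟩
  | mul d d₁ d₂ h f g hf0 hg0 ihf ihg =>
    obtain ⟨f', hf', hf⟩ := ihf
    obtain ⟨g', hg', hg⟩ := ihg
    exact ⟨_, add _ _ _ (mul _ _ _ (by omega) _ _ hf' hg0) (mul _ _ _ (by omega) _ _ hf0 hg'),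
      fun k x hx => (hf k x hx).mul (hg k x hx)⟩

lemma exists_bound (hf : DPol u n d f) {B : ℝ} (hB : 0 ≤ B) : ∃ C, 0 ≤ C ∧ ∀ y ∈ Disk, ∀ k,
    ∀ ρ : ℝ, 1 ≤ ρ → (∀ l : List (Fin 2), 1 ≤ l.length → l.length ≤ n + d →
      |pdl l (u k) y| ≤ B * ρ ^ (l.length - n)) → |f k y| ≤ C * ρ ^ d := by
  induction hf with
  | const d c =>
    refine ⟨|c|, abs_nonneg c, fun y _ k ρ hρ _ => le_mul_of_one_le_right (abs_nonneg c) ?_⟩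
    exact one_le_pow₀ hρ
  | coord d i =>
    refine ⟨1, zero_le_one, fun y hy k ρ hρ _ => ?_⟩
    rw [one_mul]
    exact ((PiLp.norm_apply_le y i).trans (norm_le_of_disk hy)).trans (one_le_pow₀ hρ)
  | gen d l h1 h2 =>
    refine ⟨B, hB, fun y _ k ρ hρ h => (h l h1 h2).trans ?_⟩
    have : l.length - n ≤ d := by omega
    gcongr
  | add d f g _ _ ihf ihg =>
    obtain ⟨C, hC0, hC⟩ := ihf
    obtain ⟨D, hD0, hD⟩ := ihg
    refine ⟨C + D, by positivity, fun y hy k ρ hρ h => (abs_add_le _ _).trans ?_⟩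
    rw [add_mul]
    exact add_le_add (hC y hy k ρ hρ h) (hD y hy k ρ hρ h)
  | mul d d₁ d₂ hd f g _ _ ihf ihg =>
    obtain ⟨C, hC0, hC⟩ := ihf
    obtain ⟨D, hD0, hD⟩ := ihg
    refine ⟨C * D, by positivity, fun y hy k ρ hρ h => ?_⟩
    have h1 := hC y hy k ρ hρ fun l a b => h l a (by omega)
    have h2 := hD y hy k ρ hρ fun l a b => h l a (by omega)
    rw [abs_mul]
    calc _ ≤ (C * ρ ^ d₁) * (D * ρ ^ d₂) := by gcongr
      _ = C * D * ρ ^ (d₁ + d₂) := by ring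
      _ ≤ _ := by gcongr

end DPol

/-! ### Prolongation of the minimal graph equation -/

/-- The vector field whose second derivative completes the Laplacian to the principal part of the
minimal graph equation. -/
def qf (u : E2 → ℝ) (x : E2) : E2 := !₂[-(kap x / 2 * pd 1 u x), kap x / 2 * pd 0 u x]

lemma qf_zero (u : E2 → ℝ) (x : E2) : qf u x 0 = -(kap x / 2 * pd 1 u x) := rfl

lemma qf_one (u : E2 → ℝ) (x : E2) : qf u x 1 = kap x / 2 * pd 0 u x := rfl

section Prolongation

variable {ι : Type*} {Ω : Set E2} {u : ι → E2 → ℝ}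

lemma Lq_qf_self (u : E2 → ℝ) (x : E2) : Lq (qf u) u x
    = mgOp u x - kap x / 2 * (pd 0 u x ^ 2 + pd 1 u x ^ 2) * (x 0 * pd 0 u x + x 1 * pd 1 u x) := by
  rw [Lq, mgOp, qf_zero, qf_one]
  ring

lemma pd_comm_three (hΩ : IsOpen Ω) {f : E2 → ℝ} (hf : ContDiffOn ℝ ∞ f Ω) {p : E2} (hp : p ∈ Ω)
    (i a b : Fin 2) : pd i (pd a (pd b f)) p = pd a (pd b (pd i f)) p := by
  rw [pd_comm hΩ (smooth_pd hΩ hf b) hp i a]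
  exact ((hasD_pd hΩ (smooth_pd hΩ (smooth_pd hΩ hf i) b) hp a).congr_on hΩ hp
    fun x hx => pd_comm hΩ hf hx i b).2

/-- Commutation of `Lq` with a partial derivative. -/
lemma Lq_pd (hΩ : IsOpen Ω) {q : E2 → E2} {f F c0 c1 : E2 → ℝ} (hf : ContDiffOn ℝ ∞ f Ω) {p : E2}
    (hp : p ∈ Ω) {i : Fin 2} (hF : ∀ x ∈ Ω, Lq q f x = F x) {F' : ℝ}
    (hF' : HasD (EuclideanSpace.single i 1) F p F')
    (h0 : HasD (EuclideanSpace.single i 1) (fun x => q x 0) p (c0 p))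
    (h1 : HasD (EuclideanSpace.single i 1) (fun x => q x 1) p (c1 p)) :
    Lq q (pd i f) p = F' - (2 * q p 0 * c0 p * pd 0 (pd 0 f) p
      + 2 * (c0 p * q p 1 + q p 0 * c1 p) * pd 0 (pd 1 f) p
      + 2 * q p 1 * c1 p * pd 1 (pd 1 f) p) := by
  have s := fun a b : Fin 2 => hasD_pd hΩ (smooth_pd hΩ (smooth_pd hΩ hf b) a) hp i
  have h := ((s 0 0).add (s 1 1)).add (((h0.sq.mul (s 0 0)).add
    (((h0.mul h1).const_mul 2).mul (s 0 1))).add (h1.sq.mul (s 1 1)))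
  have h' : HasD (EuclideanSpace.single i 1) (Lq q f) p F' := hF'.congr_on hΩ hp hF
  have e := h'.unique h
  rw [e, Lq, ← pd_comm_three hΩ hf hp i 0 0, ← pd_comm_three hΩ hf hp i 0 1,
    ← pd_comm_three hΩ hf hp i 1 1]
  ring

lemma dpol_qf (u : ι → E2 → ℝ) (a : Fin 2) : DPol u 1 0 (fun k x => qf (u k) x a) := by
  have g : ∀ i : Fin 2, DPol u 1 0 (fun k x => kap x * pd i (u k) x) := fun i =>
    DPol.kap.mul' (DPol.gen 0 [i] (by simp) (by simp))
  fin_cases a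
  · have := (DPol.const (u := u) (n := 1) 0 (-1 / 2)).mul' (g 1)
    convert this using 3
    simp only [Fin.zero_eta, qf_zero]
    ring
  · have := (DPol.const (u := u) (n := 1) 0 (1 / 2)).mul' (g 0)
    convert this using 3
    simp only [Fin.mk_one, qf_one]
    ring

lemma prolong (hΩ : IsOpen Ω) (hu : ∀ k, ContDiffOn ℝ ∞ (u k) Ω) {l : List (Fin 2)} {n d n' d' : ℕ}
    {g : ι → E2 → ℝ} (hg : DPol u n d g)
    (hL : ∀ k, ∀ x ∈ Ω, Lq (qf (u k)) (pdl l (u k)) x = g k x) (hn' : 2 ≤ n')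
    (hsub : ∀ g, DPol u n (d + 1) g → DPol u n' d' g) (hl : l.length + 2 ≤ n' + d') (i : Fin 2) :
    ∃ g', DPol u n' d' g' ∧ ∀ k, ∀ x ∈ Ω, Lq (qf (u k)) (pdl (i :: l) (u k)) x = g' k x := by
  obtain ⟨G, hG, hGD⟩ := hg.exists_deriv hΩ hu i
  obtain ⟨c0, hc0, hc0D⟩ := (dpol_qf u 0).exists_deriv hΩ hu i
  obtain ⟨c1, hc1, hc1D⟩ := (dpol_qf u 1).exists_deriv hΩ hu i
  have q0 : DPol u n' 0 (fun k x => qf (u k) x 0) := (dpol_qf u 0).mono (by omega) le_rfl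
  have q1 : DPol u n' 0 (fun k x => qf (u k) x 1) := (dpol_qf u 1).mono (by omega) le_rfl
  have hc0' : DPol u n' 0 c0 := hc0.shift.mono hn' le_rfl
  have hc1' : DPol u n' 0 c1 := hc1.shift.mono hn' le_rfl
  have z : ∀ a b : Fin 2, DPol u n' d' (fun k => pd a (pd b (pdl l (u k)))) := fun a b =>
    DPol.gen d' (a :: b :: l) (by simp) (by simp only [List.length_cons]; omega)
  have two : DPol u n' 0 (fun _ _ => (2:ℝ)) := DPol.const 0 2
  have t0 := (z 0 0).mul' ((two.mul' q0).mul' hc0')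
  have t1 := (z 0 1).mul' (two.mul' (DPol.add 0 _ _ (hc0'.mul' q1) (q0.mul' hc1')))
  have t2 := (z 1 1).mul' ((two.mul' q1).mul' hc1')
  refine ⟨_, (hsub G hG).sub (DPol.add _ _ _ (DPol.add _ _ _ t0 t1) t2), fun k x hx => ?_⟩
  change Lq (qf (u k)) (pd i (pdl l (u k))) x = _
  rw [Lq_pd hΩ (smooth_pdl hΩ (hu k) l) hx (hL k) (hGD k x hx) (hc0D k x hx) (hc1D k x hx)]
  ring

lemma exists_Lq_pdl (hΩ : IsOpen Ω) (hu : ∀ k, ContDiffOn ℝ ∞ (u k) Ω)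
    (hm : ∀ k, ∀ p ∈ Ω, mgOp (u k) p = 0) (l : List (Fin 2)) :
    ∃ g, DPol u (l.length + 1) 0 g ∧
      ∀ k, ∀ x ∈ Ω, Lq (qf (u k)) (pdl l (u k)) x = g k x := by
  induction l with
  | nil =>
    have z : ∀ i : Fin 2, DPol u 1 0 (fun k => pd i (u k)) := fun i =>
      DPol.gen 0 [i] (by simp) (by simp)
    have c : ∀ i : Fin 2, DPol u 1 0 (fun _ x => x i) := fun i => DPol.coord 0 i
    refine ⟨_, ((DPol.const 0 (-1 / 2)).mul' DPol.kap).mul' ((DPol.add 0 _ _ ((z 0).mul' (z 0))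
      ((z 1).mul' (z 1))).mul' (DPol.add 0 _ _ ((c 0).mul' (z 0)) ((c 1).mul' (z 1)))),
      fun k x hx => ?_⟩
    change Lq (qf (u k)) (u k) x = _
    rw [Lq_qf_self, hm k x hx]
    ring
  | cons i l ih =>
    obtain ⟨g, hg, hL⟩ := ih
    exact prolong hΩ hu hg hL (by simp) (fun g hg => by simpa using hg.shift) (by simp) i

lemma exists_Lq_pdl_one (hΩ : IsOpen Ω) (hu : ∀ k, ContDiffOn ℝ ∞ (u k) Ω)
    (hm : ∀ k, ∀ p ∈ Ω, mgOp (u k) p = 0) {n : ℕ} (hn : 2 ≤ n) {l : List (Fin 2)}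
    (hl : l.length = n) :
    ∃ g, DPol u n 1 g ∧ ∀ k, ∀ x ∈ Ω, Lq (qf (u k)) (pdl l (u k)) x = g k x := by
  match l, hl with
  | [], hl => simp at hl; omega
  | i :: l, hl =>
    simp only [List.length_cons] at hl
    obtain ⟨g, hg, hL⟩ := exists_Lq_pdl hΩ hu hm l
    rw [hl] at hg
    exact prolong hΩ hu hg hL hn (fun g hg => hg) (by omega) i

lemma exists_Lq_pdl_two (hΩ : IsOpen Ω) (hu : ∀ k, ContDiffOn ℝ ∞ (u k) Ω)
    (hm : ∀ k, ∀ p ∈ Ω, mgOp (u k) p = 0) {n : ℕ} (hn : 2 ≤ n) {l : List (Fin 2)}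
    (hl : l.length = n) (i : Fin 2) :
    ∃ g, DPol u n 2 g ∧ ∀ k, ∀ x ∈ Ω, Lq (qf (u k)) (pdl (i :: l) (u k)) x = g k x := by
  obtain ⟨g, hg, hL⟩ := exists_Lq_pdl_one hΩ hu hm hn hl
  exact prolong hΩ hu hg hL hn (fun g hg => hg) (by omega) i

end Prolongation

/-! ### Local bounds for all derivatives -/

lemma sq_le_sqs {ι : Type*} [Fintype ι] (w : ι → E2 → ℝ) (a : ι) (x : E2) : w a x ^ 2 ≤ sqs w x :=
  Finset.single_le_sum (f := fun a => w a x ^ 2) (fun _ _ => sq_nonneg _) (Finset.mem_univ a)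

section HigherBounds

variable {ι : Type*} {Ω : Set E2} {u : ι → E2 → ℝ}

lemma exists_common_bound {n : ℕ}
    (h : ∀ l : List (Fin 2), 1 ≤ l.length → l.length ≤ n → LB Ω (fun k => pdl l (u k))) {x₀ : E2}
    (hx₀ : x₀ ∈ Ω) : ∃ B, 0 ≤ B ∧ ∀ᶠ y in 𝓝 x₀, ∀ l : List (Fin 2), 1 ≤ l.length →
      l.length ≤ n → ∀ k, |pdl l (u k) y| ≤ B := by
  have h1 : ∀ l : List (Fin 2), ∃ C, 0 ≤ C ∧ ∀ᶠ y in 𝓝 x₀, 1 ≤ l.length → l.length ≤ n →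
      ∀ k, |pdl l (u k) y| ≤ C := by
    intro l
    by_cases hl : 1 ≤ l.length ∧ l.length ≤ n
    · obtain ⟨C, hC⟩ := h l hl.1 hl.2 x₀ hx₀
      exact ⟨|C|, abs_nonneg C, hC.mono fun y hy _ _ k => (hy k).trans (le_abs_self C)⟩
    · exact ⟨0, le_rfl, Eventually.of_forall fun y a b => (hl ⟨a, b⟩).elim⟩
  choose C hC0 hC using h1
  have hS : {l : List (Fin 2) | l.length ≤ n}.Finite := List.finite_length_le (Fin 2) n
  refine ⟨∑ l ∈ hS.toFinset, C l, Finset.sum_nonneg fun l _ => hC0 l, ?_⟩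
  have := (eventually_all_finite hS).2 fun l _ => hC l
  filter_upwards [this] with y hy l hl1 hl2 k
  exact (hy l hl2 hl1 hl2 k).trans
    (Finset.single_le_sum (f := C) (fun l _ => hC0 l) (hS.mem_toFinset.2 hl2))

lemma LB_pdl_succ (hΩ : IsOpen Ω) (hΩD : Ω ⊆ Disk) (hu : ∀ k, ContDiffOn ℝ ∞ (u k) Ω)
    (hm : ∀ k, ∀ p ∈ Ω, mgOp (u k) p = 0) {n : ℕ} (hn : 2 ≤ n)
    (h : ∀ l : List (Fin 2), 1 ≤ l.length → l.length ≤ n → LB Ω (fun k => pdl l (u k)))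
    {l : List (Fin 2)} (hl : l.length = n + 1) : LB Ω (fun k => pdl l (u k)) := by
  intro x₀ hx₀
  obtain ⟨B, hB0, hB⟩ := exists_common_bound h hx₀
  obtain ⟨R, ⟨hR0, hR1⟩, hRsub⟩ : ∃ R : ℝ, (0 < R ∧ R ≤ 1) ∧ Metric.closedBall x₀ R ⊆
      {y | y ∈ Ω ∧ ∀ l : List (Fin 2), 1 ≤ l.length → l.length ≤ n → ∀ k,
        |pdl l (u k) y| ≤ B} := by
    obtain ⟨R, hR, hs⟩ := Metric.nhds_basis_closedBall.mem_iff.1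
      ((hΩ.eventually_mem hx₀).and hB)
    exact ⟨min R 1, ⟨lt_min hR one_pos, min_le_right _ _⟩,
      (Metric.closedBall_subset_closedBall (min_le_left _ _)).trans hs⟩
  let w : ι → List.Vector (Fin 2) n → E2 → ℝ := fun k a => pdl a.1 (u k)
  choose g₁ hg₁ hL₁ using fun a : List.Vector (Fin 2) n => exists_Lq_pdl_one hΩ hu hm hn a.2
  choose g₂ hg₂ hL₂ using fun b : Fin 2 × List.Vector (Fin 2) n =>
    exists_Lq_pdl_two hΩ hu hm hn b.2.2 b.1
  have hB1 : 0 ≤ B + 1 := by linarith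
  choose C₁ hC₁0 hC₁ using fun a => (hg₁ a).exists_bound hB1
  choose C₂ hC₂0 hC₂ using fun b => (hg₂ b).exists_bound hB1
  have hlow : ∀ y ∈ Metric.closedBall x₀ R, ∀ k, ∀ ρ : ℝ, ∀ l : List (Fin 2), 1 ≤ l.length →
      l.length ≤ n → |pdl l (u k) y| ≤ (B + 1) * ρ ^ (l.length - n) := by
    intro y hy k ρ l h1 h2
    rw [Nat.sub_eq_zero_of_le h2, pow_zero, mul_one]
    linarith [(hRsub hy).2 l h1 h2 k]
  have hone : ∀ y k, ∀ l : List (Fin 2), l.length = n + 1 →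
      pdl l (u k) y ^ 2 ≤ sqs (gr (w k)) y := by
    intro y k l hl
    match l, hl with
    | [], hl => simp at hl
    | i :: l, hl => exact sq_le_sqs (gr (w k)) (i, ⟨l, by simpa using hl⟩) y
  have htwo : ∀ y k, ∀ l : List (Fin 2), l.length = n + 2 →
      pdl l (u k) y ^ 2 ≤ sqs (gr (gr (w k))) y := by
    intro y k l hl
    match l, hl with
    | [], hl => simp at hl
    | [_], hl => simp at hl
    | j :: i :: l, hl => exact sq_le_sqs (gr (gr (w k))) (j, (i, ⟨l, by simpa using hl⟩)) y
  have est₁ : ∀ y ∈ Metric.closedBall x₀ R, ∀ k a,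
      Lq (qf (u k)) (w k a) y ^ 2 ≤ C₁ a ^ 2 * (1 + sqs (gr (w k)) y) := by
    intro y hy k a
    have hG := sqs_nonneg (gr (w k)) y
    set G := sqs (gr (w k)) y with hGdef
    have hρ : 1 ≤ √(1 + G) := Real.one_le_sqrt.2 (by linarith)
    have hs : √(1 + G) ^ 2 = 1 + G := Real.sq_sqrt (by linarith)
    have := hC₁ a y (hΩD (hRsub hy).1) k (√(1 + G)) hρ fun l h1 h2 => by
      rcases h2.lt_or_eq with h2 | h2
      · exact hlow y hy k _ l h1 (by omega)
      · have e := hone y k l h2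
        rw [h2, Nat.add_sub_cancel_left, pow_one]
        have : |pdl l (u k) y| ≤ √(1 + G) := Real.abs_le_sqrt (by linarith)
        nlinarith
    rw [pow_one, ← hL₁ a k y (hRsub hy).1] at this
    calc _ = |Lq (qf (u k)) (pdl a.1 (u k)) y| ^ 2 := (sq_abs _).symm
      _ ≤ (C₁ a * √(1 + G)) ^ 2 := by gcongr
      _ = _ := by rw [mul_pow, hs]
  have est₂ : ∀ y ∈ Metric.closedBall x₀ R, ∀ k b, Lq (qf (u k)) (gr (w k) b) y ^ 2
      ≤ C₂ b ^ 2 * (1 + sqs (gr (w k)) y ^ 2 + sqs (gr (gr (w k))) y) := by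
    intro y hy k b
    have hG := sqs_nonneg (gr (w k)) y
    have hP := sqs_nonneg (gr (gr (w k))) y
    set G := sqs (gr (w k)) y with hGdef
    set P := sqs (gr (gr (w k))) y with hPdef
    have hT : 1 ≤ 1 + G ^ 2 + P := by nlinarith
    have hs₁ : √(1 + G ^ 2 + P) ^ 2 = 1 + G ^ 2 + P := Real.sq_sqrt (by linarith)
    have hσ : 1 ≤ √(1 + G ^ 2 + P) := Real.one_le_sqrt.2 hT
    have hGσ : G ≤ √(1 + G ^ 2 + P) := Real.le_sqrt_of_sq_le (by linarith)
    set σ := √(1 + G ^ 2 + P) with hσdef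
    have hρ : 1 ≤ √σ := Real.one_le_sqrt.2 hσ
    have hs : √σ ^ 2 = σ := Real.sq_sqrt (by linarith)
    have := hC₂ b y (hΩD (hRsub hy).1) k (√σ) hρ fun l h1 h2 => by
      rcases h2.lt_or_eq with h2 | h2
      · rcases (Nat.lt_succ_iff.1 h2).lt_or_eq with h2 | h2
        · exact hlow y hy k _ l h1 (by omega)
        · have e := hone y k l h2
          rw [h2, Nat.add_sub_cancel_left, pow_one]
          have : |pdl l (u k) y| ≤ √σ := Real.abs_le_sqrt (e.trans hGσ)
          nlinarith
      · have e := htwo y k l h2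
        rw [h2, Nat.add_sub_cancel_left, hs]
        have : |pdl l (u k) y| ≤ σ := Real.abs_le_sqrt (by nlinarith)
        nlinarith
    rw [hs, ← hL₂ b k y (hRsub hy).1] at this
    calc _ = |Lq (qf (u k)) (pdl (b.1 :: b.2.1) (u k)) y| ^ 2 := (sq_abs _).symm
      _ ≤ (C₂ b * σ) ^ 2 := by gcongr
      _ = _ := by rw [mul_pow, hs₁]
  have hS₁ : 0 ≤ ∑ a, C₁ a ^ 2 := Finset.sum_nonneg fun _ _ => sq_nonneg _
  have hS₂ : 0 ≤ ∑ b, C₂ b ^ 2 := Finset.sum_nonneg fun _ _ => sq_nonneg _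
  obtain ⟨C, hC⟩ := bernstein_estimate (List.Vector (Fin 2) n)
    (M := Fintype.card (List.Vector (Fin 2) n) * B ^ 2) (B := ∑ a, C₁ a ^ 2 + ∑ b, C₂ b ^ 2)
    (Q := 2 * B ^ 2) (by positivity) (by positivity) (by positivity) hR0 hR1
  refine ⟨√C, ?_⟩
  filter_upwards [Metric.ball_mem_nhds x₀ (half_pos hR0)] with y hy k
  refine Real.abs_le_sqrt ((hone y k l hl).trans ?_)
  refine hC Ω (w k) (qf (u k)) x₀ hΩ (fun a => smooth_pdl hΩ (hu k) a.1)
    (fun z hz => (hRsub hz).1) (fun z hz => ⟨?_, ?_, ?_, ?_⟩) y hy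
  · have : ∀ a ∈ (Finset.univ : Finset (List.Vector (Fin 2) n)), w k a z ^ 2 ≤ B ^ 2 :=
      fun a _ => sq_le_sq' (by linarith [abs_le.1 ((hRsub hz).2 a.1 (by rw [a.2]; omega)
        (by rw [a.2]) k)]) (abs_le.1 ((hRsub hz).2 a.1 (by rw [a.2]; omega) (by rw [a.2]) k)).2
    have := Finset.sum_le_card_nsmul _ _ _ this
    rwa [nsmul_eq_mul, Finset.card_univ] at this
  · have hk0 := (kap_pos (hΩD (hRsub hz).1)).le
    have hk1 := kap_le_one z
    have key : ∀ i, (kap z / 2 * pd i (u k) z) ^ 2 ≤ B ^ 2 := fun i => by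
      have hb : |pd i (u k) z| ≤ B := (hRsub hz).2 [i] (by simp) (by simp; omega) k
      refine sq_le_sq.2 ?_
      rw [abs_mul, abs_of_nonneg (by linarith : 0 ≤ kap z / 2), abs_of_nonneg hB0]
      nlinarith [abs_nonneg (pd i (u k) z)]
    rw [qf_zero, qf_one, neg_sq]
    linarith [key 0, key 1]
  · have hG := sqs_nonneg (gr (w k)) z
    calc _ ≤ ∑ a, C₁ a ^ 2 * (1 + sqs (gr (w k)) z) :=
          Finset.sum_le_sum fun a _ => est₁ z hz k a
      _ = (∑ a, C₁ a ^ 2) * (1 + sqs (gr (w k)) z) := by rw [Finset.sum_mul]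
      _ ≤ _ := by gcongr; linarith
  · have hG := sqs_nonneg (gr (w k)) z
    have hP := sqs_nonneg (gr (gr (w k))) z
    calc _ ≤ ∑ b, C₂ b ^ 2 * (1 + sqs (gr (w k)) z ^ 2 + sqs (gr (gr (w k))) z) :=
          Finset.sum_le_sum fun b _ => est₂ z hz k b
      _ = (∑ b, C₂ b ^ 2) * (1 + sqs (gr (w k)) z ^ 2 + sqs (gr (gr (w k))) z) := by
          rw [Finset.sum_mul]
      _ ≤ _ := by gcongr; linarith

/-- All derivatives of positive order are locally bounded along a family of minimal graphs whose
gradients are pointwise bounded. -/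
lemma LB_pdl (hΩ : IsOpen Ω) (hΩD : Ω ⊆ Disk) (hu : ∀ k, ContDiffOn ℝ ∞ (u k) Ω)
    (hm : ∀ k, ∀ p ∈ Ω, mgOp (u k) p = 0) (hB : ∀ p ∈ Ω, ∃ C, ∀ k, gn (u k) p ≤ C)
    {l : List (Fin 2)} (hl : 1 ≤ l.length) : LB Ω (fun k => pdl l (u k)) := by
  have hr := LB_rr hΩ hΩD hu hm hB
  have key : ∀ n, 2 ≤ n → ∀ l : List (Fin 2), 1 ≤ l.length → l.length ≤ n →
      LB Ω (fun k => pdl l (u k)) := by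
    intro n hn
    induction n, hn using Nat.le_induction with
    | base =>
      intro l h1 h2
      match l, h1, h2 with
      | [i], _, _ => exact LB_pd hΩ (LB_gn hΩ hΩD hr) i
      | [i, j], _, _ => exact LB_pd_pd hΩ hΩD hu hm hr i j
      | _ :: _ :: _ :: _, _, h2 => simp at h2
    | succ n hn ih =>
      intro l h1 h2
      rcases h2.lt_or_eq with h2 | h2
      · exact ih l h1 (by omega)
      · exact LB_pdl_succ hΩ hΩD hu hm hn ih h2
  exact key (l.length + 2) (by omega) l hl (by omega)

end HigherBounds

/-! ### Compactness -/

section Compactness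

variable {Ω : Set E2}

lemma exists_uniform_lipschitz {ι : Type*} (hΩ : IsOpen Ω) {f : ι → E2 → ℝ}
    (hf : ∀ k, ContDiffOn ℝ ∞ (f k) Ω) (h : ∀ i, LB Ω (fun k => pd i (f k))) {x : E2} (hx : x ∈ Ω) :
    ∃ C, ∀ᶠ y in 𝓝 x, ∀ k, |f k y - f k x| ≤ C * ‖y - x‖ := by
  obtain ⟨C₀, h₀⟩ := h 0 x hx
  obtain ⟨C₁, h₁⟩ := h 1 x hx
  obtain ⟨r, hr, hsub⟩ := Metric.nhds_basis_ball.mem_iff.1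
    ((hΩ.eventually_mem hx).and (h₀.and h₁))
  refine ⟨C₀ + C₁, ?_⟩
  filter_upwards [Metric.ball_mem_nhds x hr] with y hy k
  refine (convex_ball x r).norm_image_sub_le_of_norm_fderiv_le (f := f k) (𝕜 := ℝ)
    (fun z hz => (hasD_pd hΩ (hf k) (hsub hz).1 0).1) (fun z hz => ?_) (Metric.mem_ball_self hr) hy
  have a₀ := (hsub hz).2.1 k
  have a₁ := (hsub hz).2.2 k
  refine ContinuousLinearMap.opNorm_le_bound _
    (add_nonneg ((abs_nonneg _).trans a₀) ((abs_nonneg _).trans a₁)) fun v => ?_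
  rw [fderiv_eq_pd, add_mul]
  refine (abs_add_le _ _).trans (add_le_add ?_ ?_)
  · rw [abs_mul, mul_comm]
    exact mul_le_mul a₀ (PiLp.norm_apply_le v 0) (abs_nonneg _) ((abs_nonneg _).trans a₀)
  · rw [abs_mul, mul_comm]
    exact mul_le_mul a₁ (PiLp.norm_apply_le v 1) (abs_nonneg _) ((abs_nonneg _).trans a₁)

lemma exists_bound_sub (hΩ : IsOpen Ω) (hc : IsPreconnected Ω) {ι : Type*} {f : ι → E2 → ℝ}
    (hf : ∀ k, ContDiffOn ℝ ∞ (f k) Ω) (h : ∀ i, LB Ω (fun k => pd i (f k))) {x p : E2}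
    (hx : x ∈ Ω) (hp : p ∈ Ω) : ∃ C, ∀ k, |f k x - f k p| ≤ C := by
  refine hc.induction₂ (fun x p => ∃ C, ∀ k, |f k x - f k p| ≤ C) (fun x hx => ?_) ?_ ?_ hx hp
  · obtain ⟨C, hC⟩ := exists_uniform_lipschitz hΩ hf h hx
    refine (hC.filter_mono nhdsWithin_le_nhds).mono fun y hy => ⟨C * ‖y - x‖, fun k => ?_⟩
    rw [abs_sub_comm]
    exact hy k
  · rintro x y z - - - ⟨C, hC⟩ ⟨D, hD⟩
    exact ⟨C + D, fun k => (abs_sub_le _ (f k y) _).trans (add_le_add (hC k) (hD k))⟩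
  · rintro x y - - ⟨C, hC⟩
    exact ⟨C, fun k => (abs_sub_comm _ _).trans_le (hC k)⟩

lemma isCompact_closure_range {X : Type*} [TopologicalSpace X] [LocallyCompactSpace X]
    (F : ℕ → C(X, ℝ)) (hE : Equicontinuous fun k => (F k : X → ℝ))
    (hb : ∀ x, ∃ C, ∀ k, |F k x| ≤ C) : IsCompact (closure (range F)) := by
  refine ArzelaAscoli.isCompact_closure_of_isClosedEmbedding (𝔖 := {K : Set X | IsCompact K})
    (F := fun f : C(X, ℝ) => (f : X → ℝ)) (fun K hK => hK) ?_ ?_ ?_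
  · refine ⟨ContinuousMap.isUniformEmbedding_toUniformOnFunIsCompact.isEmbedding, ?_⟩
    exact (congrArg IsClosed ContinuousMap.range_toUniformOnFunIsCompact).mpr
      (UniformOnFun.isClosed_setOfPred_continuous (β := ℝ)
        (CompactlyCoherentSpace.isCoherentWith (X := X)))
  · intro K _
    refine Equicontinuous.equicontinuousOn ?_ K
    intro x U hU
    filter_upwards [hE x U hU] with y hy
    rintro ⟨_, k, rfl⟩
    exact hy k
  · intro K _ x _
    obtain ⟨C, hC⟩ := hb x
    refine ⟨Metric.closedBall 0 C, isCompact_closedBall _ _, ?_⟩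
    rintro _ ⟨k, rfl⟩
    exact mem_closedBall_zero_iff.2 (hC k)

/-- A countable system of sequences of functions which are locally uniformly Lipschitz and
pointwise bounded has a common subsequence along which all of them converge. -/
lemma exists_common_subseq {κ : Type*} [Countable κ] (hΩ : IsOpen Ω) (f : κ → ℕ → E2 → ℝ)
    (hf : ∀ l k, ContinuousOn (f l k) Ω)
    (hL : ∀ l, ∀ x ∈ Ω, ∃ C, ∀ᶠ y in 𝓝 x, ∀ k, |f l k y - f l k x| ≤ C * ‖y - x‖)
    (hb : ∀ l, ∀ x ∈ Ω, ∃ C, ∀ k, |f l k x| ≤ C) :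
    ∃ φ : ℕ → ℕ, StrictMono φ ∧ ∃ V : κ → E2 → ℝ,
      ∀ l, TendstoLocallyUniformlyOn (fun j => f l (φ j)) (V l) atTop Ω := by
  have := hΩ.locallyCompactSpace
  let F : ℕ → κ → C(Ω, ℝ) := fun k l => ⟨Ω.domRestrict (f l k), (hf l k).domRestrict⟩
  have hcpt : ∀ l, IsCompact (closure (range fun k => F k l)) := fun l => by
    refine isCompact_closure_range _ (fun x => ?_) fun x => hb l x x.2
    obtain ⟨C, hC⟩ := hL l x x.2
    rw [Metric.equicontinuousAt_iff_right]
    intro ε hε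
    have h0 : Tendsto (fun y : Ω => C * ‖(y : E2) - x‖) (𝓝 x) (𝓝 0) := by
      have : Continuous fun y : Ω => C * ‖(y : E2) - x‖ := by fun_prop
      simpa using this.tendsto x
    filter_upwards [h0.eventually (gt_mem_nhds hε),
      (continuous_subtype_val.tendsto x).eventually hC] with y h1 h2 k
    rw [dist_comm]
    exact (h2 k).trans_lt h1
  obtain ⟨V, -, φ, hφ, hV⟩ := (isCompact_univ_pi hcpt).tendsto_subseq (x := F)
    fun k l _ => subset_closure ⟨k, rfl⟩
  refine ⟨φ, hφ, fun l => Function.extend Subtype.val (V l) 0, fun l => ?_⟩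
  have e : Function.extend Subtype.val (V l) 0 ∘ Subtype.val = V l :=
    Function.extend_comp Subtype.val_injective _ _
  refine tendstoLocallyUniformlyOn_iff_tendstoLocallyUniformly_comp_coe.2 ?_
  rw [e]
  exact ContinuousMap.tendsto_iff_tendstoLocallyUniformly.1 (tendsto_pi_nhds.1 hV l)

/-- The linear form with the given coordinates. -/
def formOf (a b : ℝ) : E2 →L[ℝ] ℝ :=
  a • EuclideanSpace.proj (0 : Fin 2) + b • EuclideanSpace.proj (1 : Fin 2)

lemma formOf_apply (a b : ℝ) (v : E2) : formOf a b v = v 0 * a + v 1 * b := by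
  simp [formOf, mul_comm]

lemma hasFDerivAt_formOf (hΩ : IsOpen Ω) {f : E2 → ℝ} (hf : ContDiffOn ℝ ∞ f Ω) {x : E2}
    (hx : x ∈ Ω) : HasFDerivAt f (formOf (pd 0 f x) (pd 1 f x)) x := by
  have h := (hasD_pd hΩ hf hx 0).1.hasFDerivAt
  convert h using 1
  ext v
  rw [fderiv_eq_pd, formOf_apply]

lemma tendsto_formOf {a b : ℕ → E2 → ℝ} {A B : E2 → ℝ}
    (ha : TendstoLocallyUniformlyOn a A atTop Ω) (hb : TendstoLocallyUniformlyOn b B atTop Ω) :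
    TendstoLocallyUniformlyOn (fun j x => formOf (a j x) (b j x)) (fun x => formOf (A x) (B x))
      atTop Ω := by
  have h := fun i : Fin 2 => (ContinuousLinearMap.toSpanSingleton ℝ
    (EuclideanSpace.proj i : E2 →L[ℝ] ℝ)).uniformContinuous
  exact ((h 0).comp_tendstoLocallyUniformlyOn ha).add ((h 1).comp_tendstoLocallyUniformlyOn hb)

/-- Derivatives pass to the limit when all derivatives converge locally uniformly. -/
lemma hasFDerivAt_limit (hΩ : IsOpen Ω) {f : ℕ → E2 → ℝ} (hf : ∀ k, ContDiffOn ℝ ∞ (f k) Ω)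
    {V : List (Fin 2) → E2 → ℝ}
    (hV : ∀ l, TendstoLocallyUniformlyOn (fun j => pdl l (f j)) (V l) atTop Ω) (l : List (Fin 2))
    {x : E2} (hx : x ∈ Ω) : HasFDerivAt (V l) (formOf (V (0 :: l) x) (V (1 :: l) x)) x :=
  hasFDerivAt_of_tendstoLocallyUniformlyOn hΩ (tendsto_formOf (hV (0 :: l)) (hV (1 :: l)))
    (fun j _ hy => hasFDerivAt_formOf hΩ (smooth_pdl hΩ (hf j) l) hy)
    (fun _ hy => (hV l).tendsto_at hy) hx

lemma contDiffOn_limit (hΩ : IsOpen Ω) {V : List (Fin 2) → E2 → ℝ}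
    (hV : ∀ l, ∀ x ∈ Ω, HasFDerivAt (V l) (formOf (V (0 :: l) x) (V (1 :: l) x)) x)
    (l : List (Fin 2)) : ContDiffOn ℝ ∞ (V l) Ω := by
  rw [contDiffOn_infty]
  intro n
  induction n generalizing l with
  | zero => exact contDiffOn_zero.2 fun x hx => (hV l x hx).continuousAt.continuousWithinAt
  | succ n ih =>
    refine (contDiffOn_succ_iff_hasFDerivWithinAt_of_uniqueDiffOn hΩ.uniqueDiffOn).2
      ⟨fun h => (WithTop.natCast_ne_top n h).elim, fun x => formOf (V (0 :: l) x) (V (1 :: l) x), ?_,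
        fun x hx => (hV l x hx).hasFDerivWithinAt⟩
    exact ((ih (0 :: l)).smul contDiffOn_const).add ((ih (1 :: l)).smul contDiffOn_const)

lemma pdl_limit (hΩ : IsOpen Ω) {V : List (Fin 2) → E2 → ℝ}
    (hV : ∀ l, ∀ x ∈ Ω, HasFDerivAt (V l) (formOf (V (0 :: l) x) (V (1 :: l) x)) x)
    (l : List (Fin 2)) : ∀ x ∈ Ω, pdl l (V []) x = V l x := by
  induction l with
  | nil => exact fun x _ => rfl
  | cons i l ih =>
    intro x hx
    have h : HasD (EuclideanSpace.single i 1) (V l) x (V (i :: l) x) := by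
      refine ⟨(hV l x hx).differentiableAt, ?_⟩
      rw [(hV l x hx).fderiv, formOf_apply]
      fin_cases i <;> simp
    exact (h.congr_on hΩ hx ih).2

lemma isMinimalGraph_limit (hΩ : IsOpen Ω) {f : ℕ → E2 → ℝ} (hf : ∀ k, ContDiffOn ℝ ∞ (f k) Ω)
    (hm : ∀ k, ∀ x ∈ Ω, mgOp (f k) x = 0) {V : List (Fin 2) → E2 → ℝ}
    (hV : ∀ l, TendstoLocallyUniformlyOn (fun j => pdl l (f j)) (V l) atTop Ω) :
    IsMinimalGraph Ω (V []) := by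
  have hD := fun l x hx => hasFDerivAt_limit hΩ hf hV l (x := x) hx
  refine (isMinimalGraph_iff hΩ).2 ⟨contDiffOn_limit hΩ hD [], fun x hx => ?_⟩
  have t : ∀ l, Tendsto (fun j => pdl l (f j) x) atTop (𝓝 (pdl l (V []) x)) := fun l => by
    rw [pdl_limit hΩ hD l x hx]
    exact (hV l).tendsto_at hx
  have t₁ : ∀ i, Tendsto (fun j => pd i (f j) x) atTop (𝓝 (pd i (V []) x)) := fun i => t [i]
  have t₂ : ∀ i i', Tendsto (fun j => pd i (pd i' (f j)) x) atTop (𝓝 (pd i (pd i' (V [])) x)) :=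
    fun i i' => t [i, i']
  have lim : Tendsto (fun j => mgOp (f j) x) atTop (𝓝 (mgOp (V []) x)) := by
    have s := ((t₁ 0).pow 2).add ((t₁ 1).pow 2)
    exact ((((s.const_mul _).const_add _).mul ((t₂ 0 0).add (t₂ 1 1))).sub
      ((((((t₁ 0).pow 2).mul (t₂ 0 0)).add ((((t₁ 0).const_mul _).mul (t₁ 1)).mul (t₂ 0 1))).add
        (((t₁ 1).pow 2).mul (t₂ 1 1))).const_mul _)).add
      ((s.const_mul _).mul (((t₁ 0).const_mul _).add ((t₁ 1).const_mul _)))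
  simp only [hm _ x hx] at lim
  exact tendsto_nhds_unique lim tendsto_const_nhds

lemma pd_sub_const (f : E2 → ℝ) (c : ℝ) (i : Fin 2) : pd i (fun x => f x - c) = pd i f := by
  funext x
  rw [pd, fderiv_sub_const, pd]

lemma pdl_sub_const (f : E2 → ℝ) (c : ℝ) {l : List (Fin 2)} (hl : 1 ≤ l.length) :
    pdl l (fun x => f x - c) = pdl l f := by
  induction l with
  | nil => simp at hl
  | cons i l ih =>
    rcases l with _ | ⟨j, l⟩
    · exact pd_sub_const f c i
    · exact congrArg (pd i) (ih (by simp))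

end Compactness

/-- **Compactness when the divergence set is empty** (Proposition `prop:div` 3):
if the gradients of a sequence of minimal graphs are bounded at every point of `Ω`,
then for every `p ∈ Ω` a subsequence of `{u_k − u_k(p)}` converges uniformly on compact
subsets of `Ω` to a minimal graph on `Ω`. -/
theorem subsequence_converges_of_empty_divergence_set (Ω : Set E2) (hΩ : IsOpen Ω)
    (hconn : IsConnected Ω) (hΩD : Ω ⊆ Disk)
    (u : ℕ → E2 → ℝ) (hu : ∀ k, IsMinimalGraph Ω (u k))
    (hB : DivergenceSet Ω u = ∅) :
    ∀ p ∈ Ω, ∃ φ : ℕ → ℕ, StrictMono φ ∧ ∃ v : E2 → ℝ, IsMinimalGraph Ω v ∧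
      ∀ K : Set E2, K ⊆ Ω → IsCompact K →
        TendstoUniformlyOn (fun j x => u (φ j) x - u (φ j) p) v atTop K := by
  intro p hp
  have hu' : ∀ k, ContDiffOn ℝ ∞ (u k) Ω := fun k => ((isMinimalGraph_iff hΩ).1 (hu k)).1
  have hm : ∀ k, ∀ x ∈ Ω, mgOp (u k) x = 0 := fun k => ((isMinimalGraph_iff hΩ).1 (hu k)).2
  have hbd : ∀ x ∈ Ω, ∃ C, ∀ k, gn (u k) x ≤ C := by
    intro x hx
    by_contra hcon
    have : x ∈ DivergenceSet Ω u := ⟨hx, by simpa only [gn_eq_norm] using hcon⟩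
    rw [hB] at this
    exact this
  have hLB : ∀ l : List (Fin 2), 1 ≤ l.length → LB Ω (fun k => pdl l (u k)) := fun l hl =>
    LB_pdl hΩ hΩD hu' hm hbd hl
  let f : ℕ → E2 → ℝ := fun k x => u k x - u k p
  have hpd : ∀ k, ∀ l : List (Fin 2), 1 ≤ l.length → pdl l (f k) = pdl l (u k) :=
    fun k l hl => pdl_sub_const (u k) (u k p) hl
  have hf : ∀ k, ContDiffOn ℝ ∞ (f k) Ω := fun k => (hu' k).sub contDiffOn_const
  have hfm : ∀ k, ∀ x ∈ Ω, mgOp (f k) x = 0 := by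
    intro k x hx
    have e : ∀ i, pd i (f k) = pd i (u k) := fun i => pd_sub_const _ _ i
    rw [← hm k x hx, mgOp, mgOp]
    simp only [e]
  obtain ⟨φ, hφ, V, hV⟩ := exists_common_subseq hΩ (fun l : List (Fin 2) => fun k => pdl l (f k))
    (fun l k => (smooth_pdl hΩ (hf k) l).continuousOn)
    (fun l x hx => exists_uniform_lipschitz hΩ (fun k => smooth_pdl hΩ (hf k) l)
      (fun i => by
        have := hLB (i :: l) (by simp)
        simp only [← hpd _ (i :: l) (by simp)] at this
        exact this) hx)
    (fun l x hx => by
      rcases l with _ | ⟨i, l⟩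
      · exact exists_bound_sub hΩ hconn.isPreconnected hu' (fun i => hLB [i] (by simp)) hx hp
      · obtain ⟨C, hC⟩ := hLB (i :: l) (by simp) x hx
        refine ⟨C, fun k => ?_⟩
        rw [hpd k _ (by simp)]
        exact hC.self_of_nhds k)
  refine ⟨φ, hφ, V [], isMinimalGraph_limit hΩ (fun j => hf (φ j)) (fun j => hfm (φ j)) hV, ?_⟩
  exact (tendstoLocallyUniformlyOn_iff_forall_isCompact hΩ).1 (hV [])

end
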